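/- Let n ≥ 2 be an integer, α ∈ ℝ, 0 < r ≤ 1, B = B_r(0) ⊂ ℝⁿ, γ ∈ ℝ, and p > 1. Let u ∈ C¹(B̄ \ {0}) satisfy ∫_B |x|^{npα} e^{pu} dx < ∞, |∇u| ∈ L^q(B) for every 1 ≤ q < n, and, for every C¹ function φ with compact support in B, ∫_B |∇u|^{n−2}⟨∇u, ∇φ⟩ dx = ∫_B |x|^{nα} e^{u} φ dx − γ φ(0). Let h ∈ C¹(B̄ \ {0}) satisfy |∇h| ∈ L^q(B) for every 1 ≤ q < n, h = u on ∂B, sup_{x ∈ B \ {0}} |h(x) − c_γ log|x|| < ∞, and, for every C¹ function φ with compact support in B, ∫_B |∇h|^{n−2}⟨∇h, ∇φ⟩ dx = −γ φ(0). Set u₀ = u − h, m = p/(p−1), and d = inf_{X ≠ Y} ⟨|X|^{n−2}X − |Y|^{n−2}Y, X − Y⟩/|X − Y|ⁿ. Then there exists C > 0, independent of q, such that for every real q ≥ 1, (∫_B u₀^{2mnq} dx)^{1/(2m)} ≤ (C q^{n−1}/d) |B|^{(n−1)/(mnq)} (∫_B |x|^{npα} e^{pu} dx)^{1/p} (∫_B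 u₀^{mnq} dx)^{(n(q−1)+1)/(mnq)}. -/

import Mathlib

open MeasureTheory Metric Filter Topology Real Set
open scoped InnerProductSpace

/-- The Lebesgue volume of the unit ball in `ℝⁿ`. -/
noncomputable def omegaN (n : ℕ) : ℝ :=
  (volume (ball (0 : EuclideanSpace ℝ (Fin n)) 1)).toReal

/-- `c_γ = sign γ * (|γ| / (n ωₙ))^{1/(n-1)}`. -/
noncomputable def cgamma (n : ℕ) (γ : ℝ) : ℝ :=
  Real.sign γ * (|γ| / ((n : ℝ) * omegaN n)) ^ ((1 : ℝ) / ((n : ℝ) - 1))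

/-- `u` is a weak solution of `-Δₙ u = f` on `U`. -/
def IsWeakNSol (n : ℕ) (U : Set (EuclideanSpace ℝ (Fin n)))
    (u f : EuclideanSpace ℝ (Fin n) → ℝ) : Prop :=
  ∀ φ : EuclideanSpace ℝ (Fin n) → ℝ, ContDiff ℝ 1 φ → HasCompactSupport φ →
    tsupport φ ⊆ U →
    ∫ x in U, ‖gradient u x‖ ^ (n - 2) * ⟪gradient u x, gradient φ x⟫_ℝ
      = ∫ x in U, f x * φ x

/-- The constant `d = inf_{X ≠ Y} ⟨|X|^{n-2}X - |Y|^{n-2}Y, X - Y⟩ / |X - Y|ⁿ`. -/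
noncomputable def dconst (n : ℕ) : ℝ :=
  sInf {c : ℝ | ∃ X Y : EuclideanSpace ℝ (Fin n), X ≠ Y ∧
    c = ⟪‖X‖ ^ (n - 2) • X - ‖Y‖ ^ (n - 2) • Y, X - Y⟫_ℝ / ‖X - Y‖ ^ n}

section Poincare

variable {E : Type*} [NormedAddCommGroup E] [NormedSpace ℝ E] 

lemma enorm_sub_pow_le {G : E → ℝ} {K : Set E} (hK : Convex ℝ K)
    (hKo : IsOpen K) (hG : ContDiffOn ℝ 1 G K) {N : ℕ} (hN : 1 ≤ N) {x y : E} (hx : x ∈ K)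
    (hy : y ∈ K) :
    ‖G x - G y‖ₑ ^ N ≤ ‖x - y‖ₑ ^ N *
      ∫⁻ t in Icc (0 : ℝ) 1, ‖fderiv ℝ G (t • y + (1 - t) • x)‖ₑ ^ N := by
  have hmem : ∀ t ∈ Icc (0 : ℝ) 1, t • y + (1 - t) • x ∈ K := fun t ht =>
    hK hy hx ht.1 (by linarith [ht.2]) (by ring)
  have hcf : ContinuousOn (fderiv ℝ G) K := hG.continuousOn_fderiv_of_isOpen hKo le_rfl
  have hcurve : Continuous (fun t : ℝ => t • y + (1 - t) • x) := by fun_prop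
  have hcont : ContinuousOn (fun t : ℝ => fderiv ℝ G (t • y + (1 - t) • x)) (Icc 0 1) :=
    hcf.comp hcurve.continuousOn hmem
  have hder : ∀ t ∈ uIcc (0 : ℝ) 1, HasDerivAt (fun t : ℝ => G (t • y + (1 - t) • x))
      (fderiv ℝ G (t • y + (1 - t) • x) (y - x)) t := by
    intro t ht
    rw [uIcc_of_le zero_le_one] at ht
    have h1 : HasFDerivAt G (fderiv ℝ G (t • y + (1 - t) • x)) (t • y + (1 - t) • x) :=
      ((hG.differentiableOn one_ne_zero).differentiableAt
        (hKo.mem_nhds (hmem t ht))).hasFDerivAt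
    have h2 : HasDerivAt (fun t : ℝ => t • y + (1 - t) • x) (y - x) t := by
      have := ((hasDerivAt_id t).smul_const y).add
        (((hasDerivAt_const t (1 : ℝ)).sub (hasDerivAt_id t)).smul_const x)
      have h3 : (1 : ℝ) • y + (0 - 1 : ℝ) • x = y - x := by simp [sub_eq_add_neg]
      rw [h3] at this
      exact this
    exact h1.comp_hasDerivAt t h2
  have hftc := intervalIntegral.integral_eq_sub_of_hasDerivAt hder (by
    apply ContinuousOn.intervalIntegrable
    rw [uIcc_of_le zero_le_one]
    exact hcont.clm_apply continuousOn_const)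
  simp only [one_smul, sub_self, zero_smul, add_zero, sub_zero, zero_add] at hftc
  have h1 : ‖G x - G y‖ₑ ≤ ‖x - y‖ₑ * ∫⁻ t in Icc (0 : ℝ) 1, ‖fderiv ℝ G (t • y + (1 - t) • x)‖ₑ := by
    rw [← enorm_neg (G x - G y), neg_sub, ← hftc, intervalIntegral.integral_of_le zero_le_one,
      ← integral_Icc_eq_integral_Ioc]
    refine (enorm_integral_le_lintegral_enorm _).trans ?_
    rw [← lintegral_const_mul' _ _ (by simp)]
    apply lintegral_mono
    intro t
    show ‖(fderiv ℝ G (t • y + (1 - t) • x)) (y - x)‖ₑ ≤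
      ‖x - y‖ₑ * ‖fderiv ℝ G (t • y + (1 - t) • x)‖ₑ
    rw [mul_comm, ← enorm_neg (x - y), neg_sub]
    exact ContinuousLinearMap.le_opENorm _ _
  refine (pow_le_pow_left' h1 N).trans ?_
  rw [mul_pow]
  gcongr
  have : IsProbabilityMeasure (volume.restrict (Icc (0 : ℝ) 1)) := ⟨by simp⟩
  have h2 := eLpNorm_le_eLpNorm_of_exponent_le (μ := volume.restrict (Icc (0 : ℝ) 1))
    (p := 1) (q := (N : ENNReal)) (by exact_mod_cast hN)
    (hcont.aestronglyMeasurable measurableSet_Icc)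
  have hN0 : (N : ENNReal) ≠ 0 := by simp; omega
  rw [eLpNorm_one_eq_lintegral_enorm, eLpNorm_eq_lintegral_rpow_enorm_toReal hN0 (by simp)] at h2
  refine (pow_le_pow_left' h2 N).trans ?_
  rw [← ENNReal.rpow_natCast, ← ENNReal.rpow_mul]
  have : (1 / (N : ENNReal).toReal * (N : ℝ)) = 1 := by
    simp; field_simp
  rw [this, ENNReal.rpow_one]
  simp

variable [FiniteDimensional ℝ E] [MeasurableSpace E] [BorelSpace E]

lemma lintegral_comp_smul_add_le (μ : Measure E) [μ.IsAddHaarMeasure] (g : E → ENNReal)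
    (hg : Measurable g) {t : ℝ} (ht : 1 / 2 ≤ t) (b : E) :
    ∫⁻ y, g (t • y + b) ∂μ ≤ 2 ^ Module.finrank ℝ E * ∫⁻ y, g y ∂μ := by
  have ht0 : t ≠ 0 := by linarith
  have h1 : ∫⁻ y, g (t • y + b) ∂μ = ∫⁻ y, g (y + b) ∂(Measure.map (fun x => t • x) μ) := by
    have := lintegral_map (μ := μ) (hg.comp (measurable_add_const b)) (measurable_const_smul t)
    simpa using this.symm
  rw [h1, Measure.map_addHaar_smul μ ht0, lintegral_smul_measure, smul_eq_mul,
    lintegral_add_right_eq_self]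
  gcongr
  have : |(t ^ Module.finrank ℝ E)⁻¹| ≤ 2 ^ Module.finrank ℝ E := by
    rw [abs_of_nonneg (by positivity), ← inv_pow]
    apply pow_le_pow_left₀ (by positivity)
    rw [inv_le_comm₀ (by linarith) (by norm_num)]
    linarith
  calc ENNReal.ofReal |(t ^ Module.finrank ℝ E)⁻¹|
      ≤ ENNReal.ofReal (2 ^ Module.finrank ℝ E) := ENNReal.ofReal_le_ofReal this
    _ = 2 ^ Module.finrank ℝ E := by
      rw [ENNReal.ofReal_pow (by norm_num)]; simp

lemma lintegral_segment_le (μ : Measure E) [μ.IsAddHaarMeasure] {K : Set E} (hK : Convex ℝ K)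
    (hKm : MeasurableSet K) (g : E → ENNReal) (hg : Measurable g) {t : ℝ} (ht : 1 / 2 ≤ t)
    (ht1 : t ≤ 1) {x : E} (hx : x ∈ K) :
    ∫⁻ y in K, g (t • y + (1 - t) • x) ∂μ ≤ 2 ^ Module.finrank ℝ E * ∫⁻ y in K, g y ∂μ := by
  calc ∫⁻ y in K, g (t • y + (1 - t) • x) ∂μ
      ≤ ∫⁻ y in K, K.indicator g (t • y + (1 - t) • x) ∂μ := by
        apply setLIntegral_mono' hKm
        intro y hy
        rw [indicator_of_mem]
        exact hK hy hx (by linarith) (by linarith) (by ring)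
    _ ≤ ∫⁻ y, K.indicator g (t • y + (1 - t) • x) ∂μ := setLIntegral_le_lintegral _ _
    _ ≤ 2 ^ Module.finrank ℝ E * ∫⁻ y, K.indicator g y ∂μ :=
        lintegral_comp_smul_add_le μ _ (hg.indicator hKm) ht _
    _ = _ := by rw [lintegral_indicator hKm]

lemma lintegral_lintegral_segment_le (μ : Measure E) [μ.IsAddHaarMeasure] {K : Set E}
    (hK : Convex ℝ K) (hKm : MeasurableSet K) (g : E → ENNReal) (hg : Measurable g) {t : ℝ}
    (ht0 : 0 ≤ t) (ht1 : t ≤ 1) :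
    ∫⁻ x in K, ∫⁻ y in K, g (t • y + (1 - t) • x) ∂μ ∂μ
      ≤ 2 ^ Module.finrank ℝ E * μ K * ∫⁻ y in K, g y ∂μ := by
  have key : ∀ s : ℝ, 1 / 2 ≤ s → s ≤ 1 →
      ∫⁻ x in K, ∫⁻ y in K, g (s • y + (1 - s) • x) ∂μ ∂μ
        ≤ 2 ^ Module.finrank ℝ E * μ K * ∫⁻ y in K, g y ∂μ := by
    intro s hs hs1
    calc ∫⁻ x in K, ∫⁻ y in K, g (s • y + (1 - s) • x) ∂μ ∂μ
        ≤ ∫⁻ x in K, 2 ^ Module.finrank ℝ E * ∫⁻ y in K, g y ∂μ ∂μ :=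
          setLIntegral_mono' hKm fun x hx => lintegral_segment_le μ hK hKm g hg hs hs1 hx
      _ = _ := by
          rw [lintegral_const, Measure.restrict_apply_univ]; ring
  by_cases h : 1 / 2 ≤ t
  · exact key t h ht1
  · rw [lintegral_lintegral_swap]
    · have := key (1 - t) (by linarith) (by linarith)
      simpa [add_comm] using this
    · apply Measurable.aemeasurable
      apply hg.comp
      fun_prop

/-- A Poincaré inequality for pairs of points of an open convex set. -/
lemma lintegral_lintegral_enorm_sub_pow_le (μ : Measure E) [μ.IsAddHaarMeasure] {G : E → ℝ}
    {K : Set E} (hK : Convex ℝ K) (hKo : IsOpen K) (hG : ContDiffOn ℝ 1 G K) {N : ℕ} (hN : 1 ≤ N)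
    {D : ENNReal} (hDt : D ≠ ⊤) (hD : ∀ x ∈ K, ∀ y ∈ K, ‖x - y‖ₑ ≤ D) :
    ∫⁻ x in K, ∫⁻ y in K, ‖G x - G y‖ₑ ^ N ∂μ ∂μ
      ≤ D ^ N * (2 ^ Module.finrank ℝ E * μ K * ∫⁻ y in K, ‖fderiv ℝ G y‖ₑ ^ N ∂μ) := by
  have hgm : Measurable fun y => ‖fderiv ℝ G y‖ₑ ^ N := (measurable_fderiv ℝ G).enorm.pow_const N
  calc ∫⁻ x in K, ∫⁻ y in K, ‖G x - G y‖ₑ ^ N ∂μ ∂μ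
      ≤ ∫⁻ x in K, ∫⁻ y in K, D ^ N *
          ∫⁻ t in Icc (0 : ℝ) 1, ‖fderiv ℝ G (t • y + (1 - t) • x)‖ₑ ^ N ∂volume ∂μ ∂μ := by
        apply setLIntegral_mono' hKo.measurableSet
        intro x hx
        apply setLIntegral_mono' hKo.measurableSet
        intro y hy
        refine (enorm_sub_pow_le hK hKo hG hN hx hy).trans ?_
        gcongr
        exact hD x hx y hy
    _ = D ^ N * ∫⁻ x in K, ∫⁻ y in K,
          ∫⁻ t in Icc (0 : ℝ) 1, ‖fderiv ℝ G (t • y + (1 - t) • x)‖ₑ ^ N ∂volume ∂μ ∂μ := by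
        have hDN : D ^ N ≠ ⊤ := ENNReal.pow_ne_top hDt
        rw [← lintegral_const_mul' _ _ hDN]
        congr 1; funext x
        rw [← lintegral_const_mul' _ _ hDN]
    _ = D ^ N * ∫⁻ t in Icc (0 : ℝ) 1, ∫⁻ x in K, ∫⁻ y in K,
          ‖fderiv ℝ G (t • y + (1 - t) • x)‖ₑ ^ N ∂μ ∂μ ∂volume := by
        congr 1
        have h1 : ∀ x, ∫⁻ y in K, ∫⁻ t in Icc (0 : ℝ) 1,
            ‖fderiv ℝ G (t • y + (1 - t) • x)‖ₑ ^ N ∂volume ∂μ = ∫⁻ t in Icc (0 : ℝ) 1,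
              ∫⁻ y in K, ‖fderiv ℝ G (t • y + (1 - t) • x)‖ₑ ^ N ∂μ ∂volume := by
          intro x
          apply lintegral_lintegral_swap
          exact (hgm.comp (f := fun z : E × ℝ => z.2 • z.1 + (1 - z.2) • x)
            (by fun_prop)).aemeasurable
        simp_rw [h1]
        apply lintegral_lintegral_swap
        apply Measurable.aemeasurable
        apply Measurable.lintegral_prod_right' (f := fun z : (E × ℝ) × E =>
          ‖fderiv ℝ G (z.1.2 • z.2 + (1 - z.1.2) • z.1.1)‖ₑ ^ N)
        exact hgm.comp (f := fun z : (E × ℝ) × E => z.1.2 • z.2 + (1 - z.1.2) • z.1.1)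
            (by fun_prop)
    _ ≤ D ^ N * ∫⁻ t in Icc (0 : ℝ) 1, 
          (2 ^ Module.finrank ℝ E * μ K * ∫⁻ y in K, ‖fderiv ℝ G y‖ₑ ^ N ∂μ) ∂volume := by
        refine mul_le_mul' le_rfl ?_
        apply setLIntegral_mono' measurableSet_Icc
        intro t ht
        exact lintegral_lintegral_segment_le μ hK hKo.measurableSet _ hgm ht.1 ht.2
    _ = _ := by simp

end Poincare

section ShellPoincare

/-- The part of the ball of radius `3ρ` on which the signed `i`-th coordinate is large. -/
def capSlab (n : ℕ) (ρ : ℝ) (i : Fin n) (σ : ℝ) : Set (EuclideanSpace ℝ (Fin n)) :=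
  ball 0 (3 * ρ) ∩ {x | ρ / (2 * n) < σ * x i}

/-- The open annulus `ρ / (2n) < |x| < 3ρ`. -/
def shell (n : ℕ) (ρ : ℝ) : Set (EuclideanSpace ℝ (Fin n)) :=
  ball 0 (3 * ρ) \ closedBall 0 (ρ / (2 * n))

/-- The closed annulus `ρ ≤ |x| ≤ 2ρ`. -/
def midShell (n : ℕ) (ρ : ℝ) : Set (EuclideanSpace ℝ (Fin n)) :=
  closedBall 0 (2 * ρ) \ ball 0 ρ

variable {n : ℕ} {ρ : ℝ}

lemma mem_capSlab {i : Fin n} {σ : ℝ} {x : EuclideanSpace ℝ (Fin n)} :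
    x ∈ capSlab n ρ i σ ↔ ‖x‖ < 3 * ρ ∧ ρ / (2 * n) < σ * x i := by
  simp [capSlab]

lemma mem_shell {x : EuclideanSpace ℝ (Fin n)} :
    x ∈ shell n ρ ↔ ρ / (2 * n) < ‖x‖ ∧ ‖x‖ < 3 * ρ := by
  simp [shell, and_comm]

lemma mem_midShell {x : EuclideanSpace ℝ (Fin n)} :
    x ∈ midShell n ρ ↔ ρ ≤ ‖x‖ ∧ ‖x‖ ≤ 2 * ρ := by
  simp [midShell, and_comm]

lemma isOpen_capSlab (i : Fin n) (σ : ℝ) : IsOpen (capSlab n ρ i σ) :=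
  isOpen_ball.inter
    (isOpen_lt continuous_const (continuous_const.mul (EuclideanSpace.proj (𝕜 := ℝ) i).continuous))

lemma convex_capSlab (i : Fin n) (σ : ℝ) : Convex ℝ (capSlab n ρ i σ) :=
  (convex_ball _ _).inter
    (convex_halfSpace_gt (σ • (EuclideanSpace.proj (𝕜 := ℝ) i).toLinearMap).isLinear _)

lemma measurableSet_shell : MeasurableSet (shell n ρ) :=
  measurableSet_ball.diff measurableSet_closedBall

lemma measurableSet_midShell : MeasurableSet (midShell n ρ) :=
  measurableSet_closedBall.diff measurableSet_ball

lemma capSlab_subset_shell {i : Fin n} {σ : ℝ} (hσ : |σ| = 1) :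
    capSlab n ρ i σ ⊆ shell n ρ := by
  intro x hx
  rw [mem_capSlab] at hx
  refine mem_shell.2 ⟨hx.2.trans_le ?_, hx.1⟩
  have h1 := PiLp.norm_apply_le x i
  rw [Real.norm_eq_abs] at h1
  calc σ * x i ≤ |σ * x i| := le_abs_self _
    _ = |x i| := by rw [abs_mul, hσ, one_mul]
    _ ≤ _ := h1

lemma midShell_subset_iUnion (hn : 1 ≤ n) (hρ : 0 < ρ) :
    midShell n ρ ⊆ ⋃ s : Fin n × Bool, capSlab n ρ s.1 (if s.2 then 1 else -1) := by
  intro x hx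
  rw [mem_midShell] at hx
  by_contra hcon
  simp only [mem_iUnion, Prod.exists, not_exists] at hcon
  have hn' : (1 : ℝ) ≤ n := by exact_mod_cast hn
  have h1 : ∀ i, (x i) ^ 2 ≤ (ρ / (2 * n)) ^ 2 := by
    intro i
    rw [sq_le_sq, abs_of_pos (by positivity : 0 < ρ / (2 * n)), abs_le]
    have ht := hcon i true
    have hf := hcon i false
    simp only [mem_capSlab, not_and, not_lt] at ht hf
    have hx3 : ‖x‖ < 3 * ρ := by linarith [hx.2]
    have := ht hx3
    have := hf hx3
    simp at *
    constructor <;> linarith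
  have h2 : ‖x‖ ^ 2 ≤ n * (ρ / (2 * n)) ^ 2 := by
    rw [EuclideanSpace.real_norm_sq_eq]
    refine (Finset.sum_le_sum fun i _ => h1 i).trans ?_
    simp
  have h3 : (n : ℝ) * (ρ / (2 * n)) ^ 2 = ρ ^ 2 / (4 * n) := by field_simp; ring
  have h4 : ρ ^ 2 / (4 * n) < ρ ^ 2 := by
    rw [div_lt_iff₀ (by positivity)]
    nlinarith [sq_pos_of_pos hρ]
  have h5 : ρ ^ 2 ≤ ‖x‖ ^ 2 := pow_le_pow_left₀ hρ.le hx.1 2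
  linarith

lemma volume_le_capSlab_inter (hn : 1 ≤ n) (hρ : 0 < ρ) {i j : Fin n} (hij : i ≠ j) {σ τ : ℝ}
    (hσ : |σ| = 1) (hτ : |τ| = 1) :
    volume (ball (0 : EuclideanSpace ℝ (Fin n)) (3 * ρ)) ≤
      12 ^ n * volume (capSlab n ρ i σ ∩ capSlab n ρ j τ) := by
  set z : EuclideanSpace ℝ (Fin n) :=
    EuclideanSpace.single i (6 / 5 * ρ * σ) + EuclideanSpace.single j (6 / 5 * ρ * τ) with hz
  have hn' : (1 : ℝ) ≤ n := by exact_mod_cast hn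
  have hsmall : ρ / (2 * n) ≤ ρ / 2 := by
    apply div_le_div_of_nonneg_left hρ.le (by norm_num); linarith
  have hznorm : ‖z‖ ≤ 12 / 5 * ρ := by
    refine (norm_add_le _ _).trans ?_
    rw [PiLp.norm_single, PiLp.norm_single]
    simp only [norm_mul, Real.norm_eq_abs, hσ, hτ, abs_of_pos hρ]
    norm_num; linarith
  have hσ2 : σ * σ = 1 := by rw [← abs_mul_abs_self, hσ]; norm_num
  have hτ2 : τ * τ = 1 := by rw [← abs_mul_abs_self, hτ]; norm_num
  have hzi : z i = 6 / 5 * ρ * σ := by simp [hz, hij]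
  have hzj : z j = 6 / 5 * ρ * τ := by simp [hz, hij.symm]
  have hcoord : ∀ x ∈ ball z (ρ / 4), ∀ (k : Fin n) (s : ℝ), |s| = 1 → s * s = 1 →
      z k = 6 / 5 * ρ * s → ρ / (2 * n) < s * x k := by
    intro x hx k s hs hs2 hzk
    have h1 := PiLp.norm_apply_le (x - z) k
    rw [mem_ball, dist_eq_norm] at hx
    rw [Real.norm_eq_abs, PiLp.sub_apply, hzk] at h1
    have h2 : |s * x k - 6 / 5 * ρ| ≤ ‖x - z‖ := by
      calc |s * x k - 6 / 5 * ρ| = |s * (x k - 6 / 5 * ρ * s)| := by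
            congr 1; linear_combination (6 / 5 * ρ) * hs2
        _ = |x k - 6 / 5 * ρ * s| := by rw [abs_mul, hs, one_mul]
        _ ≤ _ := h1
    have := (abs_le.1 h2).1
    linarith
  have hsub : ball z (ρ / 4) ⊆ capSlab n ρ i σ ∩ capSlab n ρ j τ := by
    intro x hx
    have hx3 : ‖x‖ < 3 * ρ := by
      have h1 : ‖x‖ ≤ ‖x - z‖ + ‖z‖ := by simpa using norm_add_le (x - z) z
      have h2 := hx
      rw [mem_ball, dist_eq_norm] at h2
      linarith
    exact ⟨mem_capSlab.2 ⟨hx3, hcoord x hx i σ hσ hσ2 hzi⟩,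
      mem_capSlab.2 ⟨hx3, hcoord x hx j τ hτ hτ2 hzj⟩⟩
  calc volume (ball (0 : EuclideanSpace ℝ (Fin n)) (3 * ρ))
      = 12 ^ n * volume (ball z (ρ / 4)) := by
        rw [Measure.addHaar_ball_of_pos _ _ (by positivity), Measure.addHaar_ball_of_pos _ z (by positivity),
          finrank_euclideanSpace_fin, ← mul_assoc]
        congr 1
        rw [show (12 : ENNReal) ^ n = ENNReal.ofReal (12 ^ n) by
          rw [ENNReal.ofReal_pow (by norm_num)]; norm_num, ← ENNReal.ofReal_mul (by positivity),
          ← mul_pow]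
        congr 2; ring
    _ ≤ _ := by gcongr

/-- The double integral of `|G x - G y|ⁿ`. -/
noncomputable def pairEnergy (G : EuclideanSpace ℝ (Fin n) → ℝ)
    (A B : Set (EuclideanSpace ℝ (Fin n))) : ENNReal :=
  ∫⁻ x in A, ∫⁻ y in B, ‖G x - G y‖ₑ ^ n

lemma pairEnergy_mono {G : EuclideanSpace ℝ (Fin n) → ℝ} {A A' B B' : Set (EuclideanSpace ℝ (Fin n))}
    (hA : A ⊆ A') (hB : B ⊆ B') : pairEnergy G A B ≤ pairEnergy G A' B' := by
  refine (lintegral_mono_set hA).trans ?_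
  exact lintegral_mono fun x => lintegral_mono_set hB

lemma pairEnergy_chain {G : EuclideanSpace ℝ (Fin n) → ℝ} (hG : Measurable G)
    (A I B : Set (EuclideanSpace ℝ (Fin n))) :
    volume I * pairEnergy G A B ≤
      2 ^ n * (volume B * pairEnergy G A I + volume A * pairEnergy G I B) := by
  have hpt : ∀ x y z, ‖G x - G y‖ₑ ^ n ≤ 2 ^ n * (‖G x - G z‖ₑ ^ n + ‖G z - G y‖ₑ ^ n) := by
    intro x y z
    have h1 : ‖G x - G y‖ₑ ≤ 2 * max ‖G x - G z‖ₑ ‖G z - G y‖ₑ := by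
      calc ‖G x - G y‖ₑ = ‖(G x - G z) + (G z - G y)‖ₑ := by ring_nf
        _ ≤ ‖G x - G z‖ₑ + ‖G z - G y‖ₑ := enorm_add_le _ _
        _ ≤ _ := by
          rw [two_mul]; gcongr
          · exact le_max_left _ _
          · exact le_max_right _ _
    refine (pow_le_pow_left' h1 n).trans ?_
    rw [mul_pow]
    gcongr
    rcases max_cases ‖G x - G z‖ₑ ‖G z - G y‖ₑ with h | h <;> rw [h.1]
    · exact le_self_add
    · exact le_add_self
  have hm2 : Measurable fun p : EuclideanSpace ℝ (Fin n) × EuclideanSpace ℝ (Fin n) =>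
      ‖G p.1 - G p.2‖ₑ ^ n := by fun_prop
  have hmx : ∀ x, Measurable fun y => ‖G x - G y‖ₑ ^ n := by intro x; fun_prop
  have hmy : ∀ y, Measurable fun x => ‖G x - G y‖ₑ ^ n := by intro x; fun_prop
  have hmi : ∀ S : Set (EuclideanSpace ℝ (Fin n)), 
      Measurable fun x => ∫⁻ y in S, ‖G x - G y‖ₑ ^ n := fun S => hm2.lintegral_prod_right'
  calc volume I * pairEnergy G A B
      = ∫⁻ z in I, ∫⁻ x in A, ∫⁻ y in B, ‖G x - G y‖ₑ ^ n := by
        rw [lintegral_const, Measure.restrict_apply_univ, mul_comm]; rfl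
    _ ≤ ∫⁻ z in I, ∫⁻ x in A, ∫⁻ y in B, 2 ^ n * (‖G x - G z‖ₑ ^ n + ‖G z - G y‖ₑ ^ n) :=
        lintegral_mono fun z => lintegral_mono fun x => lintegral_mono fun y => hpt x y z
    _ = ∫⁻ z in I, 2 ^ n * (volume B * (∫⁻ x in A, ‖G x - G z‖ₑ ^ n)
          + volume A * ∫⁻ y in B, ‖G z - G y‖ₑ ^ n) := by
        congr 1; funext z
        have h1 : ∀ x, ∫⁻ y in B, 2 ^ n * (‖G x - G z‖ₑ ^ n + ‖G z - G y‖ₑ ^ n)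
            = 2 ^ n * (volume B * ‖G x - G z‖ₑ ^ n + ∫⁻ y in B, ‖G z - G y‖ₑ ^ n) := by
          intro x
          rw [lintegral_const_mul' _ _ (by simp), lintegral_add_left measurable_const,
            lintegral_const, Measure.restrict_apply_univ, mul_comm (volume B)]
        simp_rw [h1]
        rw [lintegral_const_mul' _ _ (by simp), lintegral_add_right _ measurable_const,
          lintegral_const, Measure.restrict_apply_univ, lintegral_const_mul _ (hmy z), mul_comm (volume A)]
    _ = _ := by
        have h2 : Measurable fun z => ∫⁻ x in A, ‖G x - G z‖ₑ ^ n := hm2.lintegral_prod_left'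
        rw [lintegral_const_mul' _ _ (by simp), lintegral_add_left (h2.const_mul _),
          lintegral_const_mul _ h2, lintegral_const_mul _ (hmi B)]
        rw [lintegral_lintegral_swap]
        · rfl
        · exact (hm2.comp measurable_swap).aemeasurable

end ShellPoincare

section ShellPoincare

variable {n : ℕ} {ρ : ℝ}

lemma enorm_integral_pow_le {X : Type*} [MeasurableSpace X] (ν : Measure X)
    [IsProbabilityMeasure ν] {g : X → ℝ} (hg : AEStronglyMeasurable g ν) {N : ℕ} (hN : 1 ≤ N) :
    ‖∫ x, g x ∂ν‖ₑ ^ N ≤ ∫⁻ x, ‖g x‖ₑ ^ N ∂ν := by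
  have h2 := eLpNorm_le_eLpNorm_of_exponent_le (μ := ν)
    (p := 1) (q := (N : ENNReal)) (by exact_mod_cast hN) hg
  have hN0 : (N : ENNReal) ≠ 0 := by simp; omega
  rw [eLpNorm_one_eq_lintegral_enorm, eLpNorm_eq_lintegral_rpow_enorm_toReal hN0 (by simp)] at h2
  refine (pow_le_pow_left' ((enorm_integral_le_lintegral_enorm _).trans h2) N).trans ?_
  rw [← ENNReal.rpow_natCast, ← ENNReal.rpow_mul]
  have : (1 / (N : ENNReal).toReal * (N : ℝ)) = 1 := by
    simp; field_simp
  rw [this, ENNReal.rpow_one]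
  simp

lemma shell_subset_compl_zero (hρ : 0 < ρ) : shell n ρ ⊆ {0}ᶜ := by
  intro x hx
  rw [mem_shell] at hx
  have : 0 < ‖x‖ := lt_of_le_of_lt (by positivity) hx.1
  simpa using this

lemma midShell_subset_compl_zero (hρ : 0 < ρ) : midShell n ρ ⊆ {0}ᶜ := by
  intro x hx
  rw [mem_midShell] at hx
  have : 0 < ‖x‖ := by linarith
  simpa using this

lemma measurable_of_continuousOn_compl_singleton_zero {F : Type*} [TopologicalSpace F]
    [MeasurableSpace F] [BorelSpace F] {G : EuclideanSpace ℝ (Fin n) → F}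
    (hG : ContinuousOn G {0}ᶜ) : Measurable G :=
  measurable_of_continuousOn_compl_singleton 0 hG

lemma pairEnergy_capSlab_self_le (hn : 1 ≤ n) (hρ : 0 < ρ) {G : EuclideanSpace ℝ (Fin n) → ℝ}
    (hG : ContDiffOn ℝ 1 G {0}ᶜ) (i : Fin n) {σ : ℝ} (hσ : |σ| = 1) :
    pairEnergy G (capSlab n ρ i σ) (capSlab n ρ i σ) ≤
      ENNReal.ofReal (6 * ρ) ^ n * (2 ^ n * volume (ball (0 : EuclideanSpace ℝ (Fin n)) (3 * ρ)) *
        ∫⁻ y in shell n ρ, ‖fderiv ℝ G y‖ₑ ^ n) := by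
  have hsub := capSlab_subset_shell (n := n) (ρ := ρ) (i := i) hσ
  have h := lintegral_lintegral_enorm_sub_pow_le volume (convex_capSlab i σ)
    (isOpen_capSlab (ρ := ρ) i σ) (hG.mono (hsub.trans (shell_subset_compl_zero hρ))) hn
    (D := ENNReal.ofReal (6 * ρ)) ENNReal.ofReal_ne_top (by
      intro x hx y hy
      rw [mem_capSlab] at hx hy
      rw [← ofReal_norm]
      apply ENNReal.ofReal_le_ofReal
      have := norm_sub_le x y
      linarith [hx.1, hy.1])
  rw [finrank_euclideanSpace_fin] at h
  refine h.trans ?_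
  gcongr
  exact inter_subset_left

lemma le_of_volume_mul_le {a b c : ENNReal} (hb : b ≠ 0) (hb' : b ≠ ⊤) (h : b * a ≤ b * c) :
    a ≤ c := (ENNReal.mul_le_mul_iff_right hb hb').1 h

lemma pairEnergy_le_of_inter {G : EuclideanSpace ℝ (Fin n) → ℝ} (hG : Measurable G)
    {A I B : Set (EuclideanSpace ℝ (Fin n))} {b Q : ENNReal} (hb : b ≠ 0) (hb' : b ≠ ⊤)
    (hI : b ≤ 12 ^ n * volume I) (hA : volume A ≤ b) (hB : volume B ≤ b)
    (hAI : pairEnergy G A I ≤ Q) (hIB : pairEnergy G I B ≤ Q) :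
    pairEnergy G A B ≤ 12 ^ n * 2 ^ n * 2 * Q := by
  apply le_of_volume_mul_le hb hb'
  calc b * pairEnergy G A B ≤ 12 ^ n * (volume I * pairEnergy G A B) := by
        rw [← mul_assoc]; gcongr
    _ ≤ 12 ^ n * (2 ^ n * (volume B * pairEnergy G A I + volume A * pairEnergy G I B)) := by
        exact mul_le_mul_right (pairEnergy_chain hG A I B) _
    _ ≤ 12 ^ n * (2 ^ n * (b * Q + b * Q)) := by gcongr
    _ = _ := by ring

lemma pairEnergy_capSlab_le (hn : 2 ≤ n) (hρ : 0 < ρ) {G : EuclideanSpace ℝ (Fin n) → ℝ}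
    (hG : ContDiffOn ℝ 1 G {0}ᶜ) (i j : Fin n) {σ τ : ℝ} (hσ : |σ| = 1) (hτ : |τ| = 1) :
    pairEnergy G (capSlab n ρ i σ) (capSlab n ρ j τ) ≤
      (12 ^ n * 2 ^ n * 2) * ((12 ^ n * 2 ^ n * 2) *
      (ENNReal.ofReal (6 * ρ) ^ n * (2 ^ n * volume (ball (0 : EuclideanSpace ℝ (Fin n)) (3 * ρ)) *
        ∫⁻ y in shell n ρ, ‖fderiv ℝ G y‖ₑ ^ n))) := by
  set P := (ENNReal.ofReal (6 * ρ) ^ n * (2 ^ n *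
    volume (ball (0 : EuclideanSpace ℝ (Fin n)) (3 * ρ)) *
        ∫⁻ y in shell n ρ, ‖fderiv ℝ G y‖ₑ ^ n)) with hP
  have hGm : Measurable G := measurable_of_continuousOn_compl_singleton_zero hG.continuousOn
  have : Nonempty (Fin n) := ⟨i⟩
  have hb : volume (ball (0 : EuclideanSpace ℝ (Fin n)) (3 * ρ)) ≠ 0 :=
    (measure_ball_pos _ _ (by positivity)).ne'
  have hb' : volume (ball (0 : EuclideanSpace ℝ (Fin n)) (3 * ρ)) ≠ ⊤ := measure_ball_lt_top.ne
  have hvol : ∀ (k : Fin n) (s : ℝ), volume (capSlab n ρ k s) ≤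
      volume (ball (0 : EuclideanSpace ℝ (Fin n)) (3 * ρ)) :=
    fun k s => measure_mono inter_subset_left
  have hadj : ∀ (k l : Fin n), k ≠ l → ∀ s t : ℝ, |s| = 1 → |t| = 1 →
      pairEnergy G (capSlab n ρ k s) (capSlab n ρ l t) ≤ (12 ^ n * 2 ^ n * 2) * P := by
    intro k l hkl s t hs ht
    refine pairEnergy_le_of_inter hGm hb hb' (volume_le_capSlab_inter (by omega) hρ hkl hs ht)
      (hvol _ _) (hvol _ _) ?_ ?_
    · exact (pairEnergy_mono le_rfl inter_subset_left).trans
        (pairEnergy_capSlab_self_le (by omega) hρ hG k hs)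
    · exact (pairEnergy_mono inter_subset_right le_rfl).trans
        (pairEnergy_capSlab_self_le (by omega) hρ hG l ht)
  have hone : (1 : ENNReal) ≤ 12 ^ n * 2 ^ n * 2 := by
    have h1 : (1 : ENNReal) ≤ 12 ^ n := one_le_pow₀ (by norm_num)
    have h2 : (1 : ENNReal) ≤ 2 ^ n := one_le_pow₀ (by norm_num)
    calc (1 : ENNReal) = 1 * 1 * 1 := by norm_num
      _ ≤ _ := by gcongr; norm_num
  by_cases hij : i = j
  · subst hij
    have : Nontrivial (Fin n) := Fin.nontrivial_iff_two_le.2 hn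
    obtain ⟨k, hk⟩ := exists_ne i
    refine pairEnergy_le_of_inter hGm hb hb' (I := capSlab n ρ k 1) ?_ (hvol _ _) (hvol _ _)
      (hadj i k hk.symm _ _ hσ (by simp)) (hadj k i hk _ _ (by simp) hτ)
    refine (volume_le_capSlab_inter (by omega) hρ hk.symm hσ (τ := 1) (by simp)).trans ?_
    gcongr
    exact inter_subset_right
  · refine (hadj i j hij σ τ hσ hτ).trans ?_
    exact le_mul_of_one_le_left' hone

/-- A Poincaré inequality on dyadic annuli, with control of the mean value. -/
lemma exists_shell_poincare (hn : 2 ≤ n) :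
    ∃ C : ℝ, 0 < C ∧ ∀ ρ : ℝ, 0 < ρ → ∀ G : EuclideanSpace ℝ (Fin n) → ℝ,
      ContDiffOn ℝ 1 G {0}ᶜ → ∃ c : ℝ,
        ∫⁻ x in midShell n ρ, ‖G x - c‖ₑ ^ n ≤
          ENNReal.ofReal (C * ρ ^ n) * ∫⁻ y in shell n ρ, ‖fderiv ℝ G y‖ₑ ^ n ∧
        ‖c‖ₑ * ENNReal.ofReal (ρ ^ n) ≤ ENNReal.ofReal C * ∫⁻ y in shell n ρ, ‖G y‖ₑ := by
  set c₀ : ℝ := 12 ^ n * 2 ^ n * 2 with hc₀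
  set ω : ℝ := (volume (ball (0 : EuclideanSpace ℝ (Fin n)) 1)).toReal with hω
  have i₀ : Fin n := ⟨0, by omega⟩
  have : Nonempty (Fin n) := ⟨i₀⟩
  have hωpos : 0 < ω := ENNReal.toReal_pos (measure_ball_pos _ _ one_pos).ne' measure_ball_lt_top.ne
  set C : ℝ := max (12 ^ n * (2 * n * (c₀ * (c₀ * (6 ^ n * 2 ^ n))))) (12 ^ n / (3 ^ n * ω)) with hC
  refine ⟨C, lt_max_of_lt_right (by positivity), fun ρ hρ G hG => ?_⟩
  have hGm : Measurable G := measurable_of_continuousOn_compl_singleton_zero hG.continuousOn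
  set b := volume (ball (0 : EuclideanSpace ℝ (Fin n)) (3 * ρ)) with hbdef
  have hb : b ≠ 0 := (measure_ball_pos _ _ (by positivity)).ne'
  have hb' : b ≠ ⊤ := measure_ball_lt_top.ne
  have hbval : b = ENNReal.ofReal (3 ^ n * ω * ρ ^ n) := by
    rw [hbdef, Measure.addHaar_ball_of_pos _ _ (by positivity), finrank_euclideanSpace_fin,
      mul_pow, show (3 : ℝ) ^ n * ω * ρ ^ n = (3 ^ n * ρ ^ n) * ω by ring,
      ENNReal.ofReal_mul (p := 3 ^ n * ρ ^ n) (by positivity), hω,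
      ENNReal.ofReal_toReal measure_ball_lt_top.ne]
  set K := capSlab n ρ i₀ 1 with hK
  have hKsub : K ⊆ shell n ρ := capSlab_subset_shell (by simp)
  have : Nontrivial (Fin n) := Fin.nontrivial_iff_two_le.2 hn
  obtain ⟨k, hk⟩ := exists_ne i₀
  have hbK : b ≤ 12 ^ n * volume K := by
    refine (volume_le_capSlab_inter (by omega) hρ hk.symm (σ := 1) (by simp) (τ := 1)
      (by simp)).trans ?_
    gcongr
    exact inter_subset_left
  have hKb : volume K ≤ b := measure_mono inter_subset_left
  have hK0 : volume K ≠ 0 := by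
    intro h0; rw [h0] at hbK; simp at hbK; exact hb hbK
  have hKt : volume K ≠ ⊤ := (hKb.trans_lt hb'.lt_top).ne
  have hinv : (volume K)⁻¹ ≤ 12 ^ n * b⁻¹ := by
    rw [ENNReal.inv_le_iff_le_mul (fun _ => hK0) (fun h => absurd h hKt)]
    calc 1 = b * b⁻¹ := (ENNReal.mul_inv_cancel hb hb').symm
      _ ≤ (12 ^ n * volume K) * b⁻¹ := by gcongr
      _ = _ := by ring
  set ν : Measure (EuclideanSpace ℝ (Fin n)) := (volume K)⁻¹ • volume.restrict K with hν
  have hνp : IsProbabilityMeasure ν := ⟨by simp [hν, ENNReal.inv_mul_cancel hK0 hKt]⟩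
  have hGK : Integrable G ν := by
    refine Integrable.smul_measure ?_ (by simp [hK0])
    have hcomp : IsCompact (closedBall (0 : EuclideanSpace ℝ (Fin n)) (3 * ρ) \
        ball 0 (ρ / (2 * n))) := (isCompact_closedBall _ _).diff isOpen_ball
    refine IntegrableOn.mono_set (ContinuousOn.integrableOn_compact hcomp
      (hG.continuousOn.mono ?_)) ?_
    · rintro x ⟨-, hx⟩ rfl
      apply hx
      simp; positivity
    · exact hKsub.trans (sdiff_subset_sdiff ball_subset_closedBall ball_subset_closedBall)
  refine ⟨∫ y, G y ∂ν, ?_, ?_⟩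
  · have hpt : ∀ x, ‖G x - ∫ y, G y ∂ν‖ₑ ^ n ≤ (volume K)⁻¹ * ∫⁻ y in K, ‖G x - G y‖ₑ ^ n := by
      intro x
      have h1 : G x - ∫ y, G y ∂ν = ∫ y, (G x - G y) ∂ν := by
        rw [integral_sub (integrable_const _) hGK]; simp
      rw [h1]
      refine (enorm_integral_pow_le ν (by fun_prop) (by omega)).trans ?_
      rw [hν, lintegral_smul_measure, smul_eq_mul]
    set X := ∫⁻ y in shell n ρ, ‖fderiv ℝ G y‖ₑ ^ n with hX
    calc ∫⁻ x in midShell n ρ, ‖G x - ∫ y, G y ∂ν‖ₑ ^ n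
        ≤ ∫⁻ x in midShell n ρ, (volume K)⁻¹ * ∫⁻ y in K, ‖G x - G y‖ₑ ^ n :=
          lintegral_mono fun x => hpt x
      _ = (volume K)⁻¹ * pairEnergy G (midShell n ρ) K := by
          rw [lintegral_const_mul' _ _ (by simp [hK0])]; rfl
      _ ≤ (12 ^ n * b⁻¹) * (∑ s : Fin n × Bool,
            pairEnergy G (capSlab n ρ s.1 (if s.2 then 1 else -1)) K) := by
          gcongr
          refine (pairEnergy_mono (midShell_subset_iUnion (by omega) hρ) le_rfl).trans ?_
          refine (lintegral_iUnion_le _ _).trans ?_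
          rw [tsum_fintype]; rfl
      _ ≤ (12 ^ n * b⁻¹) * (∑ s : Fin n × Bool, (12 ^ n * 2 ^ n * 2) * ((12 ^ n * 2 ^ n * 2) *
            (ENNReal.ofReal (6 * ρ) ^ n * (2 ^ n * b * X)))) := by
          gcongr with s
          exact pairEnergy_capSlab_le hn hρ hG _ _ (by split_ifs <;> simp) (by simp)
      _ = (b⁻¹ * b) * ENNReal.ofReal ((12 ^ n * (2 * n * (c₀ * (c₀ * (6 ^ n * 2 ^ n))))) * ρ ^ n) * X := by
          have e1 : ENNReal.ofReal ((12 ^ n * (2 * n * (c₀ * (c₀ * (6 ^ n * 2 ^ n))))) * ρ ^ n)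
            = 12 ^ n * (2 * n * ((12 ^ n * 2 ^ n * 2) * ((12 ^ n * 2 ^ n * 2) *
              (6 ^ n * 2 ^ n)))) * ENNReal.ofReal ρ ^ n := by
            have e2 : ENNReal.ofReal c₀ = 12 ^ n * 2 ^ n * 2 := by
              rw [hc₀, ENNReal.ofReal_mul (by positivity), ENNReal.ofReal_mul (by positivity),
                ENNReal.ofReal_pow (by norm_num), ENNReal.ofReal_pow (by norm_num)]
              norm_num
            have hc₀pos : 0 < c₀ := by positivity
            rw [← e2]
            clear_value c₀
            rw [ENNReal.ofReal_mul (by positivity), ENNReal.ofReal_mul (by positivity),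
              ENNReal.ofReal_mul (by positivity), ENNReal.ofReal_mul (by positivity),
              ENNReal.ofReal_mul (by positivity), ENNReal.ofReal_mul (by positivity),
              ENNReal.ofReal_mul (by positivity), ENNReal.ofReal_pow (by positivity),
              ENNReal.ofReal_pow (by positivity), ENNReal.ofReal_pow (by positivity),
              ENNReal.ofReal_pow (by positivity)]
            norm_num
          rw [e1, ENNReal.ofReal_mul (by norm_num), mul_pow, Finset.sum_const]
          simp only [Finset.card_univ, Fintype.card_prod, Fintype.card_fin, Fintype.card_bool,
            nsmul_eq_mul]
          push_cast
          norm_num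
          ring
      _ ≤ ENNReal.ofReal (C * ρ ^ n) * X := by
          rw [ENNReal.inv_mul_cancel hb hb', one_mul]
          gcongr
          exact le_max_left _ _
  · have hE : ‖∫ y, G y ∂ν‖ₑ ≤ (12 ^ n * b⁻¹) * ∫⁻ y in shell n ρ, ‖G y‖ₑ := by
      refine (enorm_integral_le_lintegral_enorm _).trans ?_
      rw [hν, lintegral_smul_measure, smul_eq_mul]
      gcongr
    calc _ ≤ (12 ^ n * b⁻¹) * (∫⁻ y in shell n ρ, ‖G y‖ₑ) * ENNReal.ofReal (ρ ^ n) := by gcongr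
      _ = (12 ^ n * b⁻¹ * ENNReal.ofReal (ρ ^ n)) * ∫⁻ y in shell n ρ, ‖G y‖ₑ := by ring
      _ ≤ _ := by
        gcongr
        have : (12 : ENNReal) ^ n = ENNReal.ofReal (12 ^ n) := by
          rw [ENNReal.ofReal_pow (by norm_num)]; norm_num
        rw [hbval, this, ← ENNReal.ofReal_inv_of_pos (by positivity),
          ← ENNReal.ofReal_mul (by positivity), ← ENNReal.ofReal_mul (by positivity)]
        apply ENNReal.ofReal_le_ofReal
        refine le_trans (le_of_eq ?_) (le_max_right _ _)
        field_simp

end ShellPoincare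

section Cutoff

variable {n : ℕ} {ρ r : ℝ}

/-- A fixed smooth bump, equal to `1` on the unit ball and supported in the ball of radius `2`. -/
noncomputable def unitBump (n : ℕ) : ContDiffBump (0 : EuclideanSpace ℝ (Fin n)) :=
  ⟨1, 2, one_pos, one_lt_two⟩

/-- A smooth function vanishing on the ball of radius `ρ` and equal to `1` off the ball of radius
`2ρ`. -/
noncomputable def cut (n : ℕ) (ρ : ℝ) (x : EuclideanSpace ℝ (Fin n)) : ℝ :=
  1 - unitBump n (ρ⁻¹ • x)

lemma contDiff_cut : ContDiff ℝ 1 (cut n ρ) := by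
  unfold cut
  exact contDiff_const.sub ((unitBump n).contDiff.comp (contDiff_const_smul _))

lemma cut_nonneg (x : EuclideanSpace ℝ (Fin n)) : 0 ≤ cut n ρ x :=
  sub_nonneg.2 (unitBump n).le_one

lemma cut_le_one (x : EuclideanSpace ℝ (Fin n)) : cut n ρ x ≤ 1 :=
  sub_le_self _ (unitBump n).nonneg

lemma cut_eq_zero (hρ : 0 < ρ) {x : EuclideanSpace ℝ (Fin n)} (hx : ‖x‖ ≤ ρ) : cut n ρ x = 0 := by
  unfold cut
  rw [(unitBump n).one_of_mem_closedBall, sub_self]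
  rw [mem_closedBall, dist_zero_right, norm_smul, norm_inv, Real.norm_eq_abs, abs_of_pos hρ,
    inv_mul_le_iff₀ hρ]
  simpa [unitBump] using hx

lemma cut_eq_one (hρ : 0 < ρ) {x : EuclideanSpace ℝ (Fin n)} (hx : 2 * ρ ≤ ‖x‖) :
    cut n ρ x = 1 := by
  unfold cut
  rw [(unitBump n).zero_of_le_dist, sub_zero]
  rw [dist_zero_right, norm_smul, norm_inv, Real.norm_eq_abs, abs_of_pos hρ,
    le_inv_mul_iff₀ hρ]
  simp only [unitBump]; linarith

lemma exists_norm_fderiv_cut_le (n : ℕ) :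
    ∃ M : ℝ, 0 < M ∧ ∀ ρ : ℝ, 0 < ρ → ∀ x, ‖fderiv ℝ (cut n ρ) x‖ ≤ M / ρ := by
  have hcd : ContDiff ℝ 1 (unitBump n) := (unitBump n).contDiff
  have hcont : Continuous (fderiv ℝ (unitBump n)) := hcd.continuous_fderiv one_ne_zero
  obtain ⟨M, hM⟩ := ((unitBump n).hasCompactSupport.fderiv (𝕜 := ℝ)).exists_bound_of_continuous hcont
  refine ⟨max M 1, by positivity, fun ρ hρ x => ?_⟩
  have h1 : fderiv ℝ (cut n ρ) x = -(ρ⁻¹ • fderiv ℝ (unitBump n) (ρ⁻¹ • x)) := by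
    unfold cut
    rw [fderiv_const_sub, fderiv_comp_smul]
  rw [h1, norm_neg, norm_smul, norm_inv, Real.norm_eq_abs, abs_of_pos hρ, div_eq_inv_mul]
  gcongr
  exact (hM _).trans (le_max_left _ _)

lemma fderiv_cut_eq_zero_of_lt (hρ : 0 < ρ) {x : EuclideanSpace ℝ (Fin n)} (hx : ‖x‖ < ρ) :
    fderiv ℝ (cut n ρ) x = 0 := by
  have : cut n ρ =ᶠ[𝓝 x] fun _ => 0 := by
    filter_upwards [(isOpen_lt continuous_norm continuous_const).mem_nhds hx] with y hy
    exact cut_eq_zero hρ (le_of_lt hy)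
  rw [this.fderiv_eq]; simp

lemma fderiv_cut_eq_zero_of_gt (hρ : 0 < ρ) {x : EuclideanSpace ℝ (Fin n)} (hx : 2 * ρ < ‖x‖) :
    fderiv ℝ (cut n ρ) x = 0 := by
  have : cut n ρ =ᶠ[𝓝 x] fun _ => 1 := by
    filter_upwards [(isOpen_lt continuous_const continuous_norm).mem_nhds hx] with y hy
    exact cut_eq_one hρ (le_of_lt hy)
  rw [this.fderiv_eq]; simp

lemma fderiv_cut_eq_zero (hρ : 0 < ρ) {x : EuclideanSpace ℝ (Fin n)} (hx : x ∉ midShell n ρ) :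
    fderiv ℝ (cut n ρ) x = 0 := by
  rw [mem_midShell, not_and_or, not_le, not_le] at hx
  exact hx.elim (fderiv_cut_eq_zero_of_lt hρ) (fderiv_cut_eq_zero_of_gt hρ)

/-- `G` is `C¹` off the origin and vanishes near and beyond the sphere of radius `r`. -/
structure PuncturedTest (n : ℕ) (r : ℝ) (G : EuclideanSpace ℝ (Fin n) → ℝ) : Prop where
  contDiffOn : ContDiffOn ℝ 1 G {0}ᶜ
  vanish : ∃ R : ℝ, 0 < R ∧ R < r ∧ ∀ x, R ≤ ‖x‖ → G x = 0

lemma isOpen_compl_zero : IsOpen ({0}ᶜ : Set (EuclideanSpace ℝ (Fin n))) :=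
  isOpen_compl_singleton

namespace PuncturedTest

variable {G : EuclideanSpace ℝ (Fin n) → ℝ}

lemma measurable (hG : PuncturedTest n r G) : Measurable G :=
  measurable_of_continuousOn_compl_singleton_zero hG.contDiffOn.continuousOn

lemma continuousOn_fderiv (hG : PuncturedTest n r G) : ContinuousOn (fderiv ℝ G) {0}ᶜ :=
  hG.contDiffOn.continuousOn_fderiv_of_isOpen isOpen_compl_zero le_rfl

lemma measurable_fderiv (hG : PuncturedTest n r G) : Measurable (fderiv ℝ G) :=
  measurable_of_continuousOn_compl_singleton_zero hG.continuousOn_fderiv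

lemma differentiableAt (hG : PuncturedTest n r G) {x : EuclideanSpace ℝ (Fin n)} (hx : x ≠ 0) :
    DifferentiableAt ℝ G x :=
  (hG.contDiffOn.differentiableOn one_ne_zero).differentiableAt (isOpen_compl_zero.mem_nhds hx)

lemma fderiv_vanish (hG : PuncturedTest n r G) :
    ∃ R : ℝ, 0 < R ∧ R < r ∧ (∀ x, R ≤ ‖x‖ → G x = 0) ∧ ∀ x, R < ‖x‖ → fderiv ℝ G x = 0 := by
  obtain ⟨R, h0, hr, hR⟩ := hG.vanish
  refine ⟨R, h0, hr, hR, fun x hx => ?_⟩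
  have : G =ᶠ[𝓝 x] fun _ => 0 := by
    filter_upwards [(isOpen_lt continuous_const continuous_norm).mem_nhds hx] with y hy
    exact hR y (le_of_lt hy)
  rw [this.fderiv_eq]; simp

lemma contDiff_cut_mul (hG : PuncturedTest n r G) (hρ : 0 < ρ) :
    ContDiff ℝ 1 (fun x => cut n ρ x * G x) := by
  rw [contDiff_iff_contDiffAt]
  intro x
  by_cases hx : x = 0
  · subst hx
    have : (fun x => cut n ρ x * G x) =ᶠ[𝓝 0] fun _ => 0 := by
      filter_upwards [ball_mem_nhds 0 hρ] with y hy
      rw [mem_ball_zero_iff] at hy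
      rw [cut_eq_zero hρ hy.le, zero_mul]
    exact contDiffAt_const.congr_of_eventuallyEq this
  · exact contDiff_cut.contDiffAt.mul (hG.contDiffOn.contDiffAt (isOpen_compl_zero.mem_nhds hx))

lemma tsupport_cut_mul (hG : PuncturedTest n r G) :
    tsupport (fun x => cut n ρ x * G x) ⊆ ball 0 r := by
  obtain ⟨R, h0, hr, hR⟩ := hG.vanish
  refine (closure_minimal ?_ (isClosed_closedBall (x := 0) (ε := R))).trans
    (closedBall_subset_ball hr)
  intro x hx
  rw [mem_closedBall_zero_iff]
  by_contra hcon
  exact hx (by simp [hR x (not_le.1 hcon).le])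

lemma hasCompactSupport_cut_mul (hG : PuncturedTest n r G) :
    HasCompactSupport (fun x => cut n ρ x * G x) :=
  (isCompact_closedBall (0 : EuclideanSpace ℝ (Fin n)) r).of_isClosed_subset (isClosed_tsupport _)
    (hG.tsupport_cut_mul.trans ball_subset_closedBall)

lemma fderiv_cut_mul (hG : PuncturedTest n r G) {x : EuclideanSpace ℝ (Fin n)} (hx : x ≠ 0) :
    fderiv ℝ (fun x => cut n ρ x * G x) x = cut n ρ x • fderiv ℝ G x + G x • fderiv ℝ (cut n ρ) x :=
  fderiv_fun_mul (contDiff_cut.differentiable one_ne_zero x) (hG.differentiableAt hx)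

end PuncturedTest

/-- A function continuous off the origin that vanishes off a compact annulus is integrable. -/
lemma integrable_of_annulus {F : EuclideanSpace ℝ (Fin n) → ℝ} {δ R : ℝ} (hδ : 0 < δ) (hR : R < r)
    (hF : ContinuousOn F (ball 0 r \ {0})) (h1 : ∀ x, ‖x‖ < δ → F x = 0)
    (h2 : ∀ x, R < ‖x‖ → F x = 0) : Integrable F := by
  have hcomp : IsCompact (closedBall (0 : EuclideanSpace ℝ (Fin n)) R \ ball 0 δ) :=
    (isCompact_closedBall _ _).diff isOpen_ball
  have hsub : closedBall (0 : EuclideanSpace ℝ (Fin n)) R \ ball 0 δ ⊆ ball 0 r \ {0} := by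
    refine sdiff_subset_sdiff (closedBall_subset_ball hR) ?_
    rw [singleton_subset_iff]; exact mem_ball_self hδ
  refine ((hF.mono hsub).integrableOn_compact hcomp).integrable_of_forall_notMem_eq_zero ?_
  intro x hx
  rw [Set.mem_sdiff, mem_closedBall_zero_iff, mem_ball_zero_iff, not_and_or, not_not, not_le] at hx
  exact hx.elim (h2 x) (h1 x)

end Cutoff

section SingularData

/-- The difference `w` of two solutions with the same singular part: `V` is the difference of the
two fluxes, `H` bounds the gradient of the reference solution and `f` is the right-hand side. -/
structure SingularData (n : ℕ) (r p d : ℝ) (w f H : EuclideanSpace ℝ (Fin n) → ℝ)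
    (V : EuclideanSpace ℝ (Fin n) → EuclideanSpace ℝ (Fin n)) : Prop where
  two_le : 2 ≤ n
  r_pos : 0 < r
  one_lt : 1 < p
  d_pos : 0 < d
  w_diff : ContDiffOn ℝ 1 w (ball 0 r \ {0})
  w_cont : ContinuousOn w (closedBall 0 r \ {0})
  w_bdry : ∀ x, ‖x‖ = r → w x = 0
  V_cont : ContinuousOn V (ball 0 r \ {0})
  H_cont : ContinuousOn H (ball 0 r \ {0})
  H_nonneg : ∀ x, 0 ≤ H x
  V_le : ∀ x ∈ ball (0 : EuclideanSpace ℝ (Fin n)) r \ {0},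
    ‖V x‖ ≤ 2 * (‖fderiv ℝ w x‖ + H x) ^ (n - 1)
  V_ge : ∀ x ∈ ball (0 : EuclideanSpace ℝ (Fin n)) r \ {0},
    d * ‖fderiv ℝ w x‖ ^ n ≤ fderiv ℝ w x (V x)
  grad_int : ∀ q : ℝ, 1 ≤ q → q < n →
    IntegrableOn (fun x => (‖fderiv ℝ w x‖ + H x) ^ q) (ball 0 r)
  f_nonneg : ∀ x, 0 ≤ f x
  f_meas : Measurable f
  f_pow : IntegrableOn (fun x => f x ^ p) (ball 0 r)
  weak : ∀ φ : EuclideanSpace ℝ (Fin n) → ℝ, ContDiff ℝ 1 φ → HasCompactSupport φ →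
    tsupport φ ⊆ ball 0 r →
    ∫ x in ball (0 : EuclideanSpace ℝ (Fin n)) r, fderiv ℝ φ x (V x) =
      ∫ x in ball (0 : EuclideanSpace ℝ (Fin n)) r, f x * φ x
  H_shell : ∃ C : ENNReal, C ≠ ⊤ ∧ ∀ ρ : ℝ, 0 < ρ → 6 * ρ < r →
    ∫⁻ x in shell n ρ, ENNReal.ofReal (H x) ^ n ≤ C

lemma pow_mul_le_young {n : ℕ} (hn : 1 ≤ n) (a b : ENNReal) {l : ENNReal} (hl : l ≠ 0)
    (hl' : l ≠ ⊤) : a ^ (n - 1) * b ≤ l * a ^ n + l⁻¹ ^ (n - 1) * b ^ n := by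
  obtain ⟨k, rfl⟩ : ∃ k, n = k + 1 := ⟨n - 1, by omega⟩
  simp only [Nat.add_sub_cancel]
  rcases le_total b (l * a) with h | h
  · calc a ^ k * b ≤ a ^ k * (l * a) := by gcongr
      _ = l * a ^ (k + 1) := by ring
      _ ≤ _ := le_self_add
  · have h2 : a ≤ l⁻¹ * b := by
      calc a = l⁻¹ * (l * a) := by rw [← mul_assoc, ENNReal.inv_mul_cancel hl hl', one_mul]
        _ ≤ _ := by gcongr
    calc a ^ k * b ≤ (l⁻¹ * b) ^ k * b := by gcongr
      _ = l⁻¹ ^ k * b ^ (k + 1) := by ring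
      _ ≤ _ := le_add_self

namespace SingularData

variable {n : ℕ} {r p d : ℝ} {w f H : EuclideanSpace ℝ (Fin n) → ℝ}
  {V : EuclideanSpace ℝ (Fin n) → EuclideanSpace ℝ (Fin n)}

/-- The combined gradient size. -/
noncomputable def slope (w H : EuclideanSpace ℝ (Fin n) → ℝ) (x : EuclideanSpace ℝ (Fin n)) :
    ENNReal := ENNReal.ofReal (‖fderiv ℝ w x‖ + H x)

lemma isOpen_punctured : IsOpen (ball (0 : EuclideanSpace ℝ (Fin n)) r \ {0}) :=
  isOpen_ball.sdiff isClosed_singleton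

lemma mem_punctured {x : EuclideanSpace ℝ (Fin n)} :
    x ∈ ball (0 : EuclideanSpace ℝ (Fin n)) r \ {0} ↔ ‖x‖ < r ∧ x ≠ 0 := by simp

variable (S : SingularData n r p d w f H V)
include S

lemma continuousOn_fderiv : ContinuousOn (fderiv ℝ w) (ball 0 r \ {0}) :=
  S.w_diff.continuousOn_fderiv_of_isOpen isOpen_punctured le_rfl

lemma differentiableAt {x : EuclideanSpace ℝ (Fin n)} (hx : ‖x‖ < r) (hx0 : x ≠ 0) :
    DifferentiableAt ℝ w x :=
  (S.w_diff.differentiableOn one_ne_zero).differentiableAt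
    (isOpen_punctured.mem_nhds (mem_punctured.2 ⟨hx, hx0⟩))

lemma f_integrableOn : IntegrableOn f (ball 0 r) := by
  have hfin : IsFiniteMeasure (volume.restrict (ball (0 : EuclideanSpace ℝ (Fin n)) r)) :=
    ⟨by simp [measure_ball_lt_top]⟩
  refine Integrable.mono' ((integrable_const (1 : ℝ)).add S.f_pow) S.f_meas.aestronglyMeasurable ?_
  filter_upwards with x
  rw [Real.norm_eq_abs, abs_of_nonneg (S.f_nonneg x), Pi.add_apply]
  rcases le_total (f x) 1 with h | h
  · linarith [Real.rpow_nonneg (S.f_nonneg x) p]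
  · linarith [Real.self_le_rpow_of_one_le h S.one_lt.le]

lemma enorm_V_le {x : EuclideanSpace ℝ (Fin n)} (hx : ‖x‖ < r) (hx0 : x ≠ 0) :
    ‖V x‖ₑ ≤ 2 * slope w H x ^ (n - 1) := by
  have h2 : (2 : ENNReal) = ENNReal.ofReal 2 := by norm_num
  rw [slope, ← ofReal_norm, ← ENNReal.ofReal_pow (add_nonneg (norm_nonneg _) (S.H_nonneg x))]
  refine le_trans ?_ (mul_le_mul_left h2.ge _)
  rw [← ENNReal.ofReal_mul (by norm_num)]
  exact ENNReal.ofReal_le_ofReal (S.V_le x (mem_punctured.2 ⟨hx, hx0⟩))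

lemma integrable_cut_fderiv {G : EuclideanSpace ℝ (Fin n) → ℝ} (hG : PuncturedTest n r G) {ρ : ℝ}
    (hρ : 0 < ρ) : IntegrableOn (fun x => cut n ρ x * fderiv ℝ G x (V x)) (ball 0 r) := by
  obtain ⟨R, h0, hr, hR, hR'⟩ := hG.fderiv_vanish
  refine (integrable_of_annulus hρ hr ?_ ?_ ?_).integrableOn
  · exact contDiff_cut.continuous.continuousOn.mul
      ((hG.continuousOn_fderiv.mono fun x hx => hx.2).clm_apply S.V_cont)
  · intro x hx; rw [cut_eq_zero hρ hx.le, zero_mul]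
  · intro x hx; simp [hR' x hx]

lemma integrable_mul_fderiv_cut {G : EuclideanSpace ℝ (Fin n) → ℝ} (hG : ContinuousOn G {0}ᶜ)
    {ρ : ℝ} (hρ : 0 < ρ) (hr : 2 * ρ < r) :
    IntegrableOn (fun x => G x * fderiv ℝ (cut n ρ) x (V x)) (ball 0 r) := by
  refine (integrable_of_annulus hρ hr ?_ ?_ ?_).integrableOn
  · exact (hG.mono fun x hx => hx.2).mul
      ((contDiff_cut.continuous_fderiv one_ne_zero).continuousOn.clm_apply S.V_cont)
  · intro x hx; simp [fderiv_cut_eq_zero_of_lt hρ hx]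
  · intro x hx; simp [fderiv_cut_eq_zero_of_gt hρ hx]

lemma integral_cut_fderiv {G : EuclideanSpace ℝ (Fin n) → ℝ} (hG : PuncturedTest n r G) {ρ : ℝ}
    (hρ : 0 < ρ) (hr : 2 * ρ < r) :
    ∫ x in ball 0 r, cut n ρ x * fderiv ℝ G x (V x) =
      (∫ x in ball 0 r, f x * (cut n ρ x * G x)) -
        ∫ x in ball 0 r, G x * fderiv ℝ (cut n ρ) x (V x) := by
  have h := S.weak _ (hG.contDiff_cut_mul hρ) hG.hasCompactSupport_cut_mul hG.tsupport_cut_mul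
  rw [eq_sub_iff_add_eq, ← h, ← integral_add (S.integrable_cut_fderiv hG hρ)
    (S.integrable_mul_fderiv_cut hG.contDiffOn.continuousOn hρ hr)]
  have : Nonempty (Fin n) := ⟨⟨0, by have := S.two_le; omega⟩⟩
  have hae : ∀ᵐ x ∂(volume.restrict (ball (0 : EuclideanSpace ℝ (Fin n)) r)), x ≠ 0 :=
    ae_restrict_of_ae (by simp [ae_iff])
  apply integral_congr_ae
  filter_upwards [hae] with x hx
  rw [hG.fderiv_cut_mul hx]
  simp

lemma integral_fderiv_cut {ρ : ℝ} (hρ : 0 < ρ) (hr : 2 * ρ < r) :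
    ∫ x in ball 0 r, fderiv ℝ (cut n ρ) x (V x) = ∫ x in ball 0 r, f x * (cut n ρ x - 1) := by
  have hsupp : tsupport (fun x => cut n ρ x - 1) ⊆ closedBall 0 (2 * ρ) := by
    refine closure_minimal ?_ isClosed_closedBall
    intro x hx
    rw [mem_closedBall_zero_iff]
    by_contra hcon
    exact hx (by simp [cut_eq_one hρ (not_le.1 hcon).le])
  have h := S.weak (fun x => cut n ρ x - 1) (contDiff_cut.sub contDiff_const)
    ((isCompact_closedBall _ _).of_isClosed_subset (isClosed_tsupport _) hsupp)
    (hsupp.trans (closedBall_subset_ball hr))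
  rw [← h]
  simp_rw [fderiv_sub_const]

lemma enorm_integral_cut_sub_le :
    ∃ C : ENNReal, C ≠ ⊤ ∧ ∀ G, PuncturedTest n r G → ∀ ρ : ℝ, 0 < ρ → 3 * ρ < r →
      ∀ l : ENNReal, l ≠ 0 → l ≠ ⊤ →
      ‖(∫ x in ball 0 r, cut n ρ x * fderiv ℝ G x (V x)) -
          ∫ x in ball 0 r, f x * (cut n ρ x * G x)‖ₑ ≤
        l * (∫⁻ x in shell n ρ, slope w H x ^ n)
          + C * l⁻¹ ^ (n - 1) * (∫⁻ x in shell n ρ, ‖fderiv ℝ G x‖ₑ ^ n)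
          + C * (ENNReal.ofReal (ρ ^ n))⁻¹ * (∫⁻ x in shell n ρ, ‖G x‖ₑ) *
            ∫⁻ x in ball 0 (2 * ρ), ENNReal.ofReal (f x) := by
  have hn := S.two_le
  obtain ⟨M, hM0, hM⟩ := exists_norm_fderiv_cut_le n
  obtain ⟨C, hC0, hC⟩ := exists_shell_poincare hn
  set C' := ENNReal.ofReal ((2 * M) ^ n * C) with hC'
  refine ⟨max C' (ENNReal.ofReal C), (max_lt ENNReal.ofReal_lt_top ENNReal.ofReal_lt_top).ne, ?_⟩
  intro G hG ρ hρ hr l hl hl'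
  have hr2 : 2 * ρ < r := by linarith
  obtain ⟨c, hc1, hc2⟩ := hC ρ hρ G hG.contDiffOn
  have hid : (∫ x in ball 0 r, cut n ρ x * fderiv ℝ G x (V x)) -
      (∫ x in ball 0 r, f x * (cut n ρ x * G x)) =
      -(∫ x in ball 0 r, (G x - c) * fderiv ℝ (cut n ρ) x (V x))
        + c * ∫ x in ball 0 r, f x * (1 - cut n ρ x) := by
    have h1 := S.integrable_mul_fderiv_cut hG.contDiffOn.continuousOn hρ hr2
    have h2 := S.integrable_mul_fderiv_cut (G := fun _ => c) continuousOn_const hρ hr2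
    have h3 : ∫ x in ball 0 r, (G x - c) * fderiv ℝ (cut n ρ) x (V x) =
        (∫ x in ball 0 r, G x * fderiv ℝ (cut n ρ) x (V x)) -
          c * ∫ x in ball 0 r, f x * (cut n ρ x - 1) := by
      rw [← S.integral_fderiv_cut hρ hr2, ← integral_const_mul, ← integral_sub h1 h2]
      simp_rw [sub_mul]
    have h4 : ∫ x in ball 0 r, f x * (1 - cut n ρ x) = -∫ x in ball 0 r, f x * (cut n ρ x - 1) := by
      rw [← integral_neg]; congr 1; funext x; ring
    rw [S.integral_cut_fderiv hG hρ hr2, h3, h4]; ring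
  rw [hid]
  refine (enorm_add_le _ _).trans ?_
  rw [enorm_neg, enorm_mul]
  gcongr ?_ + ?_
  · calc ‖∫ x in ball 0 r, (G x - c) * fderiv ℝ (cut n ρ) x (V x)‖ₑ
        ≤ ∫⁻ x in ball 0 r, ‖(G x - c) * fderiv ℝ (cut n ρ) x (V x)‖ₑ :=
          enorm_integral_le_lintegral_enorm _
      _ ≤ ∫⁻ x in ball 0 r, (midShell n ρ).indicator (fun x => l * slope w H x ^ n +
            l⁻¹ ^ (n - 1) * (ENNReal.ofReal (2 * M / ρ) ^ n * ‖G x - c‖ₑ ^ n)) x := by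
          refine setLIntegral_mono' measurableSet_ball fun x hx => ?_
          by_cases hxm : x ∈ midShell n ρ
          · rw [indicator_of_mem hxm]
            have hx0 : x ≠ 0 := midShell_subset_compl_zero hρ hxm
            have h1 : ‖fderiv ℝ (cut n ρ) x (V x)‖ₑ ≤
                ENNReal.ofReal (M / ρ) * (2 * slope w H x ^ (n - 1)) := by
              refine (ContinuousLinearMap.le_opENorm _ _).trans ?_
              gcongr
              · rw [← ofReal_norm]; exact ENNReal.ofReal_le_ofReal (hM ρ hρ x)
              · exact S.enorm_V_le (by simpa using hx) hx0
            have h2 := pow_mul_le_young (n := n) (by omega) (slope w H x)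
              (ENNReal.ofReal (2 * M / ρ) * ‖G x - c‖ₑ) hl hl'
            rw [mul_pow] at h2
            refine le_trans ?_ h2
            rw [enorm_mul]
            refine (mul_le_mul_right h1 _).trans (le_of_eq ?_)
            rw [mul_div_assoc, ENNReal.ofReal_mul (by norm_num), ENNReal.ofReal_ofNat]
            ring
          · rw [indicator_of_notMem hxm, fderiv_cut_eq_zero hρ hxm]
            simp
      _ ≤ ∫⁻ x in midShell n ρ, (l * slope w H x ^ n +
            l⁻¹ ^ (n - 1) * (ENNReal.ofReal (2 * M / ρ) ^ n * ‖G x - c‖ₑ ^ n)) := by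
          rw [← lintegral_indicator measurableSet_midShell]
          exact setLIntegral_le_lintegral _ _
      _ = l * (∫⁻ x in midShell n ρ, slope w H x ^ n) +
            l⁻¹ ^ (n - 1) * (ENNReal.ofReal (2 * M / ρ) ^ n *
              ∫⁻ x in midShell n ρ, ‖G x - c‖ₑ ^ n) := by
          have hm := hG.measurable
          rw [lintegral_add_right _ (by fun_prop), lintegral_const_mul' _ _ hl',
            lintegral_const_mul' _ _ (by simp [hl]), lintegral_const_mul' _ _ (by simp)]
      _ ≤ _ := by
          gcongr ?_ + ?_
          · gcongr
            intro x hx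
            rw [mem_midShell] at hx
            rw [mem_shell]
            have hn' : (2 : ℝ) ≤ n := by exact_mod_cast hn
            refine ⟨lt_of_lt_of_le ?_ hx.1, by linarith⟩
            rw [div_lt_iff₀ (by positivity)]
            nlinarith
          · calc _ ≤ l⁻¹ ^ (n - 1) * (ENNReal.ofReal (2 * M / ρ) ^ n *
                  (ENNReal.ofReal (C * ρ ^ n) * ∫⁻ y in shell n ρ, ‖fderiv ℝ G y‖ₑ ^ n)) := by
                  gcongr
              _ = C' * l⁻¹ ^ (n - 1) * ∫⁻ y in shell n ρ, ‖fderiv ℝ G y‖ₑ ^ n := by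
                  have : C' = ENNReal.ofReal (2 * M / ρ) ^ n * ENNReal.ofReal (C * ρ ^ n) := by
                    rw [hC', ← ENNReal.ofReal_pow (by positivity),
                      ← ENNReal.ofReal_mul (by positivity)]
                    congr 1
                    rw [mul_left_comm, ← mul_pow, div_mul_cancel₀ _ hρ.ne', mul_comm]
                  rw [this]; ring
              _ ≤ _ := by gcongr; exact le_max_left _ _
  · have hρn : ENNReal.ofReal (ρ ^ n) ≠ 0 := by simp [hρ]
    have h1 : ‖c‖ₑ ≤ ENNReal.ofReal C * (ENNReal.ofReal (ρ ^ n))⁻¹ * ∫⁻ x in shell n ρ, ‖G x‖ₑ := by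
      calc ‖c‖ₑ = ‖c‖ₑ * ENNReal.ofReal (ρ ^ n) * (ENNReal.ofReal (ρ ^ n))⁻¹ := by
            rw [mul_assoc, ENNReal.mul_inv_cancel hρn ENNReal.ofReal_ne_top, mul_one]
        _ ≤ (ENNReal.ofReal C * ∫⁻ y in shell n ρ, ‖G y‖ₑ) * (ENNReal.ofReal (ρ ^ n))⁻¹ := by
            gcongr
        _ = _ := by ring
    have h2 : ‖∫ x in ball 0 r, f x * (1 - cut n ρ x)‖ₑ ≤
        ∫⁻ x in ball 0 (2 * ρ), ENNReal.ofReal (f x) := by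
      refine (enorm_integral_le_lintegral_enorm _).trans ?_
      refine (setLIntegral_le_lintegral _ _).trans ?_
      rw [← lintegral_indicator measurableSet_ball]
      refine lintegral_mono fun x => ?_
      by_cases hx : x ∈ ball (0 : EuclideanSpace ℝ (Fin n)) (2 * ρ)
      · rw [indicator_of_mem hx, ← ofReal_norm]
        apply ENNReal.ofReal_le_ofReal
        rw [norm_mul, Real.norm_eq_abs, Real.norm_eq_abs, abs_of_nonneg (S.f_nonneg x),
          abs_of_nonneg (sub_nonneg.2 (cut_le_one x))]
        exact mul_le_of_le_one_right (S.f_nonneg x) (by linarith [cut_nonneg (ρ := ρ) x])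
      · rw [mem_ball_zero_iff, not_lt] at hx
        rw [cut_eq_one hρ hx]; simp
    refine mul_le_mul' (h1.trans ?_) h2
    gcongr
    exact le_max_right _ _

end SingularData

end SingularData

section PuncturedSobolev

variable {n : ℕ} {r : ℝ}

lemma eLpNorm_mul_fderiv_cut_le {G : EuclideanSpace ℝ (Fin n) → ℝ} {K : ℝ} (hK0 : 0 ≤ K)
    (hK : ∀ x, |G x| ≤ K) {M : ℝ} (hM0 : 0 ≤ M)
    (hM : ∀ ρ : ℝ, 0 < ρ → ∀ x, ‖fderiv ℝ (cut n ρ) x‖ ≤ M / ρ) {s : NNReal} (hs : 1 ≤ s) {ρ : ℝ}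
    (hρ : 0 < ρ) :
    eLpNorm (fun x => G x • fderiv ℝ (cut n ρ) x) s volume ≤
      ENNReal.ofReal (K * M * ((volume (ball (0 : EuclideanSpace ℝ (Fin n)) 1)).toReal * 2 ^ n)
        ^ (1 / (s : ℝ)) * ρ ^ ((n : ℝ) / s - 1)) := by
  set ω := (volume (ball (0 : EuclideanSpace ℝ (Fin n)) 1)).toReal with hω
  have hω0 : 0 ≤ ω := ENNReal.toReal_nonneg
  have hs0 : (0 : ℝ) < s := by exact_mod_cast zero_lt_one.trans_le hs
  calc eLpNorm (fun x => G x • fderiv ℝ (cut n ρ) x) s volume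
      ≤ eLpNorm ((closedBall (0 : EuclideanSpace ℝ (Fin n)) (2 * ρ)).indicator
          fun _ => K * (M / ρ)) s volume := by
        refine eLpNorm_mono fun x => ?_
        by_cases hx : ‖x‖ ≤ 2 * ρ
        · rw [indicator_of_mem (mem_closedBall_zero_iff.2 hx), norm_smul, Real.norm_eq_abs,
            Real.norm_of_nonneg (by positivity)]
          gcongr
          · exact hK x
          · exact hM ρ hρ x
        · rw [fderiv_cut_eq_zero_of_gt hρ (not_le.1 hx), smul_zero, norm_zero]
          exact norm_nonneg _
    _ = ENNReal.ofReal (K * (M / ρ)) * ENNReal.ofReal (ω * 2 ^ n * ρ ^ n) ^ (1 / (s : ℝ)) := by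
        rw [eLpNorm_indicator_const measurableSet_closedBall (by exact_mod_cast hs0.ne') (by simp),
          ← ofReal_norm, Real.norm_of_nonneg (by positivity)]
        congr 2
        rw [Measure.addHaar_closedBall _ _ (by positivity), finrank_euclideanSpace_fin, mul_pow,
          mul_assoc, mul_comm ω, ENNReal.ofReal_mul (q := ω) (by positivity), hω,
          ENNReal.ofReal_toReal measure_ball_lt_top.ne]
    _ = _ := by
        rw [ENNReal.ofReal_rpow_of_nonneg (by positivity) (by positivity),
          ← ENNReal.ofReal_mul (by positivity), Real.mul_rpow (by positivity) (by positivity),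
          ← Real.rpow_natCast ρ, ← Real.rpow_mul hρ.le, mul_one_div, Real.rpow_sub_one hρ.ne']
        congr 1; ring

lemma PuncturedTest.eLpNorm_fderiv_cut_mul_le {G : EuclideanSpace ℝ (Fin n) → ℝ}
    (hG : PuncturedTest n r G) (hn : 2 ≤ n) {K : ℝ} (hK0 : 0 ≤ K)
    (hK : ∀ x, |G x| ≤ K) {M : ℝ} (hM0 : 0 ≤ M)
    (hM : ∀ ρ : ℝ, 0 < ρ → ∀ x, ‖fderiv ℝ (cut n ρ) x‖ ≤ M / ρ) {s : NNReal} (hs : 1 ≤ s) {ρ : ℝ}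
    (hρ : 0 < ρ) :
    eLpNorm (fderiv ℝ fun x => cut n ρ x * G x) s volume ≤ eLpNorm (fderiv ℝ G) s volume +
      ENNReal.ofReal (K * M * ((volume (ball (0 : EuclideanSpace ℝ (Fin n)) 1)).toReal * 2 ^ n)
        ^ (1 / (s : ℝ)) * ρ ^ ((n : ℝ) / s - 1)) := by
  have : Nonempty (Fin n) := ⟨⟨0, by omega⟩⟩
  have hae : ∀ᵐ x : EuclideanSpace ℝ (Fin n), x ≠ 0 := by simp [ae_iff]
  have hm1 : AEStronglyMeasurable (fun x => cut n ρ x • fderiv ℝ G x) volume :=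
    contDiff_cut.continuous.aestronglyMeasurable.smul hG.measurable_fderiv.aestronglyMeasurable
  have hm2 : AEStronglyMeasurable (fun x => G x • fderiv ℝ (cut n ρ) x) volume :=
    hG.measurable.aestronglyMeasurable.smul
      (contDiff_cut.continuous_fderiv one_ne_zero).aestronglyMeasurable
  have heq : (fderiv ℝ fun x => cut n ρ x * G x) =ᵐ[volume] (fun x => cut n ρ x • fderiv ℝ G x) +
      fun x => G x • fderiv ℝ (cut n ρ) x := by
    filter_upwards [hae] with x hx
    rw [hG.fderiv_cut_mul hx]; rfl
  rw [eLpNorm_congr_ae heq]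
  refine (eLpNorm_add_le hm1 hm2 (by exact_mod_cast hs)).trans ?_
  refine add_le_add ?_ (eLpNorm_mul_fderiv_cut_le hK0 hK hM0 hM hs hρ)
  refine eLpNorm_mono fun x => ?_
  rw [norm_smul, Real.norm_of_nonneg (cut_nonneg x)]
  exact mul_le_of_le_one_left (norm_nonneg _) (cut_le_one x)

/-- The Gagliardo–Nirenberg–Sobolev inequality for bounded functions that are `C¹` off the
origin. -/
lemma exists_eLpNorm_le_eLpNorm_fderiv (hn : 2 ≤ n) (r : ℝ) {s t : NNReal} (hs : 1 ≤ s)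
    (hsn : s < n) (hst : (s : ℝ)⁻¹ - (n : ℝ)⁻¹ ≤ (t : ℝ)⁻¹) :
    ∃ C : NNReal, ∀ G : EuclideanSpace ℝ (Fin n) → ℝ, PuncturedTest n r G →
      (∃ K, ∀ x, |G x| ≤ K) → eLpNorm G t volume ≤ C * eLpNorm (fderiv ℝ G) s volume := by
  refine ⟨eLpNormLESNormFDerivOfLeConst ℝ (volume : Measure (EuclideanSpace ℝ (Fin n)))
    (ball 0 r) s t, fun G hG ⟨K, hK⟩ => ?_⟩
  set C := eLpNormLESNormFDerivOfLeConst ℝ (volume : Measure (EuclideanSpace ℝ (Fin n)))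
    (ball 0 r) s t
  obtain ⟨M, hM0, hM⟩ := exists_norm_fderiv_cut_le n
  have hK0 : 0 ≤ K := (abs_nonneg _).trans (hK 0)
  have : Nonempty (Fin n) := ⟨⟨0, by omega⟩⟩
  set A := K * M * ((volume (ball (0 : EuclideanSpace ℝ (Fin n)) 1)).toReal * 2 ^ n)
        ^ (1 / (s : ℝ))
  have hs0 : (0 : ℝ) < s := by exact_mod_cast zero_lt_one.trans_le hs
  have hae : ∀ᵐ x : EuclideanSpace ℝ (Fin n), x ≠ 0 := by simp [ae_iff]
  set δ : ℕ → ℝ := fun k => 1 / ((k : ℝ) + 1) with hδ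
  have hδpos : ∀ k, 0 < δ k := fun k => by positivity
  have hδlim : Tendsto δ atTop (𝓝 0) := tendsto_one_div_add_atTop_nhds_zero_nat
  have hbound : ∀ k, eLpNorm (fun x => cut n (δ k) x * G x) t volume ≤
      C * (eLpNorm (fderiv ℝ G) s volume + ENNReal.ofReal (A * δ k ^ ((n : ℝ) / s - 1))) := by
    intro k
    have h1 := eLpNorm_le_eLpNorm_fderiv_of_le volume (hG.contDiff_cut_mul (hδpos k))
      (s := ball 0 r) ((subset_tsupport _).trans hG.tsupport_cut_mul) hs
      (by rw [finrank_euclideanSpace_fin]; exact hsn) (q := t)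
      (by rw [finrank_euclideanSpace_fin]; exact hst) isBounded_ball
    refine h1.trans ?_
    gcongr
    exact hG.eLpNorm_fderiv_cut_mul_le hn hK0 hK hM0.le hM hs (hδpos k)
  have hlim : ∀ᵐ x : EuclideanSpace ℝ (Fin n),
      Tendsto (fun k => cut n (δ k) x * G x) atTop (𝓝 (G x)) := by
    filter_upwards [hae] with x hx
    apply tendsto_const_nhds.congr'
    have hx' : 0 < ‖x‖ / 2 := by positivity
    filter_upwards [hδlim.eventually (gt_mem_nhds hx')] with k hk
    rw [cut_eq_one (hδpos k) (by linarith), one_mul]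
  refine (Lp.eLpNorm_lim_le_liminf_eLpNorm (fun k => ?_) G hlim).trans ?_
  · exact (hG.contDiff_cut_mul (hδpos k)).continuous.aestronglyMeasurable
  have hlim2 : Tendsto (fun k => C * (eLpNorm (fderiv ℝ G) s volume +
      ENNReal.ofReal (A * δ k ^ ((n : ℝ) / s - 1)))) atTop
      (𝓝 (C * (eLpNorm (fderiv ℝ G) s volume + ENNReal.ofReal (A * 0)))) := by
    refine ENNReal.Tendsto.const_mul (tendsto_const_nhds.add (ENNReal.tendsto_ofReal
      (tendsto_const_nhds.mul ?_))) (Or.inr (by simp))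
    have hpos : 0 < (n : ℝ) / s - 1 := by
      have : (s : ℝ) < n := by exact_mod_cast hsn
      rw [sub_pos, one_lt_div hs0]; exact this
    have := hδlim.rpow_const (p := (n : ℝ) / s - 1) (Or.inr hpos.le)
    rwa [Real.zero_rpow hpos.ne'] at this
  rw [mul_zero, ENNReal.ofReal_zero, add_zero] at hlim2
  rw [← hlim2.liminf_eq]
  exact liminf_le_liminf (Eventually.of_forall hbound)

end PuncturedSobolev

section Profile

/-- A nonnegative continuous function supported away from `0` and `±∞`. -/
structure Profile (θ : ℝ → ℝ) : Prop where
  cont : Continuous θ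
  nonneg : ∀ t, 0 ≤ θ t
  gap : ∃ ε > 0, ∀ t, |t| ≤ ε → θ t = 0
  bdd : ∃ k, ∀ t, k ≤ |t| → θ t = 0

/-- The primitive of `θ` vanishing at `0`. -/
noncomputable def prim (θ : ℝ → ℝ) (t : ℝ) : ℝ := ∫ s in (0 : ℝ)..t, θ s

namespace Profile

variable {θ : ℝ → ℝ}

lemma hasCompactSupport (hθ : Profile θ) : HasCompactSupport θ := by
  obtain ⟨k, hk⟩ := hθ.bdd
  refine HasCompactSupport.intro (isCompact_closedBall 0 k) fun t ht => hk t ?_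
  rw [mem_closedBall_zero_iff, Real.norm_eq_abs, not_le] at ht
  exact ht.le

lemma exists_le (hθ : Profile θ) : ∃ L, 0 ≤ L ∧ ∀ t, θ t ≤ L := by
  obtain ⟨L, hL⟩ := hθ.hasCompactSupport.exists_bound_of_continuous hθ.cont
  exact ⟨L, (norm_nonneg _).trans (hL 0), fun t => (le_abs_self _).trans (hL t)⟩

lemma pow (hθ : Profile θ) {N : ℕ} (hN : N ≠ 0) : Profile fun t => θ t ^ N where
  cont := hθ.cont.pow N
  nonneg t := pow_nonneg (hθ.nonneg t) N
  gap := by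
    obtain ⟨ε, h0, hε⟩ := hθ.gap
    exact ⟨ε, h0, fun t ht => by rw [hε t ht, zero_pow hN]⟩
  bdd := by
    obtain ⟨k, hk⟩ := hθ.bdd
    exact ⟨k, fun t ht => by rw [hk t ht, zero_pow hN]⟩

lemma hasDerivAt_prim (hθ : Profile θ) (t : ℝ) : HasDerivAt (prim θ) (θ t) t :=
  intervalIntegral.integral_hasDerivAt_right (hθ.cont.intervalIntegrable _ _)
    (hθ.cont.stronglyMeasurableAtFilter _ _) hθ.cont.continuousAt

lemma contDiff_prim (hθ : Profile θ) : ContDiff ℝ 1 (prim θ) := by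
  rw [contDiff_one_iff_deriv]
  refine ⟨fun t => (hθ.hasDerivAt_prim t).differentiableAt, ?_⟩
  have : deriv (prim θ) = θ := funext fun t => (hθ.hasDerivAt_prim t).deriv
  rw [this]
  exact hθ.cont

lemma prim_eq_zero (hθ : Profile θ) : ∃ ε > 0, ∀ t, |t| ≤ ε → prim θ t = 0 := by
  obtain ⟨ε, h0, hε⟩ := hθ.gap
  refine ⟨ε, h0, fun t ht => ?_⟩
  refine intervalIntegral.integral_zero_ae (Eventually.of_forall fun s hs => hε s ?_)
  rcases le_total 0 t with h | h
  · rw [uIoc_of_le h] at hs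
    rw [abs_of_nonneg h] at ht
    rw [abs_of_nonneg hs.1.le]; exact hs.2.trans ht
  · rw [uIoc_of_ge h] at hs
    rw [abs_of_nonpos h] at ht
    rw [abs_of_nonpos hs.2]; linarith [hs.1]

lemma prim_bdd (hθ : Profile θ) : ∃ K, ∀ t, |prim θ t| ≤ K := by
  refine ⟨∫ s, ‖θ s‖, fun t => ?_⟩
  rw [← Real.norm_eq_abs, prim]
  refine intervalIntegral.norm_integral_le_integral_norm_uIoc.trans ?_
  exact setIntegral_le_integral (hθ.cont.integrable_of_hasCompactSupport hθ.hasCompactSupport).norm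
    (Eventually.of_forall fun s => norm_nonneg _)

lemma prim_nonneg (hθ : Profile θ) {t : ℝ} (ht : 0 ≤ t) : 0 ≤ prim θ t :=
  intervalIntegral.integral_nonneg ht fun s _ => hθ.nonneg s

lemma prim_nonpos (hθ : Profile θ) {t : ℝ} (ht : t ≤ 0) : prim θ t ≤ 0 := by
  rw [prim, intervalIntegral.integral_symm, neg_nonpos]
  exact intervalIntegral.integral_nonneg ht fun s _ => hθ.nonneg s

end Profile

namespace SingularData

variable {n : ℕ} {r p d : ℝ} {w f H : EuclideanSpace ℝ (Fin n) → ℝ}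
  {V : EuclideanSpace ℝ (Fin n) → EuclideanSpace ℝ (Fin n)} {θ : ℝ → ℝ}

lemma exists_radius (S : SingularData n r p d w f H V) {ε : ℝ} (hε : 0 < ε) :
    ∃ R, 0 < R ∧ R < r ∧ ∀ x, R ≤ ‖x‖ → ‖x‖ ≤ r → |w x| ≤ ε := by
  have hr := S.r_pos
  set K := closedBall (0 : EuclideanSpace ℝ (Fin n)) r \ ball 0 (r / 2) with hK
  have hKc : IsCompact K := (isCompact_closedBall _ _).diff isOpen_ball
  have hKsub : K ⊆ closedBall 0 r \ {0} :=
    sdiff_subset_sdiff_right (singleton_subset_iff.2 (mem_ball_self (by positivity)))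
  have hmem : ∀ x : EuclideanSpace ℝ (Fin n), x ∈ K ↔ ‖x‖ ≤ r ∧ r / 2 ≤ ‖x‖ := by
    intro x; simp [hK]
  have hcl : IsClosed (K ∩ (fun x => |w x|) ⁻¹' Ici ε) :=
    (S.w_cont.mono hKsub).abs.preimage_isClosed_of_isClosed hKc.isClosed isClosed_Ici
  have hcomp : IsCompact (K ∩ (fun x => |w x|) ⁻¹' Ici ε) :=
    hKc.of_isClosed_subset hcl inter_subset_left
  by_cases hne : (K ∩ (fun x => |w x|) ⁻¹' Ici ε).Nonempty
  · obtain ⟨y, hy, hmax⟩ := hcomp.exists_isMaxOn hne continuous_norm.continuousOn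
    have hyK := (hmem y).1 hy.1
    have hyr : ‖y‖ < r := by
      refine lt_of_le_of_ne hyK.1 fun h => ?_
      have h1 : ε ≤ |w y| := hy.2
      rw [S.w_bdry y h, abs_zero] at h1
      linarith
    refine ⟨(‖y‖ + r) / 2, by linarith [norm_nonneg y], by linarith, fun x hx hxr => ?_⟩
    by_contra hcon
    have h1 : x ∈ K ∩ (fun x => |w x|) ⁻¹' Ici ε :=
      ⟨(hmem x).2 ⟨hxr, by linarith⟩, (not_le.1 hcon).le⟩
    have h2 : ‖x‖ ≤ ‖y‖ := hmax h1
    linarith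
  · refine ⟨r / 2, by linarith, by linarith, fun x hx hxr => ?_⟩
    by_contra hcon
    exact hne ⟨x, (hmem x).2 ⟨hxr, hx⟩, (not_le.1 hcon).le⟩

/-- The composition `ψ(w)` with the primitive of a profile, extended by zero off the ball. -/
noncomputable def trunc (n : ℕ) (r : ℝ) (w : EuclideanSpace ℝ (Fin n) → ℝ) (θ : ℝ → ℝ) :
    EuclideanSpace ℝ (Fin n) → ℝ :=
  (ball 0 r).indicator fun x => prim θ (w x)

lemma trunc_of_lt {x : EuclideanSpace ℝ (Fin n)} (hx : ‖x‖ < r) :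
    trunc n r w θ x = prim θ (w x) :=
  indicator_of_mem (mem_ball_zero_iff.2 hx) _

lemma trunc_of_le {x : EuclideanSpace ℝ (Fin n)} (hx : r ≤ ‖x‖) : trunc n r w θ x = 0 :=
  indicator_of_notMem (by rw [mem_ball_zero_iff, not_lt]; exact hx) _

variable (S : SingularData n r p d w f H V) (hθ : Profile θ)
include hθ

lemma trunc_bdd (w : EuclideanSpace ℝ (Fin n) → ℝ) (r : ℝ) :
    ∃ K, 0 ≤ K ∧ ∀ x, |trunc n r w θ x| ≤ K := by
  obtain ⟨K, hK⟩ := hθ.prim_bdd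
  have hK0 := (abs_nonneg _).trans (hK 0)
  refine ⟨K, hK0, fun x => ?_⟩
  rcases lt_or_ge ‖x‖ r with h | h
  · rw [trunc_of_lt h]; exact hK _
  · rw [trunc_of_le h, abs_zero]; exact hK0

include S

lemma hasFDerivAt_trunc {x : EuclideanSpace ℝ (Fin n)} (hx : ‖x‖ < r) (hx0 : x ≠ 0) :
    HasFDerivAt (trunc n r w θ) (θ (w x) • fderiv ℝ w x) x := by
  have h1 : HasFDerivAt (fun y => prim θ (w y)) (θ (w x) • fderiv ℝ w x) x :=
    (hθ.hasDerivAt_prim (w x)).comp_hasFDerivAt x (S.differentiableAt hx hx0).hasFDerivAt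
  refine h1.congr_of_eventuallyEq ?_
  filter_upwards [isOpen_ball.mem_nhds (mem_ball_zero_iff.2 hx)] with y hy
  exact trunc_of_lt (mem_ball_zero_iff.1 hy)

lemma fderiv_trunc {x : EuclideanSpace ℝ (Fin n)} (hx : ‖x‖ < r) (hx0 : x ≠ 0) :
    fderiv ℝ (trunc n r w θ) x = θ (w x) • fderiv ℝ w x :=
  (S.hasFDerivAt_trunc hθ hx hx0).fderiv

lemma puncturedTest_trunc : PuncturedTest n r (trunc n r w θ) := by
  obtain ⟨ε, hε0, hε⟩ := hθ.prim_eq_zero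
  obtain ⟨R, hR0, hRr, hR⟩ := S.exists_radius hε0
  have hvan : ∀ x, R ≤ ‖x‖ → trunc n r w θ x = 0 := by
    intro x hx
    rcases lt_or_ge ‖x‖ r with h | h
    · rw [trunc_of_lt h]; exact hε _ (hR x hx h.le)
    · exact trunc_of_le h
  refine ⟨?_, R, hR0, hRr, hvan⟩
  intro x hx
  apply ContDiffAt.contDiffWithinAt
  rcases lt_or_ge ‖x‖ r with h | h
  · have h1 : ContDiffAt ℝ 1 (fun y => prim θ (w y)) x :=
      hθ.contDiff_prim.contDiffAt.comp x
        (S.w_diff.contDiffAt (isOpen_punctured.mem_nhds (mem_punctured.2 ⟨h, hx⟩)))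
    refine h1.congr_of_eventuallyEq ?_
    filter_upwards [isOpen_ball.mem_nhds (mem_ball_zero_iff.2 h)] with y hy
    exact trunc_of_lt (mem_ball_zero_iff.1 hy)
  · have : trunc n r w θ =ᶠ[𝓝 x] fun _ => 0 := by
      filter_upwards [(isOpen_lt continuous_const continuous_norm).mem_nhds
        (hRr.trans_le h : R < ‖x‖)] with y hy
      exact hvan y (le_of_lt hy)
    exact contDiffAt_const.congr_of_eventuallyEq this

end SingularData

end Profile

section Bump

/-- A cutoff function on the line, supported in `1/j ≤ |t| ≤ j + 1`. -/
noncomputable def bump (j : ℕ) (t : ℝ) : ℝ :=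
  min 1 (max 0 (j * |t| - 1)) * min 1 (max 0 (j + 1 - |t|))

lemma bump_nonneg (j : ℕ) (t : ℝ) : 0 ≤ bump j t :=
  mul_nonneg (le_min zero_le_one (le_max_left _ _)) (le_min zero_le_one (le_max_left _ _))

lemma bump_le_one (j : ℕ) (t : ℝ) : bump j t ≤ 1 :=
  mul_le_one₀ (min_le_left _ _) (le_min zero_le_one (le_max_left _ _)) (min_le_left _ _)

lemma continuous_bump (j : ℕ) : Continuous (bump j) := by
  unfold bump; fun_prop

lemma tendsto_bump {t : ℝ} (ht : t ≠ 0) : Tendsto (fun j => bump j t) atTop (𝓝 1) := by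
  have h0 : 0 < |t| := abs_pos.2 ht
  refine tendsto_const_nhds.congr' ?_
  obtain ⟨N, hN⟩ := exists_nat_gt (2 / |t|)
  obtain ⟨M, hM⟩ := exists_nat_gt |t|
  filter_upwards [eventually_ge_atTop N, eventually_ge_atTop M] with j hj hj'
  have h1 : (N : ℝ) ≤ j := by exact_mod_cast hj
  have h2 : (M : ℝ) ≤ j := by exact_mod_cast hj'
  have h3 : 2 ≤ j * |t| := by
    have := (div_lt_iff₀ h0).1 (hN.trans_le h1); linarith
  rw [bump, min_eq_left, min_eq_left, one_mul]
  · exact le_max_of_le_right (by linarith)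
  · exact le_max_of_le_right (by linarith)

lemma profile_bump_mul (j : ℕ) {g : ℝ → ℝ} (hg : Continuous g) (h0 : ∀ t, 0 ≤ g t) :
    Profile fun t => bump j t * g t where
  cont := (continuous_bump j).mul hg
  nonneg t := mul_nonneg (bump_nonneg j t) (h0 t)
  gap := by
    refine ⟨1 / (j + 1), by positivity, fun t ht => ?_⟩
    have h1 : (j : ℝ) * |t| ≤ 1 := by
      have h2 := (le_div_iff₀ (by positivity : (0 : ℝ) < j + 1)).1 ht
      nlinarith [abs_nonneg t]
    rw [bump, max_eq_left (by linarith), min_eq_right zero_le_one, zero_mul, zero_mul]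
  bdd := by
    refine ⟨j + 1, fun t ht => ?_⟩
    rw [bump, max_eq_left (by linarith : (j : ℝ) + 1 - |t| ≤ 0), min_eq_right zero_le_one,
      mul_zero, zero_mul]

lemma tendsto_prim_bump_mul {g : ℝ → ℝ} (hg : Continuous g) (t : ℝ) :
    Tendsto (fun j => prim (fun s => bump j s * g s) t) atTop (𝓝 (prim g t)) := by
  refine intervalIntegral.tendsto_integral_filter_of_dominated_convergence (fun s => ‖g s‖) ?_ ?_
    (hg.norm.intervalIntegrable _ _) ?_
  · exact Eventually.of_forall fun j => ((continuous_bump j).mul hg).aestronglyMeasurable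
  · refine Eventually.of_forall fun j => Eventually.of_forall fun s _ => ?_
    rw [norm_mul, Real.norm_of_nonneg (bump_nonneg j s)]
    exact mul_le_of_le_one_left (norm_nonneg _) (bump_le_one j s)
  · have : ∀ᵐ s : ℝ, s ≠ 0 := by simp [ae_iff]
    filter_upwards [this] with s hs _
    simpa using (tendsto_bump hs).mul_const (g s)

end Bump

namespace SingularData

section Integrability

lemma eLpNorm_eq_of_ae_eq_indicator {X E : Type*} [MeasurableSpace X] [NormedAddCommGroup E]
    {μ : Measure X} {F g : X → E} {B : Set X} (hB : MeasurableSet B) {s : ENNReal}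
    (h : F =ᵐ[μ] B.indicator g) : eLpNorm F s μ = eLpNorm g s (μ.restrict B) := by
  rw [eLpNorm_congr_ae h, eLpNorm_indicator_eq_eLpNorm_restrict hB]

variable {n : ℕ} {r p d : ℝ} {w f H : EuclideanSpace ℝ (Fin n) → ℝ}
  {V : EuclideanSpace ℝ (Fin n) → EuclideanSpace ℝ (Fin n)} {θ : ℝ → ℝ}

lemma fderiv_trunc_ae (S : SingularData n r p d w f H V) (hθ : Profile θ) :
    fderiv ℝ (trunc n r w θ) =ᵐ[volume]
      (ball 0 r).indicator fun x => θ (w x) • fderiv ℝ w x := by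
  have : Nonempty (Fin n) := ⟨⟨0, by have := S.two_le; omega⟩⟩
  have hae : ∀ᵐ x : EuclideanSpace ℝ (Fin n), x ≠ 0 := by simp [ae_iff]
  obtain ⟨R, h0, hr, -, hR'⟩ := (S.puncturedTest_trunc hθ).fderiv_vanish
  filter_upwards [hae] with x hx
  rcases lt_or_ge ‖x‖ r with h | h
  · rw [indicator_of_mem (mem_ball_zero_iff.2 h), S.fderiv_trunc hθ h hx]
  · rw [indicator_of_notMem (by rw [mem_ball_zero_iff, not_lt]; exact h), hR' x (hr.trans_le h)]

lemma eLpNorm_fderiv_trunc (S : SingularData n r p d w f H V) (hθ : Profile θ) (s : ENNReal) :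
    eLpNorm (fderiv ℝ (trunc n r w θ)) s volume =
      eLpNorm (fun x => θ (w x) • fderiv ℝ w x) s (volume.restrict (ball 0 r)) := by
  exact eLpNorm_eq_of_ae_eq_indicator measurableSet_ball (S.fderiv_trunc_ae hθ)

lemma aestronglyMeasurable_fderiv (S : SingularData n r p d w f H V) :
    AEStronglyMeasurable (fderiv ℝ w) (volume.restrict (ball 0 r)) := by
  have : Nonempty (Fin n) := ⟨⟨0, by have := S.two_le; omega⟩⟩
  have h := S.continuousOn_fderiv.aestronglyMeasurable (μ := volume) isOpen_punctured.measurableSet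
  rwa [Measure.restrict_congr_set (sdiff_null_ae_eq_self (measure_singleton 0))] at h

lemma aestronglyMeasurable (S : SingularData n r p d w f H V) :
    AEStronglyMeasurable w (volume.restrict (ball 0 r)) := by
  have : Nonempty (Fin n) := ⟨⟨0, by have := S.two_le; omega⟩⟩
  have h := S.w_diff.continuousOn.aestronglyMeasurable (μ := volume)
    isOpen_punctured.measurableSet
  rwa [Measure.restrict_congr_set (sdiff_null_ae_eq_self (measure_singleton 0))] at h

lemma memLp_fderiv (S : SingularData n r p d w f H V) {s : NNReal} (hs : 1 ≤ s) (hsn : s < n) :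
    MemLp (fderiv ℝ w) s (volume.restrict (ball 0 r)) := by
  have h := S.grad_int s (by exact_mod_cast hs) (by exact_mod_cast hsn)
  have hs0 : (s : ENNReal) ≠ 0 := by
    have : s ≠ 0 := (zero_lt_one.trans_le hs).ne'
    exact_mod_cast this
  rw [← integrable_norm_rpow_iff S.aestronglyMeasurable_fderiv hs0 ENNReal.coe_ne_top]
  refine Integrable.mono' h ?_ ?_
  · exact (S.aestronglyMeasurable_fderiv.norm.aemeasurable.pow_const _).aestronglyMeasurable
  · filter_upwards with x
    rw [Real.norm_of_nonneg (by positivity), ENNReal.coe_toReal]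
    exact Real.rpow_le_rpow (norm_nonneg _) (by linarith [S.H_nonneg x]) s.2

lemma tendsto_trunc {g : ℝ → ℝ} (hg : Continuous g) (x : EuclideanSpace ℝ (Fin n)) :
    Tendsto (fun j => trunc n r w (fun t => bump j t * g t) x) atTop
      (𝓝 ((ball 0 r).indicator (fun x => prim g (w x)) x)) := by
  rcases lt_or_ge ‖x‖ r with h | h
  · simp_rw [trunc_of_lt h]
    rw [indicator_of_mem (mem_ball_zero_iff.2 h)]
    exact tendsto_prim_bump_mul hg _
  · simp_rw [trunc_of_le h]
    rw [indicator_of_notMem (by rw [mem_ball_zero_iff, not_lt]; exact h)]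
    exact tendsto_const_nhds

lemma eLpNorm_lt_top_of_two_le (S : SingularData n r p d w f H V) {T : NNReal} (hT : 2 ≤ T) :
    eLpNorm w T (volume.restrict (ball 0 r)) < ⊤ := by
  have hn : (2 : NNReal) ≤ n := by exact_mod_cast S.two_le
  have hn' : (2 : ℝ) ≤ n := by exact_mod_cast S.two_le
  have hT' : (2 : ℝ) ≤ T := by exact_mod_cast hT
  set s : NNReal := n * T / (n + T) with hsdef
  have hsR : (s : ℝ) = n * T / (n + T) := by rw [hsdef]; push_cast; rfl
  have hs1 : 1 ≤ s := by
    rw [← NNReal.coe_le_coe, hsR, NNReal.coe_one, le_div_iff₀ (by positivity)]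
    nlinarith
  have hsn : s < n := by
    rw [← NNReal.coe_lt_coe, hsR, div_lt_iff₀ (by positivity), NNReal.coe_natCast]
    nlinarith
  obtain ⟨C, hC⟩ := exists_eLpNorm_le_eLpNorm_fderiv S.two_le r hs1 hsn (t := T) (by
    rw [hsR, inv_div]; apply le_of_eq; field_simp; ring)
  clear_value s
  have hprof : ∀ j, Profile fun t => bump j t * (fun _ => 1 : ℝ → ℝ) t :=
    fun j => profile_bump_mul j continuous_const fun _ => zero_le_one
  have hlim := Lp.eLpNorm_lim_le_liminf_eLpNorm (p := (T : ENNReal)) (μ := volume)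
    (f := fun j => trunc n r w (fun t => bump j t * (fun _ => 1 : ℝ → ℝ) t))
    (fun j => (S.puncturedTest_trunc (hprof j)).measurable.aestronglyMeasurable) _
    (Eventually.of_forall fun x => tendsto_trunc continuous_const x)
  have hprim : ∀ t : ℝ, prim (fun _ => 1) t = t := fun t => by simp [prim]
  simp_rw [hprim] at hlim
  rw [eLpNorm_indicator_eq_eLpNorm_restrict measurableSet_ball] at hlim
  refine hlim.trans_lt (lt_of_le_of_lt (b := C * eLpNorm (fderiv ℝ w) s
    (volume.restrict (ball 0 r))) ?_ (ENNReal.mul_lt_top ENNReal.coe_lt_top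
      (S.memLp_fderiv hs1 hsn).2))
  refine (liminf_le_liminf (v := fun _ => C * eLpNorm (fderiv ℝ w) s
    (volume.restrict (ball 0 r))) (Eventually.of_forall fun j => ?_)).trans
    (liminf_const _).le
  obtain ⟨K, -, hK⟩ := trunc_bdd (hprof j) w r
  refine (hC _ (S.puncturedTest_trunc (hprof j)) ⟨K, hK⟩).trans ?_
  gcongr
  refine (S.eLpNorm_fderiv_trunc (hprof j) s).le.trans (eLpNorm_mono fun x => ?_)
  rw [norm_smul, Real.norm_of_nonneg ((hprof j).nonneg _)]
  exact mul_le_of_le_one_left (norm_nonneg _) (by simpa using bump_le_one j (w x))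

lemma memLp (S : SingularData n r p d w f H V) {T : ENNReal} (hT : T ≠ ⊤) :
    MemLp w T (volume.restrict (ball 0 r)) := by
  have hfin : IsFiniteMeasure (volume.restrict (ball (0 : EuclideanSpace ℝ (Fin n)) r)) :=
    ⟨by simp [measure_ball_lt_top]⟩
  lift T to NNReal using hT
  have h : MemLp w ((max 2 T : NNReal) : ENNReal) (volume.restrict (ball 0 r)) :=
    ⟨S.aestronglyMeasurable, S.eLpNorm_lt_top_of_two_le (le_max_left _ _)⟩
  exact h.mono_exponent (by exact_mod_cast le_max_right _ _)

lemma lintegral_ofReal_abs_rpow_lt_top (S : SingularData n r p d w f H V) {T : ℝ} (hT : 0 < T) :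
    ∫⁻ x in ball 0 r, ‖w x‖ₑ ^ T < ⊤ := by
  have h := S.memLp (ENNReal.ofReal_ne_top (r := T))
  have := lintegral_rpow_enorm_lt_top_of_eLpNorm_lt_top (by simpa using hT) ENNReal.ofReal_ne_top h.2
  rwa [ENNReal.toReal_ofReal hT.le] at this

end Integrability

end SingularData

namespace SingularData

section Energy

variable {n : ℕ} {r p d : ℝ} {w f H : EuclideanSpace ℝ (Fin n) → ℝ}
  {V : EuclideanSpace ℝ (Fin n) → EuclideanSpace ℝ (Fin n)}

lemma lintegral_f_rpow_lt_top (S : SingularData n r p d w f H V) :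
    ∫⁻ x in ball 0 r, ENNReal.ofReal (f x) ^ p < ⊤ := by
  have h := S.f_pow.lintegral_lt_top
  refine lt_of_eq_of_lt (lintegral_congr fun x => ?_) h
  rw [ENNReal.ofReal_rpow_of_nonneg (S.f_nonneg x) (zero_lt_one.trans S.one_lt).le]

/-- The `L^p` norm of `f`. -/
noncomputable def fNorm (n : ℕ) (r p : ℝ) (f : EuclideanSpace ℝ (Fin n) → ℝ) : ENNReal :=
  (∫⁻ x in ball 0 r, ENNReal.ofReal (f x) ^ p) ^ (1 / p)

lemma fNorm_ne_top (S : SingularData n r p d w f H V) : fNorm n r p f ≠ ⊤ :=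
  ENNReal.rpow_ne_top_of_nonneg (by have := S.one_lt; positivity) S.lintegral_f_rpow_lt_top.ne

lemma setLIntegral_f_mul_le (S : SingularData n r p d w f H V)
    {A : Set (EuclideanSpace ℝ (Fin n))} (hA : A ⊆ ball 0 r)
    {g : EuclideanSpace ℝ (Fin n) → ENNReal} (hg : AEMeasurable g (volume.restrict A)) :
    ∫⁻ x in A, ENNReal.ofReal (f x) * g x ≤
      fNorm n r p f * (∫⁻ x in A, g x ^ p.conjExponent) ^ (1 / p.conjExponent) := by
  have h := ENNReal.lintegral_mul_le_Lp_mul_Lq (volume.restrict A)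
    (Real.HolderConjugate.conjExponent S.one_lt)
    (f := fun x => ENNReal.ofReal (f x)) S.f_meas.ennreal_ofReal.aemeasurable hg
  refine h.trans (mul_le_mul_left ?_ _)
  exact ENNReal.rpow_le_rpow (lintegral_mono_set hA) (by have := S.one_lt; positivity)

lemma setLIntegral_f_le (S : SingularData n r p d w f H V)
    {A : Set (EuclideanSpace ℝ (Fin n))} (hA : A ⊆ ball 0 r) :
    ∫⁻ x in A, ENNReal.ofReal (f x) ≤ fNorm n r p f * volume A ^ (1 / p.conjExponent) := by
  have h := S.setLIntegral_f_mul_le hA (g := fun _ => 1) aemeasurable_const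
  simpa using h

lemma setLIntegral_w_le (S : SingularData n r p d w f H V)
    {A : Set (EuclideanSpace ℝ (Fin n))} (hA : A ⊆ ball 0 r) :
    ∫⁻ x in A, ‖w x‖ₑ ≤
      (∫⁻ x in ball 0 r, ‖w x‖ₑ ^ p.conjExponent) ^ (1 / p.conjExponent) *
        volume A ^ (1 / p) := by
  have h := ENNReal.lintegral_mul_le_Lp_mul_Lq (volume.restrict A)
    (Real.HolderConjugate.conjExponent S.one_lt).symm
    (f := fun x => ‖w x‖ₑ) (g := fun _ => 1)
    (S.aestronglyMeasurable.mono_set hA).enorm aemeasurable_const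
  have h0 : (0 : ℝ) ≤ 1 / p.conjExponent :=
    one_div_nonneg.2 (Real.HolderConjugate.conjExponent S.one_lt).symm.nonneg
  refine le_trans (by simp) (h.trans ?_)
  simp only [ENNReal.one_rpow, lintegral_const, one_mul, Measure.restrict_apply MeasurableSet.univ,
    univ_inter]
  gcongr

lemma wNorm_ne_top (S : SingularData n r p d w f H V) :
    (∫⁻ x in ball 0 r, ‖w x‖ₑ ^ p.conjExponent) ^ (1 / p.conjExponent) ≠ ⊤ := by
  have h1 := (Real.HolderConjugate.conjExponent S.one_lt).symm.pos
  exact ENNReal.rpow_ne_top_of_nonneg (by positivity)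
    (S.lintegral_ofReal_abs_rpow_lt_top h1).ne

lemma setLIntegral_f_mul_setLIntegral_w_le (S : SingularData n r p d w f H V) :
    ∃ C : ENNReal, C ≠ ⊤ ∧ ∀ ρ : ℝ, 0 < ρ → 3 * ρ < r →
      (ENNReal.ofReal (ρ ^ n))⁻¹ * (∫⁻ x in shell n ρ, ‖w x‖ₑ) *
        (∫⁻ x in ball 0 (2 * ρ), ENNReal.ofReal (f x)) ≤ C := by
  set W := (∫⁻ x in ball 0 r, ‖w x‖ₑ ^ p.conjExponent) ^ (1 / p.conjExponent) with hW
  set ω := volume (ball (0 : EuclideanSpace ℝ (Fin n)) 1) with hω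
  have : Nonempty (Fin n) := ⟨⟨0, by have := S.two_le; omega⟩⟩
  have hωt : ω ≠ ⊤ := measure_ball_lt_top.ne
  refine ⟨W * fNorm n r p f * (ENNReal.ofReal (3 ^ n) * ω), ENNReal.mul_ne_top
    (ENNReal.mul_ne_top S.wNorm_ne_top S.fNorm_ne_top)
    (ENNReal.mul_ne_top ENNReal.ofReal_ne_top hωt), fun ρ hρ hr => ?_⟩
  have hsub : ball (0 : EuclideanSpace ℝ (Fin n)) (3 * ρ) ⊆ ball 0 r := ball_subset_ball hr.le
  have hs : shell n ρ ⊆ ball 0 (3 * ρ) := sdiff_subset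
  have h2 : ball (0 : EuclideanSpace ℝ (Fin n)) (2 * ρ) ⊆ ball 0 (3 * ρ) :=
    ball_subset_ball (by linarith)
  have hc := Real.HolderConjugate.conjExponent S.one_lt
  have hv : volume (ball (0 : EuclideanSpace ℝ (Fin n)) (3 * ρ)) =
      ENNReal.ofReal (ρ ^ n) * (ENNReal.ofReal (3 ^ n) * ω) := by
    rw [Measure.addHaar_ball _ _ (by positivity), finrank_euclideanSpace_fin, mul_pow,
      ENNReal.ofReal_mul (by positivity)]
    ring
  set v := volume (ball (0 : EuclideanSpace ℝ (Fin n)) (3 * ρ)) with hvdef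
  have e1 : ∫⁻ x in shell n ρ, ‖w x‖ₑ ≤ W * v ^ (1 / p) :=
    (lintegral_mono_set hs).trans (S.setLIntegral_w_le hsub)
  have e2 : ∫⁻ x in ball 0 (2 * ρ), ENNReal.ofReal (f x) ≤
      fNorm n r p f * v ^ (1 / p.conjExponent) :=
    (lintegral_mono_set h2).trans (S.setLIntegral_f_le hsub)
  have e3 : v ^ (1 / p) * v ^ (1 / p.conjExponent) = v := by
    rw [← ENNReal.rpow_add_of_nonneg _ _ (one_div_nonneg.2 hc.nonneg)
      (one_div_nonneg.2 hc.symm.nonneg), one_div, one_div, hc.inv_add_inv_eq_one, ENNReal.rpow_one]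
  have hρn : ENNReal.ofReal (ρ ^ n) ≠ 0 := by
    rw [ne_eq, ENNReal.ofReal_eq_zero, not_le]; positivity
  calc _ ≤ (ENNReal.ofReal (ρ ^ n))⁻¹ * (W * v ^ (1 / p)) *
        (fNorm n r p f * v ^ (1 / p.conjExponent)) := by gcongr
    _ = (ENNReal.ofReal (ρ ^ n))⁻¹ * (W * fNorm n r p f) *
        (v ^ (1 / p) * v ^ (1 / p.conjExponent)) := by ring
    _ = ((ENNReal.ofReal (ρ ^ n))⁻¹ * ENNReal.ofReal (ρ ^ n)) *
        (W * fNorm n r p f * (ENNReal.ofReal (3 ^ n) * ω)) := by rw [e3, hv]; ring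
    _ = _ := by rw [ENNReal.inv_mul_cancel hρn ENNReal.ofReal_ne_top, one_mul]
    _ ≤ _ := le_rfl

/-- The function `w` cut off away from the boundary of the ball. -/
noncomputable def localized (n : ℕ) (r : ℝ) (w : EuclideanSpace ℝ (Fin n) → ℝ)
    (x : EuclideanSpace ℝ (Fin n)) : ℝ := (1 - cut n (r / 3) x) * w x

lemma localized_eq_zero (hr : 0 < r) {x : EuclideanSpace ℝ (Fin n)} (hx : 2 * (r / 3) ≤ ‖x‖) :
    localized n r w x = 0 := by
  rw [localized, cut_eq_one (by positivity) hx, sub_self, zero_mul]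

lemma localized_of_le (hr : 0 < r) {x : EuclideanSpace ℝ (Fin n)} (hx : ‖x‖ ≤ r / 3) :
    localized n r w x = w x := by
  rw [localized, cut_eq_zero (by positivity) hx, sub_zero, one_mul]

lemma abs_localized_le (x : EuclideanSpace ℝ (Fin n)) : |localized n r w x| ≤ |w x| := by
  rw [localized, abs_mul]
  refine mul_le_of_le_one_left (abs_nonneg _) ?_
  rw [abs_le]
  constructor <;> linarith [cut_nonneg (n := n) (ρ := r / 3) x, cut_le_one (n := n) (ρ := r / 3) x]

lemma fderiv_localized (hr : 0 < r) {x : EuclideanSpace ℝ (Fin n)} (hx : ‖x‖ < r / 3) :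
    fderiv ℝ (localized n r w) x = fderiv ℝ w x := by
  apply Filter.EventuallyEq.fderiv_eq
  filter_upwards [isOpen_ball.mem_nhds (mem_ball_zero_iff.2 hx)] with y hy
  exact localized_of_le hr (mem_ball_zero_iff.1 hy).le

lemma puncturedTest_localized (S : SingularData n r p d w f H V) :
    PuncturedTest n r (localized n r w) := by
  have hr := S.r_pos
  refine ⟨?_, 2 * (r / 3), by positivity, by linarith, fun x hx => localized_eq_zero hr hx⟩
  intro x hx
  apply ContDiffAt.contDiffWithinAt
  rcases lt_or_ge ‖x‖ r with h | h
  · exact (contDiff_const.sub contDiff_cut).contDiffAt.mul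
      (S.w_diff.contDiffAt (isOpen_punctured.mem_nhds (mem_punctured.2 ⟨h, hx⟩)))
  · have : localized n r w =ᶠ[𝓝 x] fun _ => 0 := by
      filter_upwards [(isOpen_lt continuous_const continuous_norm).mem_nhds
        (by simp only [mem_ofPred_eq]; linarith : x ∈ {y : EuclideanSpace ℝ (Fin n) | 2 * (r / 3) < ‖y‖})] with y hy
      exact localized_eq_zero hr (le_of_lt hy)
    exact contDiffAt_const.congr_of_eventuallyEq this

lemma enorm_integral_f_cut_localized_le (S : SingularData n r p d w f H V) (ρ : ℝ) :
    ‖∫ x in ball 0 r, f x * (cut n ρ x * localized n r w x)‖ₑ ≤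
      fNorm n r p f *
        (∫⁻ x in ball 0 r, ‖w x‖ₑ ^ p.conjExponent) ^ (1 / p.conjExponent) := by
  refine (enorm_integral_le_lintegral_enorm _).trans ?_
  refine le_trans (lintegral_mono fun x => ?_)
    (S.setLIntegral_f_mul_le subset_rfl S.aestronglyMeasurable.enorm)
  rw [enorm_mul, Real.enorm_of_nonneg (S.f_nonneg x)]
  gcongr
  rw [← ofReal_norm, ← ofReal_norm]
  refine ENNReal.ofReal_le_ofReal ?_
  rw [norm_mul, Real.norm_of_nonneg (cut_nonneg _)]
  exact (mul_le_of_le_one_left (norm_nonneg _) (cut_le_one _)).trans (abs_localized_le x)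

lemma energy_le (S : SingularData n r p d w f H V) :
    ∃ C : ENNReal, C ≠ ⊤ ∧ ∀ ρ : ℝ, 0 < ρ → 9 * ρ < r →
      ENNReal.ofReal d * ∫⁻ x in ball 0 (r / 3) \ ball 0 (2 * ρ), ‖fderiv ℝ w x‖ₑ ^ n ≤
        C + ‖(∫ x in ball 0 r, cut n ρ x * fderiv ℝ (localized n r w) x (V x)) -
          ∫ x in ball 0 r, f x * (cut n ρ x * localized n r w x)‖ₑ := by
  have hr := S.r_pos
  have hG := S.puncturedTest_localized
  set A := ∫ x in ball 0 r \ ball 0 (r / 3), fderiv ℝ (localized n r w) x (V x) with hA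
  refine ⟨fNorm n r p f *
    (∫⁻ x in ball 0 r, ‖w x‖ₑ ^ p.conjExponent) ^ (1 / p.conjExponent) + ‖A‖ₑ,
    ENNReal.add_ne_top.2 ⟨ENNReal.mul_ne_top S.fNorm_ne_top S.wNorm_ne_top, enorm_ne_top⟩,
    fun ρ hρ hρr => ?_⟩
  have hint := S.integrable_cut_fderiv hG hρ
  have hsub : ball (0 : EuclideanSpace ℝ (Fin n)) (r / 3) ⊆ ball 0 r :=
    ball_subset_ball (by linarith)
  have hsplit : ∫ x in ball 0 r, cut n ρ x * fderiv ℝ (localized n r w) x (V x) =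
      (∫ x in ball 0 (r / 3), cut n ρ x * fderiv ℝ (localized n r w) x (V x)) + A := by
    rw [← integral_inter_add_sdiff (measurableSet_ball (x := 0) (ε := r / 3)) hint,
      inter_eq_self_of_subset_right hsub]
    congr 1
    refine setIntegral_congr_fun (measurableSet_ball.diff measurableSet_ball) fun x hx => ?_
    have := hx.2
    rw [mem_ball_zero_iff, not_lt] at this
    rw [cut_eq_one hρ (by linarith), one_mul]
  have : Nonempty (Fin n) := ⟨⟨0, by have := S.two_le; omega⟩⟩
  have hae : ∀ᵐ x ∂(volume.restrict (ball (0 : EuclideanSpace ℝ (Fin n)) (r / 3))), x ≠ 0 :=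
    ae_restrict_of_ae (by simp [ae_iff])
  have hmem := ae_restrict_mem (μ := volume)
    (measurableSet_ball (x := (0 : EuclideanSpace ℝ (Fin n))) (ε := r / 3))
  have hge : ∀ᵐ x ∂(volume.restrict (ball (0 : EuclideanSpace ℝ (Fin n)) (r / 3))),
      cut n ρ x * (d * ‖fderiv ℝ w x‖ ^ n) ≤
        cut n ρ x * fderiv ℝ (localized n r w) x (V x) := by
    filter_upwards [hae, hmem] with x hx0 hx
    rw [mem_ball_zero_iff] at hx
    rw [fderiv_localized hr hx]
    exact mul_le_mul_of_nonneg_left (S.V_ge x (mem_punctured.2 ⟨by linarith, hx0⟩)) (cut_nonneg _)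
  have hnn : ∀ x, 0 ≤ cut n ρ x * (d * ‖fderiv ℝ w x‖ ^ n) := fun x =>
    mul_nonneg (cut_nonneg _) (mul_nonneg S.d_pos.le (by positivity))
  have hlow : ENNReal.ofReal d * ∫⁻ x in ball 0 (r / 3) \ ball 0 (2 * ρ), ‖fderiv ℝ w x‖ₑ ^ n ≤
      ENNReal.ofReal (∫ x in ball 0 (r / 3),
        cut n ρ x * fderiv ℝ (localized n r w) x (V x)) := by
    rw [ofReal_integral_eq_lintegral_ofReal (hint.mono_set hsub)
      (hge.mono fun x hx => (hnn x).trans hx), ← lintegral_const_mul' _ _ ENNReal.ofReal_ne_top]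
    refine le_trans ?_ (lintegral_mono_ae (hge.mono fun x hx => ENNReal.ofReal_le_ofReal hx))
    refine (setLIntegral_mono' (measurableSet_ball.diff measurableSet_ball) fun x hx => ?_).trans
      (lintegral_mono_set sdiff_subset)
    have := hx.2
    rw [mem_ball_zero_iff, not_lt] at this
    rw [cut_eq_one hρ this, one_mul, ENNReal.ofReal_mul S.d_pos.le,
      ENNReal.ofReal_pow (norm_nonneg _), ofReal_norm]
  refine hlow.trans ?_
  set I := ∫ x in ball 0 r, cut n ρ x * fderiv ℝ (localized n r w) x (V x)
  set J := ∫ x in ball 0 r, f x * (cut n ρ x * localized n r w x) with hJ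
  have hI : ∫ x in ball 0 (r / 3), cut n ρ x * fderiv ℝ (localized n r w) x (V x) =
      J - A + (I - J) := by rw [hsplit]; ring
  rw [hI]
  calc ENNReal.ofReal (J - A + (I - J)) ≤ ‖J - A + (I - J)‖ₑ := Real.ofReal_le_enorm _
    _ ≤ ‖J‖ₑ + ‖A‖ₑ + ‖I - J‖ₑ := (enorm_add_le _ _).trans (by gcongr; exact enorm_sub_le)
    _ ≤ _ := by
      gcongr
      exact S.enorm_integral_f_cut_localized_le ρ

end Energy

end SingularData

lemma le_of_geometric_growth {e : ℕ → ℝ} {τ K b : ℝ} (hτ : 0 < τ)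
    (h : ∀ j, (1 + τ) * e j ≤ e (j + 1) + 1) (hb0 : 0 ≤ b) (hb : b < 1 + τ)
    (hg : ∀ j, e j ≤ K * b ^ j) (j : ℕ) : e j ≤ 1 / τ := by
  by_contra hcon
  rw [not_le] at hcon
  set δ := e j - 1 / τ with hδ
  have hδ0 : 0 < δ := by linarith
  have hlow : ∀ i, (1 + τ) ^ i * δ ≤ e (j + i) - 1 / τ := by
    intro i
    induction i with
    | zero => simp [hδ]
    | succ i ih =>
      have h1 := h (j + i)
      have h2 : (1 + τ) * (1 / τ) = 1 / τ + 1 := by field_simp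
      calc (1 + τ) ^ (i + 1) * δ = (1 + τ) * ((1 + τ) ^ i * δ) := by ring
        _ ≤ (1 + τ) * (e (j + i) - 1 / τ) := by gcongr
        _ ≤ e (j + (i + 1)) - 1 / τ := by rw [mul_sub, h2, ← add_assoc]; linarith
  have hlim : Tendsto (fun i : ℕ => K * b ^ j * (b / (1 + τ)) ^ i) atTop (𝓝 (K * b ^ j * 0)) :=
    (tendsto_pow_atTop_nhds_zero_of_lt_one (by positivity)
      ((div_lt_one (by positivity)).2 hb)).const_mul _
  rw [mul_zero] at hlim
  obtain ⟨i, hi⟩ := (hlim.eventually_lt_const hδ0).exists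
  have h1 : (0 : ℝ) < (1 + τ) ^ i := by positivity
  have h2 : (1 + τ) ^ i * δ ≤ K * b ^ (j + i) := by
    have h3 : 0 < 1 / τ := by positivity
    linarith [hlow i, hg (j + i)]
  rw [div_pow, mul_div_assoc', div_lt_iff₀ h1] at hi
  rw [pow_add] at h2
  linarith

namespace SingularData

section Energy

variable {n : ℕ} {r p d : ℝ} {w f H : EuclideanSpace ℝ (Fin n) → ℝ}
  {V : EuclideanSpace ℝ (Fin n) → EuclideanSpace ℝ (Fin n)}

lemma aemeasurable_slope (S : SingularData n r p d w f H V) :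
    AEMeasurable (slope w H) (volume.restrict (ball 0 r)) := by
  have : Nonempty (Fin n) := ⟨⟨0, by have := S.two_le; omega⟩⟩
  have h := (S.continuousOn_fderiv.norm.add S.H_cont).aestronglyMeasurable (μ := volume)
    isOpen_punctured.measurableSet
  rw [Measure.restrict_congr_set (sdiff_null_ae_eq_self (measure_singleton 0))] at h
  exact h.aemeasurable.ennreal_ofReal

lemma lintegral_slope_rpow_lt_top (S : SingularData n r p d w f H V) {q : ℝ} (hq : 1 ≤ q)
    (hqn : q < n) : ∫⁻ x in ball 0 r, slope w H x ^ q < ⊤ := by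
  refine lt_of_eq_of_lt (lintegral_congr fun x => ?_) (S.grad_int q hq hqn).lintegral_lt_top
  rw [slope, ENNReal.ofReal_rpow_of_nonneg (add_nonneg (norm_nonneg _) (S.H_nonneg x))
    (by linarith)]

lemma enorm_integral_mul_fderiv_cut_le (S : SingularData n r p d w f H V) :
    ∃ C : ENNReal, C ≠ ⊤ ∧ ∀ G : EuclideanSpace ℝ (Fin n) → ℝ, (∀ x, |G x| ≤ |w x|) →
      ∀ ρ : ℝ, 0 < ρ → 3 * ρ < r →
      ‖∫ x in ball 0 r, G x * fderiv ℝ (cut n ρ) x (V x)‖ₑ ≤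
        C * ENNReal.ofReal (1 / ρ) * ∫⁻ x in ball 0 (3 * ρ), slope w H x ^ (n - 1) * ‖w x‖ₑ := by
  obtain ⟨M, hM0, hM⟩ := exists_norm_fderiv_cut_le n
  refine ⟨ENNReal.ofReal (2 * M), ENNReal.ofReal_ne_top, fun G hG ρ hρ hr => ?_⟩
  have : Nonempty (Fin n) := ⟨⟨0, by have := S.two_le; omega⟩⟩
  have hae : ∀ᵐ x ∂(volume.restrict (ball (0 : EuclideanSpace ℝ (Fin n)) r)), x ≠ 0 :=
    ae_restrict_of_ae (by simp [ae_iff])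
  have hsub : ball (0 : EuclideanSpace ℝ (Fin n)) (3 * ρ) ⊆ ball 0 r := ball_subset_ball hr.le
  refine (enorm_integral_le_lintegral_enorm _).trans ?_
  rw [← lintegral_const_mul' _ _ (ENNReal.mul_ne_top ENNReal.ofReal_ne_top ENNReal.ofReal_ne_top),
    ← inter_eq_self_of_subset_left hsub, ← Measure.restrict_restrict measurableSet_ball]
  refine le_trans (lintegral_mono_ae ?_) (le_of_eq (lintegral_indicator measurableSet_ball _))
  filter_upwards [hae, ae_restrict_mem measurableSet_ball] with x hx0 hx
  rw [mem_ball_zero_iff] at hx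
  by_cases h3 : x ∈ ball (0 : EuclideanSpace ℝ (Fin n)) (3 * ρ)
  · rw [indicator_of_mem h3, enorm_mul]
    have e1 : ‖G x‖ₑ ≤ ‖w x‖ₑ := by
      rw [← ofReal_norm, ← ofReal_norm]; exact ENNReal.ofReal_le_ofReal (hG x)
    have e2 : ‖fderiv ℝ (cut n ρ) x (V x)‖ₑ ≤
        ENNReal.ofReal (M / ρ) * (2 * slope w H x ^ (n - 1)) := by
      refine (ContinuousLinearMap.le_opENorm _ _).trans (mul_le_mul' ?_ (S.enorm_V_le hx hx0))
      rw [← ofReal_norm]; exact ENNReal.ofReal_le_ofReal (hM ρ hρ x)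
    have e3 : ENNReal.ofReal (2 * M) * ENNReal.ofReal (1 / ρ) = ENNReal.ofReal (M / ρ) * 2 := by
      have h2 : (2 : ENNReal) = ENNReal.ofReal 2 := by norm_num
      rw [h2, ← ENNReal.ofReal_mul (by positivity), ← ENNReal.ofReal_mul (by positivity)]
      congr 1; ring
    calc _ ≤ ‖w x‖ₑ * (ENNReal.ofReal (M / ρ) * (2 * slope w H x ^ (n - 1))) := by gcongr
      _ = (ENNReal.ofReal (M / ρ) * 2) * (slope w H x ^ (n - 1) * ‖w x‖ₑ) := by ring
      _ = _ := by rw [e3]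
  · rw [indicator_of_notMem h3]
    rw [mem_ball_zero_iff, not_lt] at h3
    rw [fderiv_cut_eq_zero_of_gt hρ (by linarith)]
    simp

lemma lintegral_slope_pow_mul_le (S : SingularData n r p d w f H V) {ε : ℝ} (hε : 0 < ε)
    (hε1 : ε < 1) :
    ∃ C : ENNReal, C ≠ ⊤ ∧ ∀ ρ : ℝ, 0 < ρ → 3 * ρ < r →
      ∫⁻ x in ball 0 (3 * ρ), slope w H x ^ (n - 1) * ‖w x‖ₑ ≤
        C * ENNReal.ofReal (ρ ^ (1 - ε)) := by
  have hn := S.two_le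
  have hnR : (2 : ℝ) ≤ n := by exact_mod_cast hn
  set s : ℝ := n / (1 - ε / 2) with hs
  set T : ℝ := 2 * n / ε with hT
  have hsn : (n : ℝ) < s := by
    rw [hs, lt_div_iff₀ (by linarith)]; nlinarith
  have hs1 : 1 < s := by linarith
  have hsT : s ≤ T := by
    rw [hs, hT, div_le_div_iff₀ (by linarith) hε]; nlinarith
  have hsT' : 1 / s - 1 / T = (1 - ε) / n := by
    rw [hs, hT]; field_simp; ring
  have hc := Real.HolderConjugate.conjExponent hs1
  set s' := s.conjExponent with hs'
  have hs'0 : 0 < s' := hc.symm.pos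
  have hq : ((n : ℝ) - 1) * s' < n := by
    rw [hs', Real.conjExponent, mul_div_assoc', div_lt_iff₀ (by linarith)]
    nlinarith
  have hq1 : 1 ≤ ((n : ℝ) - 1) * s' := by
    have : 1 < s' := hc.symm.lt
    nlinarith
  set A := (∫⁻ x in ball 0 r, slope w H x ^ (((n : ℝ) - 1) * s')) ^ (1 / s') with hA
  have hAt : A ≠ ⊤ := ENNReal.rpow_ne_top_of_nonneg (by positivity)
    (S.lintegral_slope_rpow_lt_top hq1 hq).ne
  set W := eLpNorm w (ENNReal.ofReal T) (volume.restrict (ball 0 r)) with hW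
  have hWt : W ≠ ⊤ := (S.memLp ENNReal.ofReal_ne_top).2.ne
  have : Nonempty (Fin n) := ⟨⟨0, by omega⟩⟩
  set ω := volume (ball (0 : EuclideanSpace ℝ (Fin n)) 1) with hω
  have hωt : ω ≠ ⊤ := measure_ball_lt_top.ne
  have h1ε : 0 ≤ (1 - ε) / n := by have : 0 ≤ 1 - ε := by linarith
                                   positivity
  refine ⟨A * (W * (ENNReal.ofReal (3 ^ (1 - ε)) * ω ^ ((1 - ε) / n))), ?_, fun ρ hρ hr => ?_⟩
  · exact ENNReal.mul_ne_top hAt (ENNReal.mul_ne_top hWt (ENNReal.mul_ne_top ENNReal.ofReal_ne_top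
      (ENNReal.rpow_ne_top_of_nonneg h1ε hωt)))
  have hsub : ball (0 : EuclideanSpace ℝ (Fin n)) (3 * ρ) ⊆ ball 0 r := ball_subset_ball hr.le
  have hv : volume (ball (0 : EuclideanSpace ℝ (Fin n)) (3 * ρ)) ^ ((1 - ε) / n) =
      ENNReal.ofReal (3 ^ (1 - ε)) * ω ^ ((1 - ε) / n) * ENNReal.ofReal (ρ ^ (1 - ε)) := by
    rw [Measure.addHaar_ball _ _ (by positivity), finrank_euclideanSpace_fin,
      ENNReal.mul_rpow_of_nonneg _ _ h1ε, ENNReal.ofReal_rpow_of_nonneg (by positivity) h1ε,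
      ← Real.rpow_natCast, ← Real.rpow_mul (by positivity), mul_div_cancel₀ _ (by positivity),
      Real.mul_rpow (by positivity) hρ.le, ENNReal.ofReal_mul (by positivity)]
    ring
  have h := ENNReal.lintegral_mul_le_Lp_mul_Lq (volume.restrict (ball 0 (3 * ρ))) hc.symm
    (f := fun x => slope w H x ^ (n - 1)) (g := fun x => ‖w x‖ₑ)
    ((S.aemeasurable_slope.mono_measure (Measure.restrict_mono_set _ hsub)).pow_const _)
    (S.aestronglyMeasurable.mono_set hsub).enorm
  have e1 : (∫⁻ x in ball 0 (3 * ρ), (slope w H x ^ (n - 1)) ^ s') ^ (1 / s') ≤ A := by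
    refine ENNReal.rpow_le_rpow ((lintegral_mono_set hsub).trans (le_of_eq ?_)) (by positivity)
    refine lintegral_congr fun x => ?_
    rw [← ENNReal.rpow_natCast, ← ENNReal.rpow_mul, Nat.cast_sub (by omega), Nat.cast_one]
  have e2 : (∫⁻ x in ball 0 (3 * ρ), ‖w x‖ₑ ^ s) ^ (1 / s) ≤
      W * (volume (ball (0 : EuclideanSpace ℝ (Fin n)) (3 * ρ)) ^ ((1 - ε) / n)) := by
    have h1 := eLpNorm_le_eLpNorm_mul_rpow_measure_univ
      (ENNReal.ofReal_le_ofReal hsT) (S.aestronglyMeasurable.mono_set hsub)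
    rw [eLpNorm_eq_lintegral_rpow_enorm_toReal (by simp; linarith) ENNReal.ofReal_ne_top,
      ENNReal.toReal_ofReal (by linarith), ENNReal.toReal_ofReal (by linarith), hsT',
      Measure.restrict_apply MeasurableSet.univ, univ_inter] at h1
    refine h1.trans (mul_le_mul_left ?_ _)
    exact eLpNorm_mono_measure _ (Measure.restrict_mono_set _ hsub)
  refine h.trans ((mul_le_mul' e1 e2).trans (le_of_eq ?_))
  rw [hv]; ring

lemma energy_growth (S : SingularData n r p d w f H V) {ε : ℝ} (hε : 0 < ε) (hε1 : ε < 1) :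
    ∃ C : ENNReal, C ≠ ⊤ ∧ ∀ ρ : ℝ, 0 < ρ → 9 * ρ < r →
      ENNReal.ofReal d * ∫⁻ x in ball 0 (r / 3) \ ball 0 (2 * ρ), ‖fderiv ℝ w x‖ₑ ^ n ≤
        C + C * ENNReal.ofReal (ρ ^ (-ε)) := by
  obtain ⟨C₁, h₁, H₁⟩ := S.energy_le
  obtain ⟨C₂, h₂, H₂⟩ := S.enorm_integral_mul_fderiv_cut_le
  obtain ⟨C₃, h₃, H₃⟩ := S.lintegral_slope_pow_mul_le hε hε1
  refine ⟨max C₁ (C₂ * C₃), (max_lt h₁.lt_top (ENNReal.mul_lt_top h₂.lt_top h₃.lt_top)).ne,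
    fun ρ hρ hr => ?_⟩
  refine (H₁ ρ hρ hr).trans (add_le_add (le_max_left _ _) ?_)
  rw [S.integral_cut_fderiv S.puncturedTest_localized hρ (by linarith), sub_sub_cancel_left,
    enorm_neg]
  refine (H₂ _ abs_localized_le ρ hρ (by linarith)).trans ?_
  calc _ ≤ C₂ * ENNReal.ofReal (1 / ρ) * (C₃ * ENNReal.ofReal (ρ ^ (1 - ε))) := by
        gcongr; exact H₃ ρ hρ (by linarith)
    _ = C₂ * C₃ * ENNReal.ofReal (ρ ^ (-ε)) := by
        have : ρ ^ (-ε) = 1 / ρ * ρ ^ (1 - ε) := by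
          rw [sub_eq_add_neg, Real.rpow_add hρ, Real.rpow_one]; field_simp
        rw [this, ENNReal.ofReal_mul (by positivity)]; ring
    _ ≤ _ := by gcongr; exact le_max_right _ _

lemma slope_pow_le (S : SingularData n r p d w f H V) (x : EuclideanSpace ℝ (Fin n)) :
    slope w H x ^ n ≤ 2 ^ n * (‖fderiv ℝ w x‖ₑ ^ n + ENNReal.ofReal (H x) ^ n) := by
  have h1 : slope w H x ≤ 2 * max ‖fderiv ℝ w x‖ₑ (ENNReal.ofReal (H x)) := by
    rw [slope, ENNReal.ofReal_add (norm_nonneg _) (S.H_nonneg x), ofReal_norm, two_mul]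
    exact add_le_add (le_max_left _ _) (le_max_right _ _)
  calc slope w H x ^ n ≤ (2 * max ‖fderiv ℝ w x‖ₑ (ENNReal.ofReal (H x))) ^ n := by gcongr
    _ ≤ _ := by
      rw [mul_pow]
      gcongr
      rcases le_total ‖fderiv ℝ w x‖ₑ (ENNReal.ofReal (H x)) with h | h
      · rw [max_eq_right h]; exact le_add_self
      · rw [max_eq_left h]; exact le_self_add

lemma lintegral_shell_slope_le (S : SingularData n r p d w f H V) :
    ∃ C : ENNReal, C ≠ ⊤ ∧ ∀ ρ : ℝ, 0 < ρ → 6 * ρ < r →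
      ∫⁻ x in shell n ρ, slope w H x ^ n ≤
        2 ^ n * (∫⁻ x in shell n ρ, ‖fderiv ℝ w x‖ₑ ^ n) + C := by
  obtain ⟨C, hC, h⟩ := S.H_shell
  refine ⟨2 ^ n * C, ENNReal.mul_ne_top (by simp) hC, fun ρ hρ hr => ?_⟩
  refine (lintegral_mono fun x => S.slope_pow_le x).trans ?_
  rw [lintegral_const_mul' _ _ (by simp), lintegral_add_left' , mul_add]
  · gcongr; exact h ρ hρ hr
  · refine (S.aestronglyMeasurable_fderiv.mono_set ?_).enorm.pow_const _
    exact sdiff_subset.trans (ball_subset_ball (by linarith))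

lemma energy_hole (S : SingularData n r p d w f H V) :
    ∃ C : ENNReal, C ≠ ⊤ ∧ ∀ ρ : ℝ, 0 < ρ → 9 * ρ < r →
      ENNReal.ofReal d * ∫⁻ x in ball 0 (r / 3) \ ball 0 (2 * ρ), ‖fderiv ℝ w x‖ₑ ^ n ≤
        C * (1 + ∫⁻ x in shell n ρ, ‖fderiv ℝ w x‖ₑ ^ n) := by
  have hr := S.r_pos
  obtain ⟨C₁, h₁, H₁⟩ := S.energy_le
  obtain ⟨C₂, h₂, H₂⟩ := S.enorm_integral_cut_sub_le
  obtain ⟨C₃, h₃, H₃⟩ := S.lintegral_shell_slope_le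
  obtain ⟨C₄, h₄, H₄⟩ := S.setLIntegral_f_mul_setLIntegral_w_le
  refine ⟨C₁ + C₃ + C₂ * C₄ + 2 ^ n + C₂, by finiteness, fun ρ hρ hρr => ?_⟩
  set X := ∫⁻ x in shell n ρ, ‖fderiv ℝ w x‖ₑ ^ n with hX
  refine (H₁ ρ hρ hρr).trans ?_
  have e := H₂ _ S.puncturedTest_localized ρ hρ (by linarith) 1 one_ne_zero ENNReal.one_ne_top
  have e1 : ∫⁻ x in shell n ρ, ‖fderiv ℝ (localized n r w) x‖ₑ ^ n = X := by
    refine setLIntegral_congr_fun (measurableSet_shell) fun x hx => ?_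
    have hx' : ‖x‖ < 3 * ρ := by simpa using hx.1
    rw [fderiv_localized hr (by linarith)]
  have e2 : ∫⁻ x in shell n ρ, ‖localized n r w x‖ₑ ≤ ∫⁻ x in shell n ρ, ‖w x‖ₑ := by
    refine lintegral_mono fun x => ?_
    rw [← ofReal_norm, ← ofReal_norm]; exact ENNReal.ofReal_le_ofReal (abs_localized_le x)
  rw [e1, inv_one, one_pow, mul_one, one_mul] at e
  have e3 : C₂ * (ENNReal.ofReal (ρ ^ n))⁻¹ * (∫⁻ x in shell n ρ, ‖localized n r w x‖ₑ) *
      (∫⁻ x in ball 0 (2 * ρ), ENNReal.ofReal (f x)) ≤ C₂ * C₄ := by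
    refine le_trans ?_ (mul_le_mul_right (H₄ ρ hρ (by linarith)) C₂)
    rw [mul_assoc C₂, mul_assoc C₂]
    gcongr
  calc _ ≤ C₁ + (2 ^ n * X + C₃ + C₂ * X + C₂ * C₄) := by
        refine add_le_add le_rfl (e.trans ?_)
        gcongr
        exact H₃ ρ hρ (by linarith)
    _ = (C₁ + C₃ + C₂ * C₄) * 1 + (2 ^ n + C₂) * X := by ring
    _ ≤ (C₁ + C₃ + C₂ * C₄ + 2 ^ n + C₂) * 1 + (C₁ + C₃ + C₂ * C₄ + 2 ^ n + C₂) * X := by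
        refine add_le_add (mul_le_mul_left ?_ _) (mul_le_mul_left ?_ _)
        · rw [add_assoc (C₁ + C₃ + C₂ * C₄)]; exact le_self_add
        · rw [add_assoc (C₁ + C₃ + C₂ * C₄)]; exact le_add_self
    _ = _ := by ring

lemma energy_hole_real (S : SingularData n r p d w f H V) :
    ∃ C : ENNReal, C ≠ 0 ∧ C ≠ ⊤ ∧ ∀ ρ : ℝ, 0 < ρ → 9 * ρ < r →
      (∫⁻ x in ball 0 (r / 3) \ ball 0 (3 * ρ), ‖fderiv ℝ w x‖ₑ ^ n) +
        C * (∫⁻ x in ball 0 (r / 3) \ ball 0 (3 * ρ), ‖fderiv ℝ w x‖ₑ ^ n) ≤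
        C * (1 + ∫⁻ x in ball 0 (r / 3) \ ball 0 (ρ / (2 * n)), ‖fderiv ℝ w x‖ₑ ^ n) := by
  obtain ⟨C, hC, h⟩ := S.energy_hole
  have hn := S.two_le
  have hd : ENNReal.ofReal d ≠ 0 := by simpa using S.d_pos
  refine ⟨(ENNReal.ofReal d)⁻¹ * C + 1, by simp, by finiteness, fun ρ hρ hr => ?_⟩
  set C' := (ENNReal.ofReal d)⁻¹ * C + 1 with hC'
  set E := fun s : ℝ => ∫⁻ x in ball 0 (r / 3) \ ball 0 s, ‖fderiv ℝ w x‖ₑ ^ n with hE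
  have h1 : E (3 * ρ) ≤ E (2 * ρ) :=
    lintegral_mono_set (sdiff_subset_sdiff_right (ball_subset_ball (by linarith)))
  have h2 : E (2 * ρ) ≤ C' * (1 + ∫⁻ x in shell n ρ, ‖fderiv ℝ w x‖ₑ ^ n) := by
    calc E (2 * ρ) = (ENNReal.ofReal d)⁻¹ * (ENNReal.ofReal d * E (2 * ρ)) := by
          rw [← mul_assoc, ENNReal.inv_mul_cancel hd ENNReal.ofReal_ne_top, one_mul]
      _ ≤ (ENNReal.ofReal d)⁻¹ * (C * (1 + ∫⁻ x in shell n ρ, ‖fderiv ℝ w x‖ₑ ^ n)) := by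
          exact mul_le_mul_right (h ρ hρ hr) _
      _ ≤ _ := by rw [← mul_assoc]; gcongr; exact le_self_add
  have h3 : (∫⁻ x in shell n ρ, ‖fderiv ℝ w x‖ₑ ^ n) + E (3 * ρ) ≤ E (ρ / (2 * n)) := by
    rw [hE]
    simp only
    rw [← lintegral_union (measurableSet_ball.diff measurableSet_ball)]
    · refine lintegral_mono_set (union_subset ?_ ?_)
      · rw [shell]
        exact sdiff_subset_sdiff (ball_subset_ball (by linarith)) ball_subset_closedBall
      · refine sdiff_subset_sdiff_right (ball_subset_ball ?_)
        have : (2 : ℝ) ≤ n := by exact_mod_cast hn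
        rw [div_le_iff₀ (by positivity)]
        nlinarith
    · rw [Set.disjoint_left]
      intro x hx hx'
      exact hx'.2 hx.1
  calc E (3 * ρ) + C' * E (3 * ρ)
      ≤ C' * (1 + ∫⁻ x in shell n ρ, ‖fderiv ℝ w x‖ₑ ^ n) + C' * E (3 * ρ) := by
        gcongr; exact h1.trans h2
    _ = C' * (1 + ((∫⁻ x in shell n ρ, ‖fderiv ℝ w x‖ₑ ^ n) + E (3 * ρ))) := by ring
    _ ≤ C' * (1 + E (ρ / (2 * n))) := by gcongr

lemma energy_ne_top (S : SingularData n r p d w f H V) {ρ : ℝ} (hρ : 0 < ρ) :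
    ∫⁻ x in ball 0 (r / 3) \ ball 0 ρ, ‖fderiv ℝ w x‖ₑ ^ n ≠ ⊤ := by
  have hr := S.r_pos
  have hcomp : IsCompact (closedBall (0 : EuclideanSpace ℝ (Fin n)) (r / 3) \ ball 0 ρ) :=
    (isCompact_closedBall _ _).diff isOpen_ball
  have hsub : closedBall (0 : EuclideanSpace ℝ (Fin n)) (r / 3) \ ball 0 ρ ⊆ ball 0 r \ {0} :=
    sdiff_subset_sdiff (closedBall_subset_ball (by linarith))
      (singleton_subset_iff.2 (mem_ball_self hρ))
  have h := (((S.continuousOn_fderiv.mono hsub).norm.pow n).integrableOn_compact hcomp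
    (μ := volume)).lintegral_lt_top
  refine ((lintegral_mono_set (sdiff_subset_sdiff_left ball_subset_closedBall)).trans_lt
    (lt_of_eq_of_lt (lintegral_congr fun x => ?_) h)).ne
  rw [Pi.pow_apply, ENNReal.ofReal_pow (norm_nonneg _), ofReal_norm]

lemma exists_energy_le (S : SingularData n r p d w f H V) :
    ∃ K : ENNReal, K ≠ ⊤ ∧ ∃ ρ₀ > 0, ∃ L > 1, ∀ j : ℕ,
      ∫⁻ x in ball 0 (r / 3) \ ball 0 (ρ₀ / L ^ j), ‖fderiv ℝ w x‖ₑ ^ n ≤ K := by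
  have hr := S.r_pos
  have hn := S.two_le
  have hnR : (2 : ℝ) ≤ n := by exact_mod_cast hn
  obtain ⟨C, hC0, hC, h⟩ := S.energy_hole_real
  set L : ℝ := 6 * n with hL
  have hL1 : 1 < L := by linarith
  have hCpos : 0 < C.toReal := ENNReal.toReal_pos hC0 hC
  set τ := 1 / C.toReal with hτ
  have hτ0 : 0 < τ := by positivity
  obtain ⟨ε, hε0, hε1, hεL⟩ : ∃ ε : ℝ, 0 < ε ∧ ε < 1 ∧ L ^ ε < 1 + τ := by
    have hc : Tendsto (fun ε : ℝ => L ^ ε) (𝓝[>] 0) (𝓝 (L ^ (0 : ℝ))) :=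
      ((Real.continuous_const_rpow (by linarith)).tendsto 0).mono_left nhdsWithin_le_nhds
    rw [Real.rpow_zero] at hc
    have h1 := hc.eventually_lt_const (by linarith : (1 : ℝ) < 1 + τ)
    obtain ⟨ε, h2, h3⟩ := (h1.and (Ioo_mem_nhdsGT (zero_lt_one' ℝ))).exists
    exact ⟨ε, h3.1, h3.2, h2⟩
  obtain ⟨D, hD, hgrow⟩ := S.energy_growth hε0 hε1
  set E := fun s : ℝ => ∫⁻ x in ball 0 (r / 3) \ ball 0 s, ‖fderiv ℝ w x‖ₑ ^ n with hE
  set ρ : ℕ → ℝ := fun j => r / 10 / L ^ j with hρ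
  have hρ0 : ∀ j, 0 < ρ j := fun j => by positivity
  have hρr : ∀ j, 9 * ρ j < r := fun j => by
    have : ρ j ≤ r / 10 := div_le_self (by positivity) (one_le_pow₀ hL1.le)
    linarith
  have hEt : ∀ j, E (3 * ρ j) ≠ ⊤ := fun j => S.energy_ne_top (by have := hρ0 j; positivity)
  have hstep : ∀ j, (1 + τ) * (E (3 * ρ j)).toReal ≤ (E (3 * ρ (j + 1))).toReal + 1 := by
    intro j
    have h1 := h (ρ j) (hρ0 j) (hρr j)
    have h2 : ρ j / (2 * n) = 3 * ρ (j + 1) := by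
      simp only [hρ, hL, pow_succ]; field_simp; ring
    rw [h2] at h1
    have h3 := ENNReal.toReal_mono (ENNReal.mul_ne_top hC
      (ENNReal.add_ne_top.2 ⟨ENNReal.one_ne_top, hEt (j + 1)⟩)) h1
    rw [ENNReal.toReal_add (hEt j) (ENNReal.mul_ne_top hC (hEt j)), ENNReal.toReal_mul,
      ENNReal.toReal_mul, ENNReal.toReal_add ENNReal.one_ne_top (hEt (j + 1)),
      ENNReal.toReal_one] at h3
    change (E (3 * ρ j)).toReal + C.toReal * (E (3 * ρ j)).toReal ≤
      C.toReal * (1 + (E (3 * ρ (j + 1))).toReal) at h3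
    have h4 : C.toReal * τ = 1 := by rw [hτ]; field_simp
    refine le_of_mul_le_mul_left ?_ hCpos
    calc C.toReal * ((1 + τ) * (E (3 * ρ j)).toReal)
        = C.toReal * (E (3 * ρ j)).toReal + (C.toReal * τ) * (E (3 * ρ j)).toReal := by ring
      _ ≤ _ := by rw [h4]; linarith
  have hg : ∀ j, (E (3 * ρ j)).toReal ≤
      (D.toReal + D.toReal * (r / 10) ^ (-ε)) / d * (L ^ ε) ^ j := by
    intro j
    have h1 := hgrow (ρ j) (hρ0 j) (hρr j)
    have h2 : E (3 * ρ j) ≤ E (2 * ρ j) :=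
      lintegral_mono_set (sdiff_subset_sdiff_right (ball_subset_ball (by linarith [hρ0 j])))
    have h3 : ENNReal.ofReal d * E (3 * ρ j) ≤ D + D * ENNReal.ofReal (ρ j ^ (-ε)) :=
      (mul_le_mul_right h2 _).trans h1
    have h4 := ENNReal.toReal_mono (by finiteness) h3
    rw [ENNReal.toReal_mul, ENNReal.toReal_add hD (by finiteness), ENNReal.toReal_mul,
      ENNReal.toReal_ofReal S.d_pos.le, ENNReal.toReal_ofReal (by have := hρ0 j; positivity)] at h4
    have h5 : ρ j ^ (-ε) = (r / 10) ^ (-ε) * (L ^ ε) ^ j := by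
      simp only [hρ]
      rw [Real.div_rpow (by positivity) (by positivity), Real.rpow_neg (by positivity) ε,
        Real.rpow_neg (by positivity) ε, ← Real.rpow_natCast, ← Real.rpow_natCast,
        ← Real.rpow_mul (by positivity), ← Real.rpow_mul (by positivity), mul_comm ε, div_inv_eq_mul]
    have h6 : 1 ≤ (L ^ ε) ^ j := one_le_pow₀ (Real.one_le_rpow hL1.le hε0.le)
    rw [div_mul_eq_mul_div, le_div_iff₀ S.d_pos]
    rw [h5] at h4
    calc _ = d * (E (3 * ρ j)).toReal := mul_comm _ _
      _ ≤ _ := h4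
      _ ≤ D.toReal * (L ^ ε) ^ j + D.toReal * ((r / 10) ^ (-ε) * (L ^ ε) ^ j) := by
        gcongr; exact le_mul_of_one_le_right ENNReal.toReal_nonneg h6
      _ = _ := by ring
  have hfin := le_of_geometric_growth hτ0 hstep (by positivity) hεL hg
  refine ⟨ENNReal.ofReal (1 / τ), ENNReal.ofReal_ne_top, 3 * (r / 10), by positivity, L, hL1,
    fun j => ?_⟩
  have h1 := hfin j
  rw [← ENNReal.le_ofReal_iff_toReal_le (hEt j) (by positivity)] at h1
  rwa [mul_div_assoc]

lemma lintegral_fderiv_pow_lt_top (S : SingularData n r p d w f H V) :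
    ∫⁻ x in ball 0 (r / 3), ‖fderiv ℝ w x‖ₑ ^ n < ⊤ := by
  have hr := S.r_pos
  have : Nonempty (Fin n) := ⟨⟨0, by have := S.two_le; omega⟩⟩
  obtain ⟨K, hK, ρ₀, hρ₀, L, hL, h⟩ := S.exists_energy_le
  have hU : ⋃ j : ℕ, (ball (0 : EuclideanSpace ℝ (Fin n)) (r / 3) \ ball 0 (ρ₀ / L ^ j)) =
      ball 0 (r / 3) \ {0} := by
    ext x
    simp only [mem_iUnion, Set.mem_sdiff, mem_ball_zero_iff, not_lt, mem_singleton_iff,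
      exists_and_left, and_congr_right_iff]
    intro hx
    constructor
    · rintro ⟨j, hj⟩ rfl
      rw [norm_zero] at hj
      have : 0 < ρ₀ / L ^ j := by positivity
      linarith
    · intro hx0
      have h0 : 0 < ‖x‖ := norm_pos_iff.2 hx0
      obtain ⟨j, hj⟩ := pow_unbounded_of_one_lt (ρ₀ / ‖x‖) hL
      refine ⟨j, ?_⟩
      rw [div_le_iff₀ (by positivity)]
      rw [div_lt_iff₀ h0] at hj
      linarith
  have hmono : Monotone fun j : ℕ =>
      (ball (0 : EuclideanSpace ℝ (Fin n)) (r / 3) \ ball 0 (ρ₀ / L ^ j)) := by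
    intro i j hij
    refine sdiff_subset_sdiff_right (ball_subset_ball ?_)
    exact div_le_div_of_nonneg_left hρ₀.le (by positivity) (pow_le_pow_right₀ hL.le hij)
  rw [← Measure.restrict_congr_set (sdiff_null_ae_eq_self (measure_singleton 0)), ← hU,
    setLIntegral_iUnion_of_directed _ hmono.directed_le]
  exact (iSup_le h).trans_lt hK.lt_top

end Energy

end SingularData

namespace SingularData

section Vanishing

variable {n : ℕ} {r p d : ℝ} {w f H : EuclideanSpace ℝ (Fin n) → ℝ}
  {V : EuclideanSpace ℝ (Fin n) → EuclideanSpace ℝ (Fin n)} {θ : ℝ → ℝ}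

/-- A sequence of radii decreasing to zero. -/
noncomputable def radius (r : ℝ) (j : ℕ) : ℝ := r / 10 / (j + 1)

lemma radius_pos (hr : 0 < r) (j : ℕ) : 0 < radius r j := by unfold radius; positivity

lemma radius_lt (hr : 0 < r) (j : ℕ) : 9 * radius r j < r := by
  have : radius r j ≤ r / 10 := div_le_self (by positivity) (by linarith [j.cast_nonneg (α := ℝ)])
  linarith

lemma tendsto_radius (r : ℝ) : Tendsto (radius r) atTop (𝓝 0) := by
  have := (tendsto_one_div_add_atTop_nhds_zero_nat (𝕜 := ℝ)).const_mul (r / 10)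
  rw [mul_zero] at this
  exact this.congr fun j => by rw [radius, mul_one_div]

lemma tendsto_setLIntegral_ball {g : EuclideanSpace ℝ (Fin n) → ENNReal} (hn : 2 ≤ n) {R c : ℝ}
    (hg : ∫⁻ x in ball 0 R, g x ≠ ⊤) (hr : 0 < r) (hc : 0 < c) (hcR : c * r ≤ 9 * R) :
    Tendsto (fun j => ∫⁻ x in ball 0 (c * radius r j), g x) atTop (𝓝 0) := by
  have : Nonempty (Fin n) := ⟨⟨0, by omega⟩⟩
  have hsub : ∀ j, ball (0 : EuclideanSpace ℝ (Fin n)) (c * radius r j) ⊆ ball 0 R := fun j =>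
    ball_subset_ball (by nlinarith [radius_lt hr j])
  have h : Tendsto (fun j => volume.restrict (ball 0 R)
      (ball (0 : EuclideanSpace ℝ (Fin n)) (c * radius r j))) atTop (𝓝 0) := by
    have h1 : ∀ j, volume.restrict (ball 0 R) (ball (0 : EuclideanSpace ℝ (Fin n))
        (c * radius r j)) = ENNReal.ofReal ((c * radius r j) ^ n) *
          volume (ball (0 : EuclideanSpace ℝ (Fin n)) 1) := by
      intro j
      have := radius_pos hr j
      rw [Measure.restrict_apply measurableSet_ball, inter_eq_self_of_subset_left (hsub j),
        Measure.addHaar_ball _ _ (by positivity), finrank_euclideanSpace_fin]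
    simp_rw [h1]
    have h2 : Tendsto (fun j => ENNReal.ofReal ((c * radius r j) ^ n)) atTop
        (𝓝 (ENNReal.ofReal ((c * 0) ^ n))) :=
      ENNReal.tendsto_ofReal (((tendsto_radius r).const_mul c).pow n)
    have h3 := ENNReal.Tendsto.mul_const (b := volume (ball (0 : EuclideanSpace ℝ (Fin n)) 1)) h2
      (Or.inr measure_ball_lt_top.ne)
    simpa [show n ≠ 0 by omega] using h3
  have h4 := tendsto_setLIntegral_zero hg h
  refine h4.congr fun j => ?_
  rw [Measure.restrict_restrict measurableSet_ball, inter_eq_self_of_subset_left (hsub j)]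

lemma tendsto_lintegral_shell_fderiv_trunc (S : SingularData n r p d w f H V) (hθ : Profile θ) :
    Tendsto (fun j => ∫⁻ x in shell n (radius r j), ‖fderiv ℝ (trunc n r w θ) x‖ₑ ^ n) atTop
      (𝓝 0) := by
  have hr := S.r_pos
  obtain ⟨L, hL0, hL⟩ := hθ.exists_le
  have h := ENNReal.Tendsto.const_mul (a := ENNReal.ofReal L ^ n)
    (tendsto_setLIntegral_ball S.two_le S.lintegral_fderiv_pow_lt_top.ne hr (c := 3) (by norm_num)
      (by linarith)) (Or.inr (by finiteness))
  rw [mul_zero] at h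
  refine tendsto_of_tendsto_of_tendsto_of_le_of_le tendsto_const_nhds h (fun _ => zero_le)
    fun j => ?_
  simp only
  rw [← lintegral_const_mul' _ _ (by finiteness)]
  refine (setLIntegral_mono_ae' measurableSet_shell ?_).trans (lintegral_mono_set sdiff_subset)
  filter_upwards with x hx
  have hx0 : x ≠ 0 := shell_subset_compl_zero (radius_pos hr j) hx
  have hxr : ‖x‖ < r := by
    have h1 := mem_ball_zero_iff.1 hx.1
    linarith [radius_lt hr j, radius_pos hr j]
  rw [S.fderiv_trunc hθ hxr hx0, enorm_smul, mul_pow]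
  gcongr
  rw [Real.enorm_of_nonneg (hθ.nonneg _)]
  exact ENNReal.ofReal_le_ofReal (hL _)

lemma tendsto_third (S : SingularData n r p d w f H V) (hθ : Profile θ) :
    Tendsto (fun j => (ENNReal.ofReal (radius r j ^ n))⁻¹ *
      (∫⁻ x in shell n (radius r j), ‖trunc n r w θ x‖ₑ) *
        ∫⁻ x in ball 0 (2 * radius r j), ENNReal.ofReal (f x)) atTop (𝓝 0) := by
  have hr := S.r_pos
  have : Nonempty (Fin n) := ⟨⟨0, by have := S.two_le; omega⟩⟩
  obtain ⟨K, hK0, hK⟩ := trunc_bdd hθ w r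
  set ω := volume (ball (0 : EuclideanSpace ℝ (Fin n)) 1) with hω
  have hωt : ω ≠ ⊤ := measure_ball_lt_top.ne
  have h := ENNReal.Tendsto.const_mul (a := ENNReal.ofReal K * (ENNReal.ofReal (3 ^ n) * ω))
    (tendsto_setLIntegral_ball S.two_le S.f_integrableOn.lintegral_lt_top.ne hr (c := 2)
      (by norm_num) (by linarith)) (Or.inr (by finiteness))
  rw [mul_zero] at h
  refine tendsto_of_tendsto_of_tendsto_of_le_of_le tendsto_const_nhds h (fun _ => zero_le)
    fun j => ?_
  simp only
  refine mul_le_mul_left ?_ _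
  set ρ := radius r j with hρdef
  have hρ : 0 < ρ := radius_pos hr j
  have hρn : ENNReal.ofReal (ρ ^ n) ≠ 0 := by
    rw [ne_eq, ENNReal.ofReal_eq_zero, not_le]; positivity
  have h1 : ∫⁻ x in shell n ρ, ‖trunc n r w θ x‖ₑ ≤
      ENNReal.ofReal K * (ENNReal.ofReal (ρ ^ n) * (ENNReal.ofReal (3 ^ n) * ω)) := by
    have hv : volume (ball (0 : EuclideanSpace ℝ (Fin n)) (3 * ρ)) =
        ENNReal.ofReal (ρ ^ n) * (ENNReal.ofReal (3 ^ n) * ω) := by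
      rw [Measure.addHaar_ball _ _ (by positivity), finrank_euclideanSpace_fin, mul_pow,
        ENNReal.ofReal_mul (by positivity)]
      ring
    rw [← hv]
    calc _ ≤ ∫⁻ x in shell n ρ, ENNReal.ofReal K := by
          refine lintegral_mono fun x => ?_
          rw [← ofReal_norm]; exact ENNReal.ofReal_le_ofReal (hK x)
      _ = ENNReal.ofReal K * volume (shell n ρ) := setLIntegral_const _ _
      _ ≤ _ := by gcongr; exact sdiff_subset
  calc _ ≤ (ENNReal.ofReal (ρ ^ n))⁻¹ *
        (ENNReal.ofReal K * (ENNReal.ofReal (ρ ^ n) * (ENNReal.ofReal (3 ^ n) * ω))) := mul_le_mul_right h1 _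
    _ = ((ENNReal.ofReal (ρ ^ n))⁻¹ * ENNReal.ofReal (ρ ^ n)) *
        (ENNReal.ofReal K * (ENNReal.ofReal (3 ^ n) * ω)) := by ring
    _ = _ := by rw [ENNReal.inv_mul_cancel hρn ENNReal.ofReal_ne_top, one_mul]
    _ ≤ _ := le_rfl

lemma exists_lintegral_shell_slope_le (S : SingularData n r p d w f H V) :
    ∃ K : ENNReal, K ≠ ⊤ ∧ ∀ j, ∫⁻ x in shell n (radius r j), slope w H x ^ n ≤ K := by
  have hr := S.r_pos
  obtain ⟨C, hC, h⟩ := S.lintegral_shell_slope_le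
  have hE := S.lintegral_fderiv_pow_lt_top.ne
  refine ⟨2 ^ n * (∫⁻ x in ball 0 (r / 3), ‖fderiv ℝ w x‖ₑ ^ n) + C, by finiteness, fun j => ?_⟩
  have h1 := radius_pos hr j
  have h2 := radius_lt hr j
  refine (h _ h1 (by linarith)).trans ?_
  gcongr
  exact sdiff_subset.trans (ball_subset_ball (by linarith))

lemma tendsto_error (S : SingularData n r p d w f H V) (hθ : Profile θ) :
    Tendsto (fun j => ‖(∫ x in ball 0 r, cut n (radius r j) x *
        fderiv ℝ (trunc n r w θ) x (V x)) -
      ∫ x in ball 0 r, f x * (cut n (radius r j) x * trunc n r w θ x)‖ₑ) atTop (𝓝 0) := by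
  have hr := S.r_pos
  obtain ⟨C, hC, hK⟩ := S.enorm_integral_cut_sub_le
  obtain ⟨K, hKt, hslope⟩ := S.exists_lintegral_shell_slope_le
  rw [ENNReal.tendsto_nhds_zero]
  intro ε hε
  have hε2 : 0 < ε / 2 := ENNReal.div_pos hε.ne' (by simp)
  obtain ⟨l, hl0, hlt, hlK⟩ : ∃ l : ENNReal, l ≠ 0 ∧ l ≠ ⊤ ∧ l * K ≤ ε / 2 := by
    refine ⟨min 1 (ε / 2 / (K + 1)), ?_, ne_top_of_le_ne_top ENNReal.one_ne_top (min_le_left _ _),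
      ?_⟩
    · refine (lt_min one_pos (ENNReal.div_pos hε2.ne' (by finiteness))).ne'
    · calc _ ≤ ε / 2 / (K + 1) * (K + 1) := by
            gcongr
            · exact min_le_right _ _
            · exact le_self_add
        _ = ε / 2 := ENNReal.div_mul_cancel (by simp) (by finiteness)
  have hsum : Tendsto (fun j => C * l⁻¹ ^ (n - 1) *
      (∫⁻ x in shell n (radius r j), ‖fderiv ℝ (trunc n r w θ) x‖ₑ ^ n) +
      C * ((ENNReal.ofReal (radius r j ^ n))⁻¹ *
        (∫⁻ x in shell n (radius r j), ‖trunc n r w θ x‖ₑ) *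
        ∫⁻ x in ball 0 (2 * radius r j), ENNReal.ofReal (f x))) atTop
      (𝓝 (C * l⁻¹ ^ (n - 1) * 0 + C * 0)) :=
    (ENNReal.Tendsto.const_mul (S.tendsto_lintegral_shell_fderiv_trunc hθ)
      (Or.inr (ENNReal.mul_ne_top hC (ENNReal.pow_ne_top (ENNReal.inv_ne_top.2 hl0))))).add
    (ENNReal.Tendsto.const_mul (S.tendsto_third hθ) (Or.inr hC))
  rw [mul_zero, mul_zero, add_zero] at hsum
  filter_upwards [(ENNReal.tendsto_nhds_zero.1 hsum) (ε / 2) hε2] with j hj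
  have h1 := hK _ (S.puncturedTest_trunc hθ) (radius r j) (radius_pos hr j)
    (by linarith [radius_pos hr j, radius_lt hr j]) l hl0 hlt
  refine h1.trans ?_
  rw [add_assoc, ← ENNReal.add_halves ε]
  refine add_le_add ((mul_le_mul_right (hslope j) _).trans hlK) ?_
  refine le_trans (le_of_eq ?_) hj
  ring

lemma tendsto_cut {x : EuclideanSpace ℝ (Fin n)} (hx : x ≠ 0) (hr : 0 < r) :
    ∀ᶠ j in atTop, cut n (radius r j) x = 1 := by
  have h0 : 0 < ‖x‖ / 2 := by have := norm_pos_iff.2 hx; positivity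
  filter_upwards [(tendsto_radius r).eventually_lt_const h0] with j hj
  exact cut_eq_one (radius_pos hr j) (by linarith)

lemma tendsto_integral_f_cut (S : SingularData n r p d w f H V) (hθ : Profile θ) :
    Tendsto (fun j => ∫ x in ball 0 r, f x * (cut n (radius r j) x * trunc n r w θ x)) atTop
      (𝓝 (∫ x in ball 0 r, f x * prim θ (w x))) := by
  have hr := S.r_pos
  have : Nonempty (Fin n) := ⟨⟨0, by have := S.two_le; omega⟩⟩
  have hae : ∀ᵐ x ∂(volume.restrict (ball (0 : EuclideanSpace ℝ (Fin n)) r)), x ≠ 0 :=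
    ae_restrict_of_ae (by simp [ae_iff])
  obtain ⟨K, hK0, hK⟩ := trunc_bdd hθ w r
  refine tendsto_integral_of_dominated_convergence (fun x => f x * K) (fun j => ?_)
    (S.f_integrableOn.mul_const K) (fun j => ?_) ?_
  · exact (S.f_meas.mul (contDiff_cut.continuous.measurable.mul
      (S.puncturedTest_trunc hθ).measurable)).aestronglyMeasurable
  · filter_upwards with x
    rw [norm_mul, norm_mul, Real.norm_of_nonneg (S.f_nonneg x), Real.norm_of_nonneg (cut_nonneg _)]
    refine mul_le_mul_of_nonneg_left ?_ (S.f_nonneg x)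
    exact (mul_le_of_le_one_left (norm_nonneg _) (cut_le_one _)).trans (hK x)
  · filter_upwards [hae, ae_restrict_mem measurableSet_ball] with x hx0 hx
    rw [mem_ball_zero_iff] at hx
    refine tendsto_const_nhds.congr' ?_
    filter_upwards [tendsto_cut hx0 hr] with j hj
    rw [hj, one_mul, trunc_of_lt hx]

theorem lintegral_profile_le (S : SingularData n r p d w f H V) (hθ : Profile θ) :
    ∫⁻ x in ball 0 r, ENNReal.ofReal (θ (w x) * (d * ‖fderiv ℝ w x‖ ^ n)) ≤
      ENNReal.ofReal (∫ x in ball 0 r, f x * prim θ (w x)) := by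
  have hr := S.r_pos
  have : Nonempty (Fin n) := ⟨⟨0, by have := S.two_le; omega⟩⟩
  have hae : ∀ᵐ x ∂(volume.restrict (ball (0 : EuclideanSpace ℝ (Fin n)) r)), x ≠ 0 :=
    ae_restrict_of_ae (by simp [ae_iff])
  set g : EuclideanSpace ℝ (Fin n) → ℝ := fun x => θ (w x) * (d * ‖fderiv ℝ w x‖ ^ n) with hg
  have hg0 : ∀ x, 0 ≤ g x := fun x =>
    mul_nonneg (hθ.nonneg _) (mul_nonneg S.d_pos.le (by positivity))
  have hgm : AEMeasurable g (volume.restrict (ball 0 r)) :=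
    (hθ.cont.measurable.comp_aemeasurable S.aestronglyMeasurable.aemeasurable).mul
      ((S.aestronglyMeasurable_fderiv.norm.aemeasurable.pow_const _).const_mul _)
  have hlim : ∫⁻ x in ball 0 r, ENNReal.ofReal (g x) ≤ liminf (fun j =>
      ∫⁻ x in ball 0 r, ENNReal.ofReal (cut n (radius r j) x * g x)) atTop := by
    refine le_trans (lintegral_mono_ae ?_) (lintegral_liminf_le' fun j =>
      (contDiff_cut.continuous.measurable.aemeasurable.mul hgm).ennreal_ofReal)
    filter_upwards [hae] with x hx0
    refine le_of_eq (Tendsto.liminf_eq ?_).symm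
    refine tendsto_const_nhds.congr' ?_
    filter_upwards [tendsto_cut hx0 hr] with j hj
    rw [hj, one_mul]
  refine hlim.trans ?_
  have hbound := (ENNReal.tendsto_ofReal (S.tendsto_integral_f_cut hθ)).add (S.tendsto_error hθ)
  rw [add_zero] at hbound
  rw [← hbound.liminf_eq]
  refine liminf_le_liminf (Eventually.of_forall fun j => ?_)
  set ρ := radius r j
  have hρ : 0 < ρ := radius_pos hr j
  have hge : ∀ᵐ x ∂(volume.restrict (ball (0 : EuclideanSpace ℝ (Fin n)) r)),
      cut n ρ x * g x ≤ cut n ρ x * fderiv ℝ (trunc n r w θ) x (V x) := by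
    filter_upwards [hae, ae_restrict_mem measurableSet_ball] with x hx0 hx
    rw [mem_ball_zero_iff] at hx
    rw [S.fderiv_trunc hθ hx hx0]
    refine mul_le_mul_of_nonneg_left ?_ (cut_nonneg _)
    rw [_root_.smul_apply, smul_eq_mul]
    exact mul_le_mul_of_nonneg_left (S.V_ge x (mem_punctured.2 ⟨hx, hx0⟩)) (hθ.nonneg _)
  have hint := S.integrable_cut_fderiv (S.puncturedTest_trunc hθ) hρ
  calc _ ≤ ∫⁻ x in ball 0 r, ENNReal.ofReal (cut n ρ x * fderiv ℝ (trunc n r w θ) x (V x)) :=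
        lintegral_mono_ae (hge.mono fun x hx => ENNReal.ofReal_le_ofReal hx)
    _ = ENNReal.ofReal (∫ x in ball 0 r, cut n ρ x * fderiv ℝ (trunc n r w θ) x (V x)) :=
        (ofReal_integral_eq_lintegral_ofReal hint
          (hge.mono fun x hx => (mul_nonneg (cut_nonneg _) (hg0 x)).trans hx)).symm
    _ ≤ _ := by
      rw [← sub_add_cancel (∫ x in ball 0 r, cut n ρ x * fderiv ℝ (trunc n r w θ) x (V x))
        (∫ x in ball 0 r, f x * (cut n ρ x * trunc n r w θ x)), add_comm]
      refine ENNReal.ofReal_add_le.trans ?_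
      rw [add_sub_cancel_left]
      gcongr
      exact Real.ofReal_le_enorm _

end Vanishing

end SingularData

lemma eLpNorm_eq_zero_of_ae_eq_zero {X G : Type*} [MeasurableSpace X] [NormedAddCommGroup G]
    {μ : Measure X} {g : X → G} {s : ENNReal} (h : ∀ᵐ x ∂μ, g x = 0) : eLpNorm g s μ = 0 :=
  eLpNorm_eq_zero_of_ae_zero h

namespace SingularData

section Moser

variable {n : ℕ} {r p d : ℝ} {w f H : EuclideanSpace ℝ (Fin n) → ℝ}
  {V : EuclideanSpace ℝ (Fin n) → EuclideanSpace ℝ (Fin n)} {θ : ℝ → ℝ}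

lemma trunc_ae_eq_zero (S : SingularData n r p d w f H V) (hθ : Profile θ)
    (h0 : ∀ t, prim θ t ≤ 0) : trunc n r w θ =ᵐ[volume] 0 := by
  have hn := S.two_le
  have hnR : (2 : ℝ) ≤ n := by exact_mod_cast hn
  have h1 := S.lintegral_profile_le hθ
  have h2 : ∫ x in ball 0 r, f x * prim θ (w x) ≤ 0 :=
    integral_nonpos fun x => mul_nonpos_of_nonneg_of_nonpos (S.f_nonneg x) (h0 _)
  rw [ENNReal.ofReal_of_nonpos h2, nonpos_iff_eq_zero, lintegral_eq_zero_iff'] at h1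
  · have hz : ∀ᵐ x, fderiv ℝ (trunc n r w θ) x = 0 := by
      have h3 := (ae_restrict_iff' measurableSet_ball).1 h1
      filter_upwards [S.fderiv_trunc_ae hθ, h3] with x hx hx'
      rw [hx]
      by_cases hb : x ∈ ball (0 : EuclideanSpace ℝ (Fin n)) r
      · rw [indicator_of_mem hb]
        have h4 := hx' hb
        simp only [Pi.zero_apply, ENNReal.ofReal_eq_zero] at h4
        have h5 : θ (w x) * (d * ‖fderiv ℝ w x‖ ^ n) = 0 := le_antisymm h4
          (mul_nonneg (hθ.nonneg _) (mul_nonneg S.d_pos.le (by positivity)))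
        rcases mul_eq_zero.1 h5 with h6 | h6
        · rw [h6, zero_smul]
        · rcases mul_eq_zero.1 h6 with h7 | h7
          · exact absurd h7 S.d_pos.ne'
          · rw [norm_eq_zero.1 (pow_eq_zero_iff (by omega) |>.1 h7), smul_zero]
      · rw [indicator_of_notMem hb]
    obtain ⟨C, hC⟩ := exists_eLpNorm_le_eLpNorm_fderiv hn r (s := 1) (t := 1) le_rfl
      (by exact_mod_cast (by omega : 1 < n)) (by
        have : (0 : ℝ) ≤ (n : ℝ)⁻¹ := by positivity
        push_cast; linarith)
    obtain ⟨K, -, hK⟩ := trunc_bdd hθ w r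
    have h6 := hC _ (S.puncturedTest_trunc hθ) ⟨K, hK⟩
    rw [eLpNorm_eq_zero_of_ae_eq_zero hz, mul_zero, nonpos_iff_eq_zero,
      eLpNorm_eq_zero_iff (S.puncturedTest_trunc hθ).measurable.aestronglyMeasurable (by simp)] at h6
    exact h6
  · exact ((hθ.cont.measurable.comp_aemeasurable S.aestronglyMeasurable.aemeasurable).mul
      ((S.aestronglyMeasurable_fderiv.norm.aemeasurable.pow_const _).const_mul _)).ennreal_ofReal

lemma ae_nonneg (S : SingularData n r p d w f H V) :
    ∀ᵐ x ∂(volume.restrict (ball 0 r)), 0 ≤ w x := by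
  set g : ℝ → ℝ := fun t => max (-t) 0 with hg
  have hgc : Continuous g := by fun_prop
  have hg0 : ∀ t, 0 ≤ g t := fun t => le_max_right _ _
  have hprof := fun j => profile_bump_mul j hgc hg0
  have hprim : ∀ j t, prim (fun s => bump j s * g s) t ≤ 0 := by
    intro j t
    rcases le_total t 0 with h | h
    · exact (hprof j).prim_nonpos h
    · refine (intervalIntegral.integral_zero_ae (Eventually.of_forall fun s hs => ?_)).le
      rw [uIoc_of_le h] at hs
      rw [hg]
      simp only
      rw [max_eq_right (by linarith [hs.1]), mul_zero]
  have hall : ∀ᵐ x ∂(volume : Measure (EuclideanSpace ℝ (Fin n))),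
      ∀ j, trunc n r w (fun s => bump j s * g s) x = 0 :=
    ae_all_iff.2 fun j => S.trunc_ae_eq_zero (hprof j) (hprim j)
  refine (ae_restrict_iff' measurableSet_ball).2 ?_
  filter_upwards [hall] with x hx hxb
  have hlim := tendsto_trunc (n := n) (r := r) (w := w) hgc x
  simp_rw [hx] at hlim
  rw [indicator_of_mem hxb] at hlim
  have h0 : prim g (w x) = 0 := tendsto_nhds_unique hlim tendsto_const_nhds
  by_contra hcon
  rw [not_le] at hcon
  have h1 : prim g (w x) = ∫ s in (0 : ℝ)..(w x), -s := by
    refine intervalIntegral.integral_congr fun s hs => ?_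
    rw [uIcc_of_ge hcon.le] at hs
    exact max_eq_left (by linarith [hs.2])
  rw [h1, intervalIntegral.integral_neg, integral_id] at h0
  nlinarith

/-- The derivative of `t ↦ t ^ q` on the positive half-line, extended by zero. -/
noncomputable def powDeriv (q t : ℝ) : ℝ := q * max t 0 ^ (q - 1)

lemma continuous_powDeriv {q : ℝ} (hq : 1 ≤ q) : Continuous (powDeriv q) :=
  continuous_const.mul ((continuous_id.max continuous_const).rpow_const
    fun _ => Or.inr (by linarith))

lemma powDeriv_nonneg {q : ℝ} (hq : 1 ≤ q) (t : ℝ) : 0 ≤ powDeriv q t :=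
  mul_nonneg (by linarith) (Real.rpow_nonneg (le_max_right _ _) _)

lemma prim_powDeriv {q t : ℝ} (hq : 1 ≤ q) (ht : 0 ≤ t) : prim (powDeriv q) t = t ^ q := by
  have h1 : prim (powDeriv q) t = ∫ s in (0 : ℝ)..t, q * s ^ (q - 1) := by
    refine intervalIntegral.integral_congr fun s hs => ?_
    rw [uIcc_of_le ht] at hs
    simp only [powDeriv, max_eq_left hs.1]
  rw [h1, intervalIntegral.integral_const_mul, integral_rpow (Or.inl (by linarith)),
    sub_add_cancel, Real.zero_rpow (by linarith), sub_zero]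
  field_simp

lemma prim_bump_powDeriv_pow_le {q t : ℝ} (hq : 1 ≤ q) (ht : 0 ≤ t) (j : ℕ) (hn : 1 ≤ n) :
    prim (fun s => (bump j s * powDeriv q s) ^ n) t ≤
      q ^ (n - 1) * t ^ ((n : ℝ) * (q - 1) + 1) := by
  have hb : (0 : ℝ) ≤ (n : ℝ) * (q - 1) := mul_nonneg (by positivity) (by linarith)
  have hnR : (1 : ℝ) ≤ n := by exact_mod_cast hn
  have h1 : prim (fun s => (bump j s * powDeriv q s) ^ n) t ≤
      ∫ s in (0 : ℝ)..t, q ^ n * s ^ ((n : ℝ) * (q - 1)) := by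
    refine intervalIntegral.integral_mono_on ht ?_ ?_ fun s hs => ?_
    · exact (((continuous_bump j).mul (continuous_powDeriv hq)).pow n).intervalIntegrable _ _
    · exact (continuous_const.mul (continuous_id.rpow_const
        fun _ => Or.inr hb)).intervalIntegrable _ _
    · have e : (q * s ^ (q - 1)) ^ n = q ^ n * s ^ ((n : ℝ) * (q - 1)) := by
        rw [mul_pow, ← Real.rpow_natCast (s ^ (q - 1)), ← Real.rpow_mul hs.1, mul_comm (q - 1)]
      rw [← e]
      have h2 : powDeriv q s = q * s ^ (q - 1) := by rw [powDeriv, max_eq_left hs.1]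
      rw [h2]
      have h3 : 0 ≤ q * s ^ (q - 1) := mul_nonneg (by linarith) (Real.rpow_nonneg hs.1 _)
      exact pow_le_pow_left₀ (mul_nonneg (bump_nonneg j s) h3)
        (mul_le_of_le_one_left h3 (bump_le_one j s)) n
  refine h1.trans ?_
  rw [intervalIntegral.integral_const_mul, integral_rpow (Or.inl (by linarith)),
    Real.zero_rpow (by linarith), sub_zero, ← mul_div_assoc, div_le_iff₀ (by linarith)]
  obtain ⟨k, rfl⟩ : ∃ k, n = k + 1 := ⟨n - 1, by omega⟩
  have hk : (0 : ℝ) ≤ k := by positivity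
  have h4 : q ≤ ((k + 1 : ℕ) : ℝ) * (q - 1) + 1 := by push_cast; nlinarith
  have h5 : 0 ≤ q ^ k * t ^ (((k + 1 : ℕ) : ℝ) * (q - 1) + 1) :=
    mul_nonneg (by positivity) (Real.rpow_nonneg ht _)
  rw [Nat.add_sub_cancel, pow_succ]
  calc _ = q ^ k * t ^ (((k + 1 : ℕ) : ℝ) * (q - 1) + 1) * q := by ring
    _ ≤ _ := by gcongr

lemma lintegral_profile_powDeriv_le (S : SingularData n r p d w f H V) {q : ℝ} (hq : 1 ≤ q)
    (j : ℕ) :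
    ENNReal.ofReal d * ∫⁻ x in ball 0 r,
        ‖(bump j (w x) * powDeriv q (w x)) • fderiv ℝ w x‖ₑ ^ n ≤
      ENNReal.ofReal (q ^ (n - 1)) *
        ∫⁻ x in ball 0 r, ENNReal.ofReal (f x) * ‖w x‖ₑ ^ ((n : ℝ) * (q - 1) + 1) := by
  have hn := S.two_le
  have hprof := profile_bump_mul j (continuous_powDeriv hq) (powDeriv_nonneg hq)
  have h1 := S.lintegral_profile_le (hprof.pow (N := n) (by omega))
  rw [← lintegral_const_mul' _ _ ENNReal.ofReal_ne_top,
    ← lintegral_const_mul' _ _ ENNReal.ofReal_ne_top]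
  refine le_trans (le_of_eq (lintegral_congr fun x => ?_)) (h1.trans ?_)
  · have h2 := hprof.nonneg (w x)
    rw [enorm_smul, Real.enorm_of_nonneg h2, mul_pow, ← ofReal_norm,
      ← ENNReal.ofReal_pow h2, ← ENNReal.ofReal_pow (norm_nonneg _), ← ENNReal.ofReal_mul
      (by positivity), ← ENNReal.ofReal_mul S.d_pos.le]
    congr 1; ring
  · refine (Real.ofReal_le_enorm _).trans ((enorm_integral_le_lintegral_enorm _).trans ?_)
    refine lintegral_mono_ae ?_
    filter_upwards [S.ae_nonneg] with x hx
    have h3 := (hprof.pow (N := n) (by omega)).prim_nonneg hx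
    rw [Real.enorm_of_nonneg (mul_nonneg (S.f_nonneg x) h3), Real.enorm_of_nonneg hx,
      ENNReal.ofReal_rpow_of_nonneg hx (by nlinarith [(n.cast_nonneg : (0 : ℝ) ≤ n)]),
      ← ENNReal.ofReal_mul (S.f_nonneg x), ← ENNReal.ofReal_mul (by positivity)]
    refine ENNReal.ofReal_le_ofReal ?_
    calc _ ≤ f x * (q ^ (n - 1) * w x ^ ((n : ℝ) * (q - 1) + 1)) :=
          mul_le_mul_of_nonneg_left (prim_bump_powDeriv_pow_le hq hx j (by omega)) (S.f_nonneg x)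
      _ = _ := by ring

lemma eLpNorm_le_lintegral_pow (S : SingularData n r p d w f H V) {s : NNReal}
    (hsn : s < n) {g : EuclideanSpace ℝ (Fin n) → EuclideanSpace ℝ (Fin n) →L[ℝ] ℝ}
    (hg : AEStronglyMeasurable g (volume.restrict (ball 0 r))) :
    eLpNorm g s (volume.restrict (ball 0 r)) ≤
      (∫⁻ x in ball 0 r, ‖g x‖ₑ ^ n) ^ (1 / (n : ℝ)) *
        volume (ball (0 : EuclideanSpace ℝ (Fin n)) r) ^ (1 / (s : ℝ) - 1 / n) := by
  have hn := S.two_le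
  have h := eLpNorm_le_eLpNorm_mul_rpow_measure_univ (p := (s : ENNReal)) (q := (n : ENNReal))
    (by exact_mod_cast hsn.le) hg
  rw [eLpNorm_eq_lintegral_rpow_enorm_toReal (p := (n : ENNReal)) (by simp; omega)
    (ENNReal.natCast_ne_top n), ENNReal.toReal_natCast,
    Measure.restrict_apply MeasurableSet.univ, univ_inter, ENNReal.coe_toReal] at h
  simpa only [ENNReal.rpow_natCast] using h

lemma eLpNorm_rpow_le (S : SingularData n r p d w f H V) {m : ℝ} (hm : 1 < m) :
    ∃ C : ENNReal, C ≠ ⊤ ∧ ∀ q : ℝ, 1 ≤ q →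
      eLpNorm (fun x => w x ^ q) (ENNReal.ofReal (2 * m * n)) (volume.restrict (ball 0 r)) ≤
        C * ((ENNReal.ofReal d)⁻¹ * (ENNReal.ofReal (q ^ (n - 1)) *
          ∫⁻ x in ball 0 r, ENNReal.ofReal (f x) * ‖w x‖ₑ ^ ((n : ℝ) * (q - 1) + 1))) ^
            (1 / (n : ℝ)) := by
  have hn := S.two_le
  have hnR : (2 : ℝ) ≤ n := by exact_mod_cast hn
  have hd : ENNReal.ofReal d ≠ 0 := by simpa using S.d_pos
  obtain ⟨T, hT⟩ : ∃ T : NNReal, (T : ℝ) = 2 * m * n := ⟨⟨2 * m * n, by positivity⟩, rfl⟩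
  obtain ⟨s, hs⟩ : ∃ s : NNReal, (s : ℝ) = 2 * m * n / (2 * m + 1) :=
    ⟨⟨2 * m * n / (2 * m + 1), by positivity⟩, rfl⟩
  have hs1 : 1 ≤ s := by
    rw [← NNReal.coe_le_coe, hs, NNReal.coe_one, le_div_iff₀ (by positivity)]; nlinarith
  have hsn : s < n := by
    rw [← NNReal.coe_lt_coe, hs, div_lt_iff₀ (by positivity), NNReal.coe_natCast]; nlinarith
  obtain ⟨C, hC⟩ := exists_eLpNorm_le_eLpNorm_fderiv hn r hs1 hsn (t := T) (by
    rw [hs, hT, inv_div]; apply le_of_eq; field_simp; ring)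
  have hvt : volume (ball (0 : EuclideanSpace ℝ (Fin n)) r) ≠ ⊤ := measure_ball_lt_top.ne
  have hsn' : (0 : ℝ) ≤ 1 / s - 1 / n := by
    have h1 : (s : ℝ) < n := by exact_mod_cast hsn
    have h2 : (0 : ℝ) < s := by exact_mod_cast zero_lt_one.trans_le hs1
    rw [sub_nonneg]; exact one_div_le_one_div_of_le h2 h1.le
  refine ⟨C * volume (ball (0 : EuclideanSpace ℝ (Fin n)) r) ^ (1 / (s : ℝ) - 1 / n),
    ENNReal.mul_ne_top ENNReal.coe_ne_top (ENNReal.rpow_ne_top_of_nonneg hsn' hvt),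
    fun q hq => ?_⟩
  rw [← hT, ENNReal.ofReal_coe_nnreal]
  have hprof := fun j => profile_bump_mul j (continuous_powDeriv hq) (powDeriv_nonneg hq)
  have hlim := Lp.eLpNorm_lim_le_liminf_eLpNorm (p := (T : ENNReal)) (μ := volume)
    (f := fun j => trunc n r w (fun t => bump j t * powDeriv q t))
    (fun j => (S.puncturedTest_trunc (hprof j)).measurable.aestronglyMeasurable) _
    (Eventually.of_forall fun x => tendsto_trunc (continuous_powDeriv hq) x)
  rw [eLpNorm_indicator_eq_eLpNorm_restrict measurableSet_ball] at hlim
  have hcongr : eLpNorm (fun x => w x ^ q) T (volume.restrict (ball 0 r)) =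
      eLpNorm (fun x => prim (powDeriv q) (w x)) T (volume.restrict (ball 0 r)) :=
    eLpNorm_congr_ae (S.ae_nonneg.mono fun x hx => (prim_powDeriv hq hx).symm)
  rw [hcongr]
  refine hlim.trans ?_
  set R := (ENNReal.ofReal d)⁻¹ * (ENNReal.ofReal (q ^ (n - 1)) *
          ∫⁻ x in ball 0 r, ENNReal.ofReal (f x) * ‖w x‖ₑ ^ ((n : ℝ) * (q - 1) + 1)) with hR
  have hbound : ∀ j, eLpNorm (trunc n r w (fun t => bump j t * powDeriv q t)) T volume ≤
      C * volume (ball (0 : EuclideanSpace ℝ (Fin n)) r) ^ (1 / (s : ℝ) - 1 / n) *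
        R ^ (1 / (n : ℝ)) := by
    intro j
    obtain ⟨K, -, hK⟩ := trunc_bdd (hprof j) w r
    refine (hC _ (S.puncturedTest_trunc (hprof j)) ⟨K, hK⟩).trans ?_
    rw [mul_assoc]
    refine mul_le_mul_right ?_ _
    rw [S.eLpNorm_fderiv_trunc (hprof j) s]
    refine (S.eLpNorm_le_lintegral_pow hsn ?_).trans ?_
    · exact AEStronglyMeasurable.smul ((hprof j).cont.comp_aestronglyMeasurable
        S.aestronglyMeasurable) S.aestronglyMeasurable_fderiv
    · rw [mul_comm]
      refine mul_le_mul_right (ENNReal.rpow_le_rpow ?_ (by positivity)) _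
      rw [hR, ← ENNReal.div_eq_inv_mul, ENNReal.le_div_iff_mul_le (Or.inl hd)
        (Or.inl ENNReal.ofReal_ne_top), mul_comm]
      exact S.lintegral_profile_powDeriv_le hq j
  exact (liminf_le_liminf (Eventually.of_forall hbound)).trans (liminf_const _).le

end Moser

end SingularData

section MoserReal

namespace SingularData

variable {n : ℕ} {r p d : ℝ} {w f H : EuclideanSpace ℝ (Fin n) → ℝ}
  {V : EuclideanSpace ℝ (Fin n) → EuclideanSpace ℝ (Fin n)}

lemma integral_rpow_eq (S : SingularData n r p d w f H V) {T : ℝ} (hT : 0 < T) :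
    ∫ x in ball 0 r, w x ^ T = (∫⁻ x in ball 0 r, ‖w x‖ₑ ^ T).toReal := by
  rw [integral_eq_lintegral_of_nonneg_ae]
  · congr 1
    refine lintegral_congr_ae (S.ae_nonneg.mono fun x hx => ?_)
    simp only
    rw [Real.enorm_of_nonneg hx, ENNReal.ofReal_rpow_of_nonneg hx hT.le]
  · exact S.ae_nonneg.mono fun x hx => Real.rpow_nonneg hx _
  · exact (S.aestronglyMeasurable.aemeasurable.pow_const _).aestronglyMeasurable

lemma fNorm_toReal (S : SingularData n r p d w f H V) :
    (fNorm n r p f).toReal = (∫ x in ball 0 r, f x ^ p) ^ (1 / p) := by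
  have hp := S.one_lt
  rw [fNorm, ← ENNReal.toReal_rpow, integral_eq_lintegral_of_nonneg_ae
    (Eventually.of_forall fun x => Real.rpow_nonneg (S.f_nonneg x) _)
    S.f_pow.aestronglyMeasurable]
  congr 2
  refine lintegral_congr fun x => ?_
  rw [ENNReal.ofReal_rpow_of_nonneg (S.f_nonneg x) (by linarith)]

lemma lintegral_interpolation (S : SingularData n r p d w f H V) {m q : ℝ} (hm : 1 < m)
    (hq : 1 ≤ q) :
    (∫⁻ x in ball 0 r, (‖w x‖ₑ ^ ((n : ℝ) * (q - 1) + 1)) ^ m) ^ (1 / m) ≤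
      (∫⁻ x in ball 0 r, ‖w x‖ₑ ^ (m * n * q)) ^ (((n : ℝ) * (q - 1) + 1) / (m * n * q)) *
        volume (ball (0 : EuclideanSpace ℝ (Fin n)) r) ^ (((n : ℝ) - 1) / (m * n * q)) := by
  have hnR : (2 : ℝ) ≤ n := by exact_mod_cast S.two_le
  set b : ℝ := (n : ℝ) * (q - 1) + 1 with hb
  have hb0 : 0 < b := by nlinarith
  have hbm : 0 < b * m := by positivity
  have hle : b * m ≤ m * n * q := by
    have : b ≤ n * q := by rw [hb]; linarith
    nlinarith
  have h := eLpNorm'_le_eLpNorm'_mul_rpow_measure_univ hbm hle S.aestronglyMeasurable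
  rw [Measure.restrict_apply MeasurableSet.univ, univ_inter] at h
  have h2 := ENNReal.rpow_le_rpow h hb0.le
  rw [ENNReal.mul_rpow_of_nonneg _ _ hb0.le, eLpNorm', eLpNorm', ← ENNReal.rpow_mul,
    ← ENNReal.rpow_mul, ← ENNReal.rpow_mul] at h2
  simp_rw [← ENNReal.rpow_mul]
  have e1 : 1 / (b * m) * b = 1 / m := by field_simp
  have e2 : 1 / (m * n * q) * b = b / (m * n * q) := by ring
  have e3 : (1 / (b * m) - 1 / (m * n * q)) * b = ((n : ℝ) - 1) / (m * n * q) := by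
    rw [sub_mul, e1, e2]
    have : (n : ℝ) ≠ 0 := by positivity
    have : q ≠ 0 := by positivity
    field_simp
    rw [hb]; ring
  rwa [e1, e2, e3] at h2

lemma lintegral_moser_le (S : SingularData n r p d w f H V) :
    ∃ C : ENNReal, C ≠ ⊤ ∧ ∀ q : ℝ, 1 ≤ q →
      (∫⁻ x in ball 0 r, ‖w x‖ₑ ^ (2 * p.conjExponent * n * q)) ^ (1 / (2 * p.conjExponent)) ≤
        C * ((ENNReal.ofReal d)⁻¹ * (ENNReal.ofReal (q ^ (n - 1)) * (fNorm n r p f *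
          ((∫⁻ x in ball 0 r, ‖w x‖ₑ ^ (p.conjExponent * n * q)) ^
            (((n : ℝ) * (q - 1) + 1) / (p.conjExponent * n * q)) *
          volume (ball (0 : EuclideanSpace ℝ (Fin n)) r) ^
            (((n : ℝ) - 1) / (p.conjExponent * n * q)))))) := by
  have hnR : (2 : ℝ) ≤ n := by exact_mod_cast S.two_le
  have hm : 1 < p.conjExponent := (Real.HolderConjugate.conjExponent S.one_lt).symm.lt
  obtain ⟨C, hC, h⟩ := S.eLpNorm_rpow_le hm
  refine ⟨C ^ n, ENNReal.pow_ne_top hC, fun q hq => ?_⟩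
  have h1 := pow_le_pow_left' (h q hq) n
  have e0 : (1 : ℝ) / n * n = 1 := by field_simp
  rw [mul_pow, ← ENNReal.rpow_natCast (_ ^ (1 / (n : ℝ))), ← ENNReal.rpow_mul, e0,
    ENNReal.rpow_one, eLpNorm_eq_lintegral_rpow_enorm_toReal (by simp; nlinarith)
    ENNReal.ofReal_ne_top, ENNReal.toReal_ofReal (by positivity), ← ENNReal.rpow_natCast,
    ← ENNReal.rpow_mul] at h1
  have e1 : 1 / (2 * p.conjExponent * n) * n = 1 / (2 * p.conjExponent) := by field_simp
  have e2 : ∫⁻ x in ball 0 r, ‖w x ^ q‖ₑ ^ (2 * p.conjExponent * n) =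
      ∫⁻ x in ball 0 r, ‖w x‖ₑ ^ (2 * p.conjExponent * n * q) := by
    refine lintegral_congr_ae (S.ae_nonneg.mono fun x hx => ?_)
    simp only
    rw [Real.enorm_of_nonneg hx, Real.enorm_of_nonneg (Real.rpow_nonneg hx _),
      ← ENNReal.ofReal_rpow_of_nonneg hx (by linarith), ← ENNReal.rpow_mul, mul_comm q]
  rw [e1, e2] at h1
  refine h1.trans ?_
  gcongr
  exact (S.setLIntegral_f_mul_le subset_rfl
    (S.aestronglyMeasurable.enorm.pow_const _)).trans
      (mul_le_mul_right (S.lintegral_interpolation hm hq) _)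

theorem moser_le (S : SingularData n r p d w f H V) :
    ∃ C : ℝ, 0 < C ∧ ∀ q : ℝ, 1 ≤ q →
      (∫ x in ball 0 r, w x ^ (2 * p.conjExponent * n * q)) ^ (1 / (2 * p.conjExponent)) ≤
        C * q ^ (n - 1) / d *
          (volume (ball (0 : EuclideanSpace ℝ (Fin n)) r)).toReal ^
            (((n : ℝ) - 1) / (p.conjExponent * n * q)) *
          (∫ x in ball 0 r, f x ^ p) ^ (1 / p) *
          (∫ x in ball 0 r, w x ^ (p.conjExponent * n * q)) ^
            (((n : ℝ) * (q - 1) + 1) / (p.conjExponent * n * q)) := by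
  have hnR : (2 : ℝ) ≤ n := by exact_mod_cast S.two_le
  have hd := S.d_pos
  have hm : 1 < p.conjExponent := (Real.HolderConjugate.conjExponent S.one_lt).symm.lt
  obtain ⟨C, hC, h⟩ := S.lintegral_moser_le
  refine ⟨C.toReal + 1, by positivity, fun q hq => ?_⟩
  have hT : 0 < p.conjExponent * n * q := by positivity
  have hb : 0 ≤ (n : ℝ) * (q - 1) + 1 := by nlinarith
  have h1 := ENNReal.toReal_mono ?_ (h q hq)
  · rw [ENNReal.toReal_mul, ENNReal.toReal_mul, ENNReal.toReal_mul, ENNReal.toReal_mul,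
      ENNReal.toReal_mul, ← ENNReal.toReal_rpow, ← ENNReal.toReal_rpow, ← ENNReal.toReal_rpow,
      ENNReal.toReal_inv, ENNReal.toReal_ofReal hd.le, ENNReal.toReal_ofReal (by positivity),
      S.fNorm_toReal, ← S.integral_rpow_eq hT, ← S.integral_rpow_eq (by positivity)] at h1
    refine h1.trans ?_
    set I := (∫ x in ball 0 r, f x ^ p) ^ (1 / p)
    set J := (∫ x in ball 0 r, w x ^ (p.conjExponent * n * q)) ^
            (((n : ℝ) * (q - 1) + 1) / (p.conjExponent * n * q)) with hJ
    set v := (volume (ball (0 : EuclideanSpace ℝ (Fin n)) r)).toReal ^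
            (((n : ℝ) - 1) / (p.conjExponent * n * q))
    have hI0 : 0 ≤ I := Real.rpow_nonneg (integral_nonneg fun x =>
      Real.rpow_nonneg (S.f_nonneg x) _) _
    have hJ0 : 0 ≤ J := by
      rw [hJ, S.integral_rpow_eq hT]; positivity
    have hv0 : 0 ≤ v := by positivity
    calc C.toReal * (d⁻¹ * (q ^ (n - 1) * (I * (J * v))))
        = C.toReal * (d⁻¹ * q ^ (n - 1) * (I * (J * v))) := by ring
      _ ≤ (C.toReal + 1) * (d⁻¹ * q ^ (n - 1) * (I * (J * v))) := by
          gcongr; linarith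
      _ = _ := by ring
  · refine ENNReal.mul_ne_top hC (ENNReal.mul_ne_top (ENNReal.inv_ne_top.2 (by simpa using hd))
      (ENNReal.mul_ne_top ENNReal.ofReal_ne_top (ENNReal.mul_ne_top S.fNorm_ne_top
      (ENNReal.mul_ne_top (ENNReal.rpow_ne_top_of_nonneg (by positivity)
        (S.lintegral_ofReal_abs_rpow_lt_top hT).ne)
        (ENNReal.rpow_ne_top_of_nonneg (div_nonneg (by linarith) hT.le)
          measure_ball_lt_top.ne)))))

end SingularData

end MoserReal

section Caccioppoli

variable {n : ℕ} {r : ℝ}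

lemma norm_gradient_eq (h : EuclideanSpace ℝ (Fin n) → ℝ) (x : EuclideanSpace ℝ (Fin n)) :
    ‖gradient h x‖ = ‖fderiv ℝ h x‖ :=
  LinearIsometryEquiv.norm_map _ _

lemma fderiv_apply_gradient (φ h : EuclideanSpace ℝ (Fin n) → ℝ)
    (x : EuclideanSpace ℝ (Fin n)) :
    ⟪gradient h x, gradient φ x⟫_ℝ = fderiv ℝ φ x (gradient h x) := by
  rw [real_inner_comm]
  exact InnerProductSpace.toDual_symm_apply

/-- The flux `|∇h|^{n-2} ∇h` of the `n`-Laplacian. -/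
noncomputable def nFlux (h : EuclideanSpace ℝ (Fin n) → ℝ) (x : EuclideanSpace ℝ (Fin n)) :
    EuclideanSpace ℝ (Fin n) :=
  ‖gradient h x‖ ^ (n - 2) • gradient h x

lemma norm_pow_mul_inner_gradient (φ h : EuclideanSpace ℝ (Fin n) → ℝ)
    (x : EuclideanSpace ℝ (Fin n)) :
    ‖gradient h x‖ ^ (n - 2) * ⟪gradient h x, gradient φ x⟫_ℝ = fderiv ℝ φ x (nFlux h x) := by
  rw [nFlux, map_smul, smul_eq_mul, fderiv_apply_gradient]

lemma norm_nFlux (hn : 2 ≤ n) (h : EuclideanSpace ℝ (Fin n) → ℝ)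
    (x : EuclideanSpace ℝ (Fin n)) : ‖nFlux h x‖ = ‖gradient h x‖ ^ (n - 1) := by
  rw [nFlux, norm_smul, norm_pow, norm_norm, ← pow_succ]
  congr 1; omega

lemma continuousOn_gradient {h : EuclideanSpace ℝ (Fin n) → ℝ}
    (hh : ContDiffOn ℝ 1 h (ball 0 r \ {0})) : ContinuousOn (gradient h) (ball 0 r \ {0}) :=
  (LinearIsometryEquiv.continuous _).comp_continuousOn
    (hh.continuousOn_fderiv_of_isOpen (isOpen_ball.sdiff isClosed_singleton) le_rfl)

lemma continuousOn_nFlux {h : EuclideanSpace ℝ (Fin n) → ℝ}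
    (hh : ContDiffOn ℝ 1 h (ball 0 r \ {0})) : ContinuousOn (nFlux h) (ball 0 r \ {0}) :=
  ((continuousOn_gradient hh).norm.pow _).smul (continuousOn_gradient hh)

lemma exists_annulus_cutoff (hn : 1 ≤ n) :
    ∃ M : ℝ, 0 < M ∧ ∀ ρ : ℝ, 0 < ρ → ∃ ξ : EuclideanSpace ℝ (Fin n) → ℝ,
      ContDiff ℝ 1 ξ ∧ (∀ x, 0 ≤ ξ x) ∧ (∀ x ∈ shell n ρ, ξ x = 1) ∧
      (∀ x, ‖x‖ ≤ ρ / (4 * n) → ξ x = 0) ∧ (∀ x, 6 * ρ ≤ ‖x‖ → ξ x = 0) ∧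
      ∀ x, ‖fderiv ℝ ξ x‖ ≤ M / ρ := by
  have hnR : (1 : ℝ) ≤ n := by exact_mod_cast hn
  obtain ⟨M, hM, hcut⟩ := exists_norm_fderiv_cut_le n
  refine ⟨M * (4 * n + 1 / 3), by positivity, fun ρ hρ =>
    ⟨fun x => cut n (ρ / (4 * n)) x * (1 - cut n (3 * ρ) x), ?_, ?_, ?_, ?_, ?_, ?_⟩⟩
  · exact contDiff_cut.mul (contDiff_const.sub contDiff_cut)
  · exact fun x => mul_nonneg (cut_nonneg x) (sub_nonneg.2 (cut_le_one x))
  · intro x hx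
    rw [mem_shell] at hx
    have h1 : 2 * (ρ / (4 * n)) ≤ ‖x‖ := by
      refine le_trans (le_of_eq ?_) hx.1.le
      field_simp; norm_num
    simp only
    rw [cut_eq_one (by positivity) h1, cut_eq_zero (by positivity) hx.2.le]
    norm_num
  · intro x hx
    simp only
    rw [cut_eq_zero (by positivity) hx, zero_mul]
  · intro x hx
    simp only
    rw [cut_eq_one (ρ := 3 * ρ) (by positivity) (by linarith), sub_self, mul_zero]
  · intro x
    have hc : ∀ ρ, DifferentiableAt ℝ (cut n ρ) x := fun ρ =>
      contDiff_cut.differentiable one_ne_zero x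
    rw [fderiv_fun_mul (hc _) ((hc _).const_sub 1), fderiv_const_sub]
    refine (norm_add_le _ _).trans ?_
    rw [norm_smul, norm_smul, norm_neg, Real.norm_of_nonneg (cut_nonneg x),
      Real.norm_of_nonneg (sub_nonneg.2 (cut_le_one x))]
    have h1 := hcut (3 * ρ) (by positivity) x
    have h2 := hcut (ρ / (4 * n)) (by positivity) x
    calc _ ≤ 1 * (M / (3 * ρ)) + 1 * (M / (ρ / (4 * n))) := by
          gcongr
          · exact cut_le_one x
          · linarith [cut_nonneg (n := n) (ρ := 3 * ρ) x]
      _ = _ := by field_simp; ring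

lemma mul_pow_le_half_add {a t : ℝ} (ha : 0 ≤ a) (ht : 0 ≤ t) (hn : 1 ≤ n) :
    t * a ^ (n - 1) ≤ a ^ n / 2 + (2 * t) ^ n := by
  obtain ⟨k, rfl⟩ : ∃ k, n = k + 1 := ⟨n - 1, by omega⟩
  rw [Nat.add_sub_cancel]
  rcases le_total t (a / 2) with h | h
  · calc t * a ^ k ≤ a / 2 * a ^ k := by gcongr
      _ = a ^ (k + 1) / 2 := by ring
      _ ≤ _ := le_add_of_nonneg_right (by positivity)
  · calc t * a ^ k ≤ (2 * t) * (2 * t) ^ k := by gcongr <;> linarith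
      _ = (2 * t) ^ (k + 1) := by ring
      _ ≤ _ := le_add_of_nonneg_left (by positivity)

lemma half_pow_sub_le_flux (hn : 2 ≤ n) {h ξ : EuclideanSpace ℝ (Fin n) → ℝ} {k K L : ℝ}
    {x : EuclideanSpace ℝ (Fin n)} (hd : DifferentiableAt ℝ h x) (hξd : DifferentiableAt ℝ ξ x)
    (hξ : 0 ≤ ξ x) (hK : |h x - k| ≤ K) (hL : ‖fderiv ℝ ξ x‖ ≤ L) :
    (ξ x * ‖gradient h x‖) ^ n / 2 - (2 * (n * K * L)) ^ n ≤
      fderiv ℝ (fun y => ξ y ^ n * (h y - k)) x (nFlux h x) := by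
  have hK0 : 0 ≤ K := (abs_nonneg _).trans hK
  have hL0 : 0 ≤ L := (norm_nonneg _).trans hL
  set a := ‖gradient h x‖ with ha
  have ha0 : 0 ≤ a := norm_nonneg _
  have h1 : fderiv ℝ h x (nFlux h x) = a ^ n := by
    rw [← norm_pow_mul_inner_gradient, real_inner_self_eq_norm_sq, ← pow_add]
    congr 1; omega
  have h2 : |fderiv ℝ ξ x (nFlux h x)| ≤ L * a ^ (n - 1) := by
    refine ((fderiv ℝ ξ x).le_opNorm _).trans ?_
    rw [norm_nFlux hn]
    gcongr
  have h3 : fderiv ℝ (fun y => ξ y ^ n * (h y - k)) x (nFlux h x) =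
      ξ x ^ n * a ^ n + (h x - k) * (n * ξ x ^ (n - 1) * fderiv ℝ ξ x (nFlux h x)) := by
    rw [fderiv_fun_mul (hξd.fun_pow n) (hd.sub_const k), fderiv_sub_const, fderiv_fun_pow _ hξd]
    simp [h1]
  have h4 : |(h x - k) * (n * ξ x ^ (n - 1) * fderiv ℝ ξ x (nFlux h x))| ≤
      (n * K * L) * (ξ x * a) ^ (n - 1) := by
    rw [abs_mul, abs_mul, abs_of_nonneg (by positivity : 0 ≤ n * ξ x ^ (n - 1))]
    calc _ ≤ K * (n * ξ x ^ (n - 1) * (L * a ^ (n - 1))) := by gcongr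
      _ = _ := by rw [mul_pow]; ring
  have h5 := mul_pow_le_half_add (n := n) (mul_nonneg hξ ha0)
    (by positivity : 0 ≤ n * K * L) (by omega)
  rw [h3]
  have h6 := neg_le_of_abs_le h4
  rw [← mul_pow]
  linarith

lemma contDiff_annulus_test {h ξ : EuclideanSpace ℝ (Fin n) → ℝ} {δ R k : ℝ} (hn : n ≠ 0)
    (hδ : 0 < δ) (hR : R < r)
    (hh : ContDiffOn ℝ 1 h (ball 0 r \ {0})) (hξ : ContDiff ℝ 1 ξ)
    (h1 : ∀ x, ‖x‖ ≤ δ → ξ x = 0) (h2 : ∀ x, R ≤ ‖x‖ → ξ x = 0) :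
    ContDiff ℝ 1 fun y => ξ y ^ n * (h y - k) := by
  rw [contDiff_iff_contDiffAt]
  intro x
  rcases lt_or_ge ‖x‖ δ with hx | hx
  · have : (fun y => ξ y ^ n * (h y - k)) =ᶠ[𝓝 x] fun _ => 0 := by
      filter_upwards [(isOpen_lt continuous_norm continuous_const).mem_nhds hx] with y hy
      rw [h1 y (le_of_lt hy), zero_pow hn, zero_mul]
    exact contDiffAt_const.congr_of_eventuallyEq this
  rcases lt_or_ge R ‖x‖ with hx' | hx'
  · have : (fun y => ξ y ^ n * (h y - k)) =ᶠ[𝓝 x] fun _ => 0 := by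
      filter_upwards [(isOpen_lt continuous_const continuous_norm).mem_nhds hx'] with y hy
      rw [h2 y (le_of_lt hy), zero_pow hn, zero_mul]
    exact contDiffAt_const.congr_of_eventuallyEq this
  · have hx0 : x ∈ ball (0 : EuclideanSpace ℝ (Fin n)) r \ {0} := by
      refine ⟨by simpa using hx'.trans_lt hR, fun h0 => ?_⟩
      rw [mem_singleton_iff.1 h0, norm_zero] at hx
      linarith
    exact (hξ.contDiffAt.pow n).mul
      ((hh.contDiffAt ((isOpen_ball.sdiff isClosed_singleton).mem_nhds hx0)).sub contDiffAt_const)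

lemma lintegral_shell_gradient_le (hn : 2 ≤ n) {h ξ : EuclideanSpace ℝ (Fin n) → ℝ}
    {k K L ρ : ℝ} (hK0 : 0 ≤ K) (hρ : 0 < ρ) (hρr : 6 * ρ < r)
    (hh : ContDiffOn ℝ 1 h (ball 0 r \ {0}))
    (hsol : ∀ φ : EuclideanSpace ℝ (Fin n) → ℝ, ContDiff ℝ 1 φ → HasCompactSupport φ →
      tsupport φ ⊆ ball 0 r → φ 0 = 0 → ∫ x in ball 0 r, fderiv ℝ φ x (nFlux h x) = 0)
    (hK : ∀ x, ρ / (4 * n) ≤ ‖x‖ → ‖x‖ ≤ 6 * ρ → |h x - k| ≤ K)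
    (hξ : ContDiff ℝ 1 ξ) (hξ0 : ∀ x, 0 ≤ ξ x) (hξ1 : ∀ x ∈ shell n ρ, ξ x = 1)
    (h1 : ∀ x, ‖x‖ ≤ ρ / (4 * n) → ξ x = 0) (h2 : ∀ x, 6 * ρ ≤ ‖x‖ → ξ x = 0)
    (hL : ∀ x, ‖fderiv ℝ ξ x‖ ≤ L) :
    ∫⁻ x in shell n ρ, ENNReal.ofReal ‖gradient h x‖ ^ n ≤
      ENNReal.ofReal (2 * (2 * (n * K * L)) ^ n) *
        volume (ball (0 : EuclideanSpace ℝ (Fin n)) (6 * ρ)) := by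
  have hn0 : n ≠ 0 := by omega
  have hnR : (0 : ℝ) < n := by exact_mod_cast (by omega : 0 < n)
  have hδ : 0 < ρ / (4 * n) := by positivity
  set φ : EuclideanSpace ℝ (Fin n) → ℝ := fun y => ξ y ^ n * (h y - k) with hφ
  have hφc : ContDiff ℝ 1 φ := contDiff_annulus_test hn0 hδ hρr hh hξ h1 h2
  have hφz : ∀ x, ξ x = 0 → φ x = 0 := fun x hx => by
    simp only [hφ]
    rw [hx, zero_pow hn0, zero_mul]
  have hts : tsupport φ ⊆ closedBall 0 (6 * ρ) := by
    refine closure_minimal (fun x hx => ?_) isClosed_closedBall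
    rw [mem_closedBall_zero_iff]
    by_contra hcon
    exact hx (hφz x (h2 x (not_le.1 hcon).le))
  have hsub : closedBall (0 : EuclideanSpace ℝ (Fin n)) (6 * ρ) ⊆ ball 0 r :=
    closedBall_subset_ball hρr
  have hcs : HasCompactSupport φ :=
    (isCompact_closedBall (0 : EuclideanSpace ℝ (Fin n)) (6 * ρ)).of_isClosed_subset
      (isClosed_tsupport _) hts
  have hI0 := hsol φ hφc hcs (hts.trans hsub) (hφz 0 (h1 0 (by rw [norm_zero]; exact hδ.le)))
  set c : ℝ := (2 * (n * K * L)) ^ n with hc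
  set A : EuclideanSpace ℝ (Fin n) → ℝ := fun x => (ξ x * ‖gradient h x‖) ^ n with hA
  have hAc : ContinuousOn A (ball 0 r \ {0}) :=
    (hξ.continuous.continuousOn.mul (continuousOn_gradient hh).norm).pow n
  have hAz : ∀ x, ξ x = 0 → A x = 0 := fun x hx => by
    simp only [hA]
    rw [hx, zero_mul, zero_pow hn0]
  have hAi : Integrable A := integrable_of_annulus hδ hρr hAc
    (fun x hx => hAz x (h1 x hx.le)) (fun x hx => hAz x (h2 x hx.le))
  have hFi : Integrable fun x => fderiv ℝ φ x (nFlux h x) := by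
    refine integrable_of_annulus hδ hρr
      ((hφc.continuous_fderiv one_ne_zero).continuousOn.clm_apply (continuousOn_nFlux hh)) ?_ ?_
    · intro x hx
      have : φ =ᶠ[𝓝 x] fun _ => 0 := by
        filter_upwards [(isOpen_lt continuous_norm continuous_const).mem_nhds hx] with y hy
        exact hφz y (h1 y (le_of_lt hy))
      rw [this.fderiv_eq]; simp
    · intro x hx
      have : φ =ᶠ[𝓝 x] fun _ => 0 := by
        filter_upwards [(isOpen_lt continuous_const continuous_norm).mem_nhds hx] with y hy
        exact hφz y (h2 y (le_of_lt hy))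
      rw [this.fderiv_eq]; simp
  have hJi : Integrable ((ball (0 : EuclideanSpace ℝ (Fin n)) (6 * ρ)).indicator fun _ => c) :=
    (integrable_indicator_iff measurableSet_ball).2
      (integrableOn_const measure_ball_lt_top.ne)
  have : Nonempty (Fin n) := ⟨⟨0, by omega⟩⟩
  have hae : ∀ᵐ x ∂(volume.restrict (ball (0 : EuclideanSpace ℝ (Fin n)) r)), x ≠ 0 :=
    ae_restrict_of_ae (by simp [ae_iff])
  have hpt : ∀ᵐ x ∂(volume.restrict (ball (0 : EuclideanSpace ℝ (Fin n)) r)),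
      A x / 2 ≤ fderiv ℝ φ x (nFlux h x) +
        (ball (0 : EuclideanSpace ℝ (Fin n)) (6 * ρ)).indicator (fun _ => c) x := by
    filter_upwards [hae, ae_restrict_mem measurableSet_ball] with x hx0 hxr
    have hd : DifferentiableAt ℝ h x :=
      (hh.differentiableOn one_ne_zero).differentiableAt
        ((isOpen_ball.sdiff isClosed_singleton).mem_nhds ⟨hxr, hx0⟩)
    have hξd : DifferentiableAt ℝ ξ x := hξ.differentiable one_ne_zero x
    by_cases hx : ξ x = 0
    · have h3 : fderiv ℝ φ x = 0 := by
        simp only [hφ]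
        rw [fderiv_fun_mul (hξd.fun_pow n) (hd.sub_const k), fderiv_fun_pow _ hξd, hx,
          zero_pow hn0, zero_pow (by omega : n - 1 ≠ 0)]
        simp
      rw [hAz x hx, h3]
      simp only [zero_div, _root_.zero_apply, zero_add]
      refine indicator_nonneg (fun y _ => ?_) x
      rw [hc]
      have hL0 : 0 ≤ L := (norm_nonneg _).trans (hL 0)
      positivity
    · have hx1 : ρ / (4 * n) ≤ ‖x‖ := le_of_lt (not_le.1 fun h => hx (h1 x h))
      have hx2 : ‖x‖ < 6 * ρ := not_le.1 fun h => hx (h2 x h)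
      rw [indicator_of_mem (mem_ball_zero_iff.2 hx2)]
      have := half_pow_sub_le_flux hn hd hξd (hξ0 x) (hK x hx1 hx2.le) (hL x)
      linarith
  have hle : (∫ x in ball 0 r, A x) / 2 ≤
      c * (volume (ball (0 : EuclideanSpace ℝ (Fin n)) (6 * ρ))).toReal := by
    have h3 := integral_mono_ae (hAi.restrict.div_const 2)
      (hFi.restrict.add hJi.restrict) hpt
    rw [integral_div, integral_add' hFi.restrict hJi.restrict, hI0, zero_add,
      setIntegral_indicator measurableSet_ball,
      inter_eq_self_of_subset_right (ball_subset_ball hρr.le), setIntegral_const,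
      smul_eq_mul, mul_comm] at h3
    exact h3
  have hsh : shell n ρ ⊆ ball 0 r :=
    sdiff_subset.trans (ball_subset_ball (by linarith))
  calc ∫⁻ x in shell n ρ, ENNReal.ofReal ‖gradient h x‖ ^ n
      ≤ ∫⁻ x in shell n ρ, ENNReal.ofReal (A x) := by
        refine setLIntegral_mono' measurableSet_shell fun x hx => ?_
        simp only [hA]
        rw [hξ1 x hx, one_mul, ENNReal.ofReal_pow (norm_nonneg _)]
    _ ≤ ∫⁻ x in ball 0 r, ENNReal.ofReal (A x) := lintegral_mono_set hsh
    _ = ENNReal.ofReal (∫ x in ball 0 r, A x) := by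
        rw [ofReal_integral_eq_lintegral_ofReal hAi.restrict]
        exact Eventually.of_forall fun x => pow_nonneg (mul_nonneg (hξ0 x) (norm_nonneg _)) n
    _ ≤ ENNReal.ofReal (2 * c * (volume (ball (0 : EuclideanSpace ℝ (Fin n)) (6 * ρ))).toReal) :=
        ENNReal.ofReal_le_ofReal (by linarith)
    _ = _ := by
        rw [ENNReal.ofReal_mul' ENNReal.toReal_nonneg,
          ENNReal.ofReal_toReal measure_ball_lt_top.ne]

end Caccioppoli

section Structure

variable {n : ℕ}

lemma norm_sub_pow_le_inner (hn : 2 ≤ n) (X Y : EuclideanSpace ℝ (Fin n)) :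
    ‖X - Y‖ ^ n ≤ 2 ^ (n - 1) * ⟪‖X‖ ^ (n - 2) • X - ‖Y‖ ^ (n - 2) • Y, X - Y⟫_ℝ := by
  obtain ⟨k, rfl⟩ : ∃ k, n = k + 2 := ⟨n - 2, by omega⟩
  simp only [Nat.add_sub_cancel, (by omega : k + 2 - 1 = k + 1)]
  have h1 : ⟪‖X‖ ^ k • X - ‖Y‖ ^ k • Y, X - Y⟫_ℝ =
      (‖X‖ ^ k + ‖Y‖ ^ k) / 2 * ‖X - Y‖ ^ 2 +
        (‖X‖ ^ k - ‖Y‖ ^ k) * (‖X‖ ^ 2 - ‖Y‖ ^ 2) / 2 := by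
    rw [norm_sub_sq_real, inner_sub_left, inner_sub_right, inner_sub_right,
      real_inner_smul_left, real_inner_smul_left, real_inner_smul_left, real_inner_smul_left,
      real_inner_self_eq_norm_sq, real_inner_self_eq_norm_sq, real_inner_comm X Y]
    ring
  have h2 : 0 ≤ (‖X‖ ^ k - ‖Y‖ ^ k) * (‖X‖ ^ 2 - ‖Y‖ ^ 2) := by
    rcases le_total ‖X‖ ‖Y‖ with h | h
    · exact mul_nonneg_of_nonpos_of_nonpos
        (sub_nonpos.2 (pow_le_pow_left₀ (norm_nonneg _) h _))
        (sub_nonpos.2 (pow_le_pow_left₀ (norm_nonneg _) h _))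
    · exact mul_nonneg (sub_nonneg.2 (pow_le_pow_left₀ (norm_nonneg _) h _))
        (sub_nonneg.2 (pow_le_pow_left₀ (norm_nonneg _) h _))
  have h3 : ‖X - Y‖ ^ k ≤ 2 ^ k * (‖X‖ ^ k + ‖Y‖ ^ k) := by
    rcases le_total ‖X‖ ‖Y‖ with h | h
    · calc ‖X - Y‖ ^ k ≤ (2 * ‖Y‖) ^ k := by
            gcongr; linarith [norm_sub_le X Y]
        _ = 2 ^ k * ‖Y‖ ^ k := mul_pow _ _ _
        _ ≤ _ := by gcongr; exact le_add_of_nonneg_left (by positivity)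
    · calc ‖X - Y‖ ^ k ≤ (2 * ‖X‖) ^ k := by
            gcongr; linarith [norm_sub_le X Y]
        _ = 2 ^ k * ‖X‖ ^ k := mul_pow _ _ _
        _ ≤ _ := by gcongr; exact le_add_of_nonneg_right (by positivity)
  calc ‖X - Y‖ ^ (k + 2) = ‖X - Y‖ ^ k * ‖X - Y‖ ^ 2 := pow_add _ _ _
    _ ≤ 2 ^ k * (‖X‖ ^ k + ‖Y‖ ^ k) * ‖X - Y‖ ^ 2 := by gcongr
    _ = 2 ^ (k + 1) * ((‖X‖ ^ k + ‖Y‖ ^ k) / 2 * ‖X - Y‖ ^ 2) := by ring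
    _ ≤ _ := by rw [h1]; gcongr; linarith

lemma inv_two_pow_le_quotient (hn : 2 ≤ n) {X Y : EuclideanSpace ℝ (Fin n)} (h : X ≠ Y) :
    (2 ^ (n - 1))⁻¹ ≤ ⟪‖X‖ ^ (n - 2) • X - ‖Y‖ ^ (n - 2) • Y, X - Y⟫_ℝ / ‖X - Y‖ ^ n := by
  have h1 : 0 < ‖X - Y‖ := norm_pos_iff.2 (sub_ne_zero.2 h)
  rw [le_div_iff₀ (by positivity), inv_mul_le_iff₀ (by positivity)]
  exact norm_sub_pow_le_inner hn X Y

lemma dconst_pos (hn : 2 ≤ n) : 0 < dconst n := by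
  have : Nonempty (Fin n) := ⟨⟨0, by omega⟩⟩
  obtain ⟨X, hX⟩ := exists_ne (0 : EuclideanSpace ℝ (Fin n))
  refine lt_of_lt_of_le (by positivity : (0 : ℝ) < (2 ^ (n - 1))⁻¹)
    (le_csInf ⟨_, X, 0, hX, rfl⟩ ?_)
  rintro c ⟨X, Y, hXY, rfl⟩
  exact inv_two_pow_le_quotient hn hXY

lemma dconst_mul_le (hn : 2 ≤ n) (X Y : EuclideanSpace ℝ (Fin n)) :
    dconst n * ‖X - Y‖ ^ n ≤ ⟪‖X‖ ^ (n - 2) • X - ‖Y‖ ^ (n - 2) • Y, X - Y⟫_ℝ := by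
  rcases eq_or_ne X Y with rfl | h
  · simp [zero_pow (by omega : n ≠ 0)]
  have h1 : 0 < ‖X - Y‖ := norm_pos_iff.2 (sub_ne_zero.2 h)
  rw [← le_div_iff₀ (by positivity)]
  refine csInf_le ⟨0, ?_⟩ ⟨X, Y, h, rfl⟩
  rintro c ⟨X, Y, hXY, rfl⟩
  exact le_trans (by positivity) (inv_two_pow_le_quotient hn hXY)

end Structure

section Instantiate

variable {n : ℕ} {r : ℝ}

lemma exists_lintegral_shell_le (hn : 2 ≤ n) {h : EuclideanSpace ℝ (Fin n) → ℝ}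
    (hh : ContDiffOn ℝ 1 h (ball 0 r \ {0}))
    (hsol : ∀ φ : EuclideanSpace ℝ (Fin n) → ℝ, ContDiff ℝ 1 φ → HasCompactSupport φ →
      tsupport φ ⊆ ball 0 r → φ 0 = 0 → ∫ x in ball 0 r, fderiv ℝ φ x (nFlux h x) = 0)
    {c C : ℝ} (hlog : ∀ x ∈ ball (0 : EuclideanSpace ℝ (Fin n)) r, x ≠ 0 →
      |h x - c * Real.log ‖x‖| ≤ C) :
    ∃ D : ENNReal, D ≠ ⊤ ∧ ∀ ρ : ℝ, 0 < ρ → 6 * ρ < r →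
      ∫⁻ x in shell n ρ, ENNReal.ofReal ‖gradient h x‖ ^ n ≤ D := by
  have hnR : (2 : ℝ) ≤ n := by exact_mod_cast hn
  obtain ⟨M, hM, hcut⟩ := exists_annulus_cutoff (n := n) (by omega)
  have hl6 : 0 ≤ Real.log 6 := Real.log_nonneg (by norm_num)
  have hl4 : 0 ≤ Real.log (4 * n) := Real.log_nonneg (by linarith)
  set K : ℝ := |C| + |c| * (Real.log 6 + Real.log (4 * n)) with hK
  have hK0 : 0 ≤ K := by positivity
  refine ⟨ENNReal.ofReal (2 * (2 * (n * K * M)) ^ n * 6 ^ n) *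
    volume (ball (0 : EuclideanSpace ℝ (Fin n)) 1),
    ENNReal.mul_ne_top ENNReal.ofReal_ne_top measure_ball_lt_top.ne, fun ρ hρ hρr => ?_⟩
  obtain ⟨ξ, hξ, hξ0, hξ1, h1, h2, hL⟩ := hcut ρ hρ
  refine (lintegral_shell_gradient_le (k := c * Real.log ρ) hn hK0 hρ hρr hh hsol ?_ hξ hξ0 hξ1
    h1 h2 hL).trans ?_
  · intro x hx1 hx2
    have hx0 : 0 < ‖x‖ := lt_of_lt_of_le (by positivity) hx1
    have h3 := hlog x (by rw [mem_ball_zero_iff]; linarith) (norm_pos_iff.1 hx0)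
    have h4 : Real.log ‖x‖ ≤ Real.log 6 + Real.log ρ := by
      rw [← Real.log_mul (by norm_num) hρ.ne']
      exact Real.log_le_log hx0 hx2
    have h5 : Real.log ρ - Real.log (4 * n) ≤ Real.log ‖x‖ := by
      rw [← Real.log_div hρ.ne' (by positivity)]
      exact Real.log_le_log (by positivity) hx1
    have h6 : |Real.log ‖x‖ - Real.log ρ| ≤ Real.log 6 + Real.log (4 * n) :=
      abs_le.2 ⟨by linarith, by linarith⟩
    calc |h x - c * Real.log ρ|
        = |(h x - c * Real.log ‖x‖) + c * (Real.log ‖x‖ - Real.log ρ)| := by congr 1; ring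
      _ ≤ |h x - c * Real.log ‖x‖| + |c| * |Real.log ‖x‖ - Real.log ρ| := by
          rw [← abs_mul]; exact abs_add_le _ _
      _ ≤ K :=
          add_le_add (h3.trans (le_abs_self C)) (mul_le_mul_of_nonneg_left h6 (abs_nonneg c))
  · have : Nonempty (Fin n) := ⟨⟨0, by omega⟩⟩
    rw [Measure.addHaar_ball volume 0 (by positivity : 0 ≤ 6 * ρ), finrank_euclideanSpace_fin,
      ← mul_assoc, ← ENNReal.ofReal_mul (by positivity)]
    refine le_of_eq ?_
    congr 2
    have e : 2 * (n * K * (M / ρ)) = 2 * (n * K * M) / ρ := by ring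
    rw [e, div_pow, mul_pow 6 ρ]
    field_simp

lemma measurable_gradient (h : EuclideanSpace ℝ (Fin n) → ℝ) : Measurable (gradient h) :=
  (LinearIsometryEquiv.continuous _).measurable.comp (measurable_fderiv ℝ h)

lemma measurable_nFlux (h : EuclideanSpace ℝ (Fin n) → ℝ) : Measurable (nFlux h) :=
  ((measurable_gradient h).norm.pow_const _).smul (measurable_gradient h)

lemma integrableOn_fderiv_nFlux (hn : 2 ≤ n) {h φ : EuclideanSpace ℝ (Fin n) → ℝ}
    (hq : ∀ q : ℝ, 1 ≤ q → q < n →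
      IntegrableOn (fun x => ‖gradient h x‖ ^ q) (ball (0 : EuclideanSpace ℝ (Fin n)) r))
    (hφ : ContDiff ℝ 1 φ) (hc : HasCompactSupport φ) :
    IntegrableOn (fun x => fderiv ℝ φ x (nFlux h x)) (ball 0 r) := by
  have hnR : (2 : ℝ) ≤ n := by exact_mod_cast hn
  obtain ⟨M, hM⟩ := (hc.fderiv (𝕜 := ℝ)).exists_bound_of_continuous
    (hφ.continuous_fderiv one_ne_zero)
  have h1 := (hq ((n : ℝ) - 1) (by linarith) (by linarith)).const_mul M
  refine Integrable.mono' h1 ?_ (Eventually.of_forall fun x => ?_)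
  · have hm : StronglyMeasurable fun x => fderiv ℝ φ x (nFlux h x) :=
      (isBoundedBilinearMap_apply (𝕜 := ℝ) (E := EuclideanSpace ℝ (Fin n)) (F := ℝ)
        |>.continuous.comp_stronglyMeasurable
        ((hφ.continuous_fderiv one_ne_zero).stronglyMeasurable.prodMk
          (measurable_nFlux h).stronglyMeasurable))
    exact hm.aestronglyMeasurable
  · refine ((fderiv ℝ φ x).le_opNorm _).trans ?_
    have e : ‖gradient h x‖ ^ ((n : ℝ) - 1) = ‖gradient h x‖ ^ (n - 1) := by
      rw [← Real.rpow_natCast]; congr 1; push_cast [Nat.cast_sub (by omega : 1 ≤ n)]; rfl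
    rw [norm_nFlux hn, e]
    gcongr
    exact hM x

lemma integrableOn_add_rpow {h g : EuclideanSpace ℝ (Fin n) → ℝ} {q : ℝ} (hq : 0 ≤ q)
    {G : EuclideanSpace ℝ (Fin n) → ℝ} {A : Set (EuclideanSpace ℝ (Fin n))}
    (hg : IntegrableOn (fun x => g x ^ q) A) (hh : IntegrableOn (fun x => h x ^ q) A)
    (hG : Measurable G) (hG0 : ∀ x, 0 ≤ G x) (hg0 : ∀ x, 0 ≤ g x) (hh0 : ∀ x, 0 ≤ h x)
    (hle : ∀ᵐ x ∂(volume.restrict A), G x ≤ g x + 2 * h x) :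
    IntegrableOn (fun x => G x ^ q) A := by
  refine Integrable.mono' ((hg.add hh).const_mul (3 ^ q))
    (hG.pow_const q).aestronglyMeasurable ?_
  filter_upwards [hle] with x hx
  rw [Real.norm_of_nonneg (Real.rpow_nonneg (hG0 x) _), Pi.add_apply]
  have h1 := Real.rpow_nonneg (hg0 x) q
  have h2 := Real.rpow_nonneg (hh0 x) q
  rcases le_total (g x) (h x) with hc | hc
  · calc G x ^ q ≤ (3 * h x) ^ q := Real.rpow_le_rpow (hG0 x) (by linarith) hq
      _ = 3 ^ q * h x ^ q := Real.mul_rpow (by norm_num) (hh0 x)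
      _ ≤ _ := by gcongr; linarith
  · calc G x ^ q ≤ (3 * g x) ^ q := Real.rpow_le_rpow (hG0 x) (by linarith) hq
      _ = 3 ^ q * g x ^ q := Real.mul_rpow (by norm_num) (hg0 x)
      _ ≤ _ := by gcongr; linarith

end Instantiate

section Difference

variable {n : ℕ} {α r γ p : ℝ} {u h : EuclideanSpace ℝ (Fin n) → ℝ}

/-- The density `|x|^{nα} e^u` on the punctured ball, extended by zero. -/
noncomputable def expDensity (n : ℕ) (α r : ℝ) (u : EuclideanSpace ℝ (Fin n) → ℝ) :
    EuclideanSpace ℝ (Fin n) → ℝ :=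
  (ball (0 : EuclideanSpace ℝ (Fin n)) r \ {0}).indicator
    fun x => ‖x‖ ^ ((n : ℝ) * α) * Real.exp (u x)

lemma expDensity_nonneg (x : EuclideanSpace ℝ (Fin n)) : 0 ≤ expDensity n α r u x :=
  indicator_nonneg (fun x _ => mul_nonneg (Real.rpow_nonneg (norm_nonneg x) _)
    (Real.exp_pos _).le) x

lemma measurable_expDensity (hu : ContinuousOn u (ball 0 r \ {0})) :
    Measurable (expDensity n α r u) := by
  classical
  rw [expDensity, ← Set.piecewise_eq_indicator]
  refine ContinuousOn.measurable_piecewise ?_ continuousOn_const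
    (isOpen_ball.sdiff isClosed_singleton).measurableSet
  exact (continuous_norm.continuousOn.rpow_const fun x hx =>
    Or.inl (norm_ne_zero_iff.2 hx.2)).mul (Real.continuous_exp.comp_continuousOn hu)

lemma expDensity_ae_eq (hn : 2 ≤ n) :
    ∀ᵐ x ∂(volume.restrict (ball (0 : EuclideanSpace ℝ (Fin n)) r)),
      expDensity n α r u x = ‖x‖ ^ ((n : ℝ) * α) * Real.exp (u x) := by
  have : Nonempty (Fin n) := ⟨⟨0, by omega⟩⟩
  have hae : ∀ᵐ x ∂(volume.restrict (ball (0 : EuclideanSpace ℝ (Fin n)) r)), x ≠ 0 :=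
    ae_restrict_of_ae (by simp [ae_iff])
  filter_upwards [hae, ae_restrict_mem measurableSet_ball] with x hx0 hx
  exact indicator_of_mem (s := ball (0 : EuclideanSpace ℝ (Fin n)) r \ {0}) ⟨hx, hx0⟩ _

lemma expDensity_rpow_ae_eq (hn : 2 ≤ n) :
    ∀ᵐ x ∂(volume.restrict (ball (0 : EuclideanSpace ℝ (Fin n)) r)),
      ‖x‖ ^ ((n : ℝ) * p * α) * Real.exp (p * u x) = expDensity n α r u x ^ p := by
  filter_upwards [expDensity_ae_eq (α := α) (u := u) hn] with x hx
  rw [hx, Real.mul_rpow (Real.rpow_nonneg (norm_nonneg x) _) (Real.exp_pos _).le,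
    ← Real.rpow_mul (norm_nonneg x), ← Real.exp_mul]
  congr 2 <;> ring

lemma fderiv_sub_apply_nFlux_sub {x : EuclideanSpace ℝ (Fin n)} (hu : DifferentiableAt ℝ u x)
    (hh : DifferentiableAt ℝ h x) :
    ‖fderiv ℝ (fun y => u y - h y) x‖ = ‖gradient u x - gradient h x‖ ∧
      fderiv ℝ (fun y => u y - h y) x (nFlux u x - nFlux h x) =
        ⟪nFlux u x - nFlux h x, gradient u x - gradient h x⟫_ℝ := by
  have e : gradient u x - gradient h x = gradient (fun y => u y - h y) x := by
    rw [gradient, gradient, gradient, fderiv_fun_sub hu hh, map_sub]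
  rw [e, norm_gradient_eq, real_inner_comm]
  exact ⟨rfl, InnerProductSpace.toDual_symm_apply.symm⟩

lemma singularData_sub (hn : 2 ≤ n) (hr : 0 < r) (hp : 1 < p)
    (hu : ContDiffOn ℝ 1 u (closedBall (0 : EuclideanSpace ℝ (Fin n)) r \ {0}))
    (hint : IntegrableOn (fun x => ‖x‖ ^ ((n : ℝ) * p * α) * Real.exp (p * u x))
      (ball (0 : EuclideanSpace ℝ (Fin n)) r))
    (huq : ∀ q : ℝ, 1 ≤ q → q < n →
      IntegrableOn (fun x => ‖gradient u x‖ ^ q) (ball (0 : EuclideanSpace ℝ (Fin n)) r))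
    (husol : ∀ φ : EuclideanSpace ℝ (Fin n) → ℝ, ContDiff ℝ 1 φ → HasCompactSupport φ →
        tsupport φ ⊆ ball (0 : EuclideanSpace ℝ (Fin n)) r →
      ∫ x in ball (0 : EuclideanSpace ℝ (Fin n)) r, fderiv ℝ φ x (nFlux u x)
        = (∫ x in ball (0 : EuclideanSpace ℝ (Fin n)) r,
            ‖x‖ ^ ((n : ℝ) * α) * Real.exp (u x) * φ x) - γ * φ 0)
    (hh : ContDiffOn ℝ 1 h (closedBall (0 : EuclideanSpace ℝ (Fin n)) r \ {0}))
    (hhq : ∀ q : ℝ, 1 ≤ q → q < n →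
      IntegrableOn (fun x => ‖gradient h x‖ ^ q) (ball (0 : EuclideanSpace ℝ (Fin n)) r))
    (hbdry : ∀ x ∈ sphere (0 : EuclideanSpace ℝ (Fin n)) r, h x = u x)
    (hlog : ∃ C : ℝ, ∀ x ∈ ball (0 : EuclideanSpace ℝ (Fin n)) r, x ≠ 0 →
      |h x - cgamma n γ * Real.log ‖x‖| ≤ C)
    (hhsol : ∀ φ : EuclideanSpace ℝ (Fin n) → ℝ, ContDiff ℝ 1 φ → HasCompactSupport φ →
        tsupport φ ⊆ ball (0 : EuclideanSpace ℝ (Fin n)) r →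
      ∫ x in ball (0 : EuclideanSpace ℝ (Fin n)) r, fderiv ℝ φ x (nFlux h x) = -(γ * φ 0)) :
    SingularData n r p (dconst n) (fun x => u x - h x) (expDensity n α r u)
      (fun x => ‖gradient h x‖) (fun x => nFlux u x - nFlux h x) := by
  have hsub : ball (0 : EuclideanSpace ℝ (Fin n)) r \ {0} ⊆ closedBall 0 r \ {0} :=
    sdiff_subset_sdiff_left ball_subset_closedBall
  have hu' := hu.mono hsub
  have hh' := hh.mono hsub
  have hopen : IsOpen (ball (0 : EuclideanSpace ℝ (Fin n)) r \ {0}) :=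
    isOpen_ball.sdiff isClosed_singleton
  have : Nonempty (Fin n) := ⟨⟨0, by omega⟩⟩
  have hdiff : ∀ {g : EuclideanSpace ℝ (Fin n) → ℝ} {x : EuclideanSpace ℝ (Fin n)},
      ContDiffOn ℝ 1 g (ball 0 r \ {0}) → x ∈ ball (0 : EuclideanSpace ℝ (Fin n)) r \ {0} →
        DifferentiableAt ℝ g x :=
    fun hg hx => (hg.differentiableOn one_ne_zero).differentiableAt (hopen.mem_nhds hx)
  have hae : ∀ᵐ x ∂(volume.restrict (ball (0 : EuclideanSpace ℝ (Fin n)) r)),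
      x ∈ ball (0 : EuclideanSpace ℝ (Fin n)) r \ {0} := by
    have hae0 : ∀ᵐ x ∂(volume.restrict (ball (0 : EuclideanSpace ℝ (Fin n)) r)), x ≠ 0 :=
      ae_restrict_of_ae (by simp [ae_iff])
    filter_upwards [hae0, ae_restrict_mem measurableSet_ball] with x hx0 hx using ⟨hx, hx0⟩
  have hnorm : ∀ x ∈ ball (0 : EuclideanSpace ℝ (Fin n)) r \ {0},
      ‖fderiv ℝ (fun y => u y - h y) x‖ = ‖gradient u x - gradient h x‖ := fun x hx =>
    (fderiv_sub_apply_nFlux_sub (hdiff hu' hx) (hdiff hh' hx)).1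
  refine
    { two_le := hn
      r_pos := hr
      one_lt := hp
      d_pos := dconst_pos hn
      w_diff := hu'.sub hh'
      w_cont := hu.continuousOn.sub hh.continuousOn
      w_bdry := fun x hx => sub_eq_zero.2 (hbdry x (by simpa using hx)).symm
      V_cont := (continuousOn_nFlux hu').sub (continuousOn_nFlux hh')
      H_cont := (continuousOn_gradient hh').norm
      H_nonneg := fun x => norm_nonneg _
      V_le := fun x hx => ?_
      V_ge := fun x hx => ?_
      grad_int := fun q hq hqn => ?_
      f_nonneg := expDensity_nonneg
      f_meas := measurable_expDensity hu'.continuousOn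
      f_pow := hint.congr (expDensity_rpow_ae_eq hn)
      weak := fun φ hφ hc ht => ?_
      H_shell := ?_ }
  · rw [hnorm x hx]
    have h1 : ‖gradient u x‖ ≤ ‖gradient u x - gradient h x‖ + ‖gradient h x‖ := by
      simpa using norm_add_le (gradient u x - gradient h x) (gradient h x)
    have h2 : ‖gradient h x‖ ≤ ‖gradient u x - gradient h x‖ + ‖gradient h x‖ :=
      le_add_of_nonneg_left (norm_nonneg _)
    refine (norm_sub_le _ _).trans ?_
    rw [norm_nFlux hn, norm_nFlux hn, two_mul]
    exact add_le_add (pow_le_pow_left₀ (norm_nonneg _) h1 _)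
      (pow_le_pow_left₀ (norm_nonneg _) h2 _)
  · rw [(fderiv_sub_apply_nFlux_sub (hdiff hu' hx) (hdiff hh' hx)).2, hnorm x hx]
    exact dconst_mul_le hn _ _
  · refine integrableOn_add_rpow (by linarith) (huq q hq hqn) (hhq q hq hqn)
      ((measurable_fderiv ℝ _).norm.add (measurable_gradient h).norm)
      (fun x => by positivity) (fun x => norm_nonneg _) (fun x => norm_nonneg _) ?_
    filter_upwards [hae] with x hx
    rw [hnorm x hx]
    linarith [norm_sub_le (gradient u x) (gradient h x)]
  · have h1 : ∫ x in ball (0 : EuclideanSpace ℝ (Fin n)) r, expDensity n α r u x * φ x =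
        ∫ x in ball (0 : EuclideanSpace ℝ (Fin n)) r,
          ‖x‖ ^ ((n : ℝ) * α) * Real.exp (u x) * φ x := by
      refine integral_congr_ae ?_
      filter_upwards [expDensity_ae_eq (α := α) (u := u) hn] with x hx
      rw [hx]
    simp_rw [map_sub]
    rw [integral_sub (integrableOn_fderiv_nFlux hn huq hφ hc)
      (integrableOn_fderiv_nFlux hn hhq hφ hc), husol φ hφ hc ht, hhsol φ hφ hc ht, h1]
    ring
  · obtain ⟨C, hC⟩ := hlog
    exact exists_lintegral_shell_le hn hh'
      (fun φ hφ hc ht h0 => by rw [hhsol φ hφ hc ht, h0, mul_zero, neg_zero]) hC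

end Difference

theorem moser_iteration_estimate
    (n : ℕ) (hn : 2 ≤ n) (α r γ p : ℝ) (hr : 0 < r) (hr1 : r ≤ 1) (hp : 1 < p)
    (u h : EuclideanSpace ℝ (Fin n) → ℝ)
    (hu : ContDiffOn ℝ 1 u (closedBall (0 : EuclideanSpace ℝ (Fin n)) r \ {0}))
    (hint : IntegrableOn (fun x => ‖x‖ ^ ((n : ℝ) * p * α) * Real.exp (p * u x))
      (ball (0 : EuclideanSpace ℝ (Fin n)) r))
    (huq : ∀ q : ℝ, 1 ≤ q → q < n →
      IntegrableOn (fun x => ‖gradient u x‖ ^ q) (ball (0 : EuclideanSpace ℝ (Fin n)) r))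
    (husol : ∀ φ : EuclideanSpace ℝ (Fin n) → ℝ, ContDiff ℝ 1 φ → HasCompactSupport φ →
        tsupport φ ⊆ ball (0 : EuclideanSpace ℝ (Fin n)) r →
      ∫ x in ball (0 : EuclideanSpace ℝ (Fin n)) r,
          ‖gradient u x‖ ^ (n - 2) * ⟪gradient u x, gradient φ x⟫_ℝ
        = (∫ x in ball (0 : EuclideanSpace ℝ (Fin n)) r,
            ‖x‖ ^ ((n : ℝ) * α) * Real.exp (u x) * φ x) - γ * φ 0)
    (hh : ContDiffOn ℝ 1 h (closedBall (0 : EuclideanSpace ℝ (Fin n)) r \ {0}))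
    (hhq : ∀ q : ℝ, 1 ≤ q → q < n →
      IntegrableOn (fun x => ‖gradient h x‖ ^ q) (ball (0 : EuclideanSpace ℝ (Fin n)) r))
    (hbdry : ∀ x ∈ sphere (0 : EuclideanSpace ℝ (Fin n)) r, h x = u x)
    (hlog : ∃ C : ℝ, ∀ x ∈ ball (0 : EuclideanSpace ℝ (Fin n)) r, x ≠ 0 →
      |h x - cgamma n γ * Real.log ‖x‖| ≤ C)
    (hhsol : ∀ φ : EuclideanSpace ℝ (Fin n) → ℝ, ContDiff ℝ 1 φ → HasCompactSupport φ →
        tsupport φ ⊆ ball (0 : EuclideanSpace ℝ (Fin n)) r →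
      ∫ x in ball (0 : EuclideanSpace ℝ (Fin n)) r,
          ‖gradient h x‖ ^ (n - 2) * ⟪gradient h x, gradient φ x⟫_ℝ
        = -(γ * φ 0)) :
    let m : ℝ := p / (p - 1)
    ∃ C : ℝ, 0 < C ∧ ∀ q : ℝ, 1 ≤ q →
      (∫ x in ball (0 : EuclideanSpace ℝ (Fin n)) r,
            (u x - h x) ^ (2 * m * (n : ℝ) * q)) ^ (1 / (2 * m))
        ≤ C * q ^ (n - 1) / dconst n *
            (volume (ball (0 : EuclideanSpace ℝ (Fin n)) r)).toReal ^
              (((n : ℝ) - 1) / (m * (n : ℝ) * q)) *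
            (∫ x in ball (0 : EuclideanSpace ℝ (Fin n)) r,
              ‖x‖ ^ ((n : ℝ) * p * α) * Real.exp (p * u x)) ^ (1 / p) *
            (∫ x in ball (0 : EuclideanSpace ℝ (Fin n)) r,
              (u x - h x) ^ (m * (n : ℝ) * q)) ^
                (((n : ℝ) * (q - 1) + 1) / (m * (n : ℝ) * q)) := by
  simp_rw [norm_pow_mul_inner_gradient] at husol hhsol
  intro m
  have S := singularData_sub hn hr hp hu hint huq husol hh hhq hbdry hlog hhsol
  obtain ⟨C, hC, hle⟩ := S.moser_le
  refine ⟨C, hC, fun q hq => ?_⟩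
  rw [integral_congr_ae (expDensity_rpow_ae_eq (α := α) (u := u) (p := p) hn)]
  exact hle q hq
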